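/- Let M ⊂ ℝ² be a compact topological 2-manifold with boundary, let K ⊂ M be a compact subset containing the boundary of M, and let h : M → M be a homeomorphism which restricts to a C^r diffeomorphism (r ≥ 1) on an open neighbourhood of K in M. Then for every ε > 0 there is a homeomorphism g : M → M such that sup_{x∈M} |g(x) − h(x)| < ε, g agrees with h on some neighbourhood of K, and g restricts to a C^r diffeomorphism of the interior of M onto itself. -/

import Mathlib

open Set

noncomputable section

/-- `M ⊆ ℝ²` is a topological 2-manifold with boundary: every point has a neighbourhood
in `M` homeomorphic either to the plane or to the closed half-plane.  (For such a
compact subset of `ℝ²` the manifold interior coincides with the topological interior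
`interior M`, and the manifold boundary with `M \ interior M`.) -/
def IsTopManifoldWithBoundary2 (M : Set (ℝ × ℝ)) : Prop :=
  ∀ p ∈ M, ∃ U : Set (ℝ × ℝ), IsOpen U ∧ p ∈ U ∧
    (Nonempty ((M ∩ U : Set (ℝ × ℝ)) ≃ₜ (ℝ × ℝ)) ∨
     Nonempty ((M ∩ U : Set (ℝ × ℝ)) ≃ₜ {q : ℝ × ℝ | 0 ≤ q.2}))

open Metric Filter Topology Complex in
/-- The identity of the unit circle has no continuous logarithm. -/
theorem not_exists_log_circle :
    ¬ ∃ L : ℂ → ℂ, ContinuousOn L (sphere 0 1) ∧ ∀ z ∈ sphere (0:ℂ) 1, exp (L z) = z := by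
  rintro ⟨L, hL, hexp⟩
  let k : ℝ → ℝ := fun t => ((L (exp (t * I)) - t * I) / (2 * Real.pi * I)).re
  have hmem : ∀ t : ℝ, exp (t * I) ∈ sphere (0:ℂ) 1 := fun t => by
    simp [Complex.norm_exp_ofReal_mul_I]
  have hk : Continuous k := by
    have h1 : Continuous fun t : ℝ => L (exp (t * I)) :=
      hL.comp_continuous (by fun_prop) hmem
    exact Complex.continuous_re.comp ((h1.sub (by fun_prop)).div_const _)
  have h_intg : ∀ t, ∃ n : ℤ, k t = n := fun t => by
    have h1 := hexp _ (hmem t)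
    obtain ⟨n, hn⟩ := Complex.exp_eq_exp_iff_exists_int.1 h1
    refine ⟨n, ?_⟩
    have : (L (exp (t * I)) - t * I) / (2 * Real.pi * I) = n := by
      rw [hn]
      have : (2 * Real.pi * I : ℂ) ≠ 0 := Complex.two_pi_I_ne_zero
      field_simp
      ring
    simp only [k, this]
    simp
  have h0 : k (2 * Real.pi) = k 0 - 1 := by
    simp only [k]
    push_cast
    rw [Complex.exp_two_pi_mul_I]
    have : (2 * Real.pi * I : ℂ) ≠ 0 := Complex.two_pi_I_ne_zero
    simp only [zero_mul, Complex.exp_zero, sub_zero]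
    rw [sub_div, div_self this]
    simp
  have : (k 0 - 1 / 2) ∈ Icc (k (2 * Real.pi)) (k 0) := by
    rw [h0]; constructor <;> linarith
  obtain ⟨t, -, ht⟩ := intermediate_value_Icc' (by positivity) hk.continuousOn this
  obtain ⟨n, hn⟩ := h_intg t
  obtain ⟨m, hm⟩ := h_intg 0
  have : ((2 * n - 2 * m : ℤ) : ℝ) = ((-1 : ℤ) : ℝ) := by
    push_cast; linarith
  have := Int.cast_injective this
  omega

open Metric in
theorem continuous_mul_inv_max : Continuous fun z : ℂ => (((max 1 ‖z‖)⁻¹ : ℝ) : ℂ) * z := by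
  have : ∀ z : ℂ, max 1 ‖z‖ ≠ 0 := fun z => (lt_of_lt_of_le one_pos (le_max_left _ _)).ne'
  have h : Continuous fun z : ℂ => (max 1 ‖z‖)⁻¹ :=
    (continuous_const.max continuous_norm).inv₀ this
  exact (Complex.continuous_ofReal.comp h).mul continuous_id

open Metric in
theorem mul_inv_max_mem (z : ℂ) :
    (((max 1 ‖z‖)⁻¹ : ℝ) : ℂ) * z ∈ closedBall (0:ℂ) 1 := by
  have h : 0 < max 1 ‖z‖ := lt_of_lt_of_le one_pos (le_max_left _ _)
  rw [mem_closedBall_zero_iff, norm_mul, Complex.norm_real, norm_inv, Real.norm_of_nonneg h.le,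
    inv_mul_le_iff₀ h, mul_one]
  exact le_max_right _ _

open Metric in
theorem mul_inv_max_eq {z : ℂ} (hz : z ∈ closedBall (0:ℂ) 1) :
    (((max 1 ‖z‖)⁻¹ : ℝ) : ℂ) * z = z := by
  rw [mem_closedBall_zero_iff] at hz
  simp [max_eq_left hz]

open Metric in
theorem exists_log_closedBall {g : ℂ → ℂ} (hg : ContinuousOn g (closedBall 0 1))
    (h0 : ∀ z ∈ closedBall (0:ℂ) 1, g z ≠ 0) :
    ∃ L : ℂ → ℂ, ContinuousOn L (closedBall 0 1) ∧
      ∀ z ∈ closedBall (0:ℂ) 1, Complex.exp (L z) = g z := by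
  have hs : IsSimplyConnected (univ : Set ℂ) := by
    have : ContractibleSpace (univ : Set ℂ) :=
      convex_univ.contractibleSpace univ_nonempty
    exact (inferInstance : SimplyConnectedSpace (univ : Set ℂ))
  obtain ⟨L, hL, h⟩ := Complex.exists_continuousOn_eqOn_exp_comp hs isOpen_univ
    (g := fun z => g ((((max 1 ‖z‖)⁻¹ : ℝ) : ℂ) * z))
    (hg.comp_continuous continuous_mul_inv_max mul_inv_max_mem).continuousOn
    (by rintro ⟨z, -, hz⟩; exact h0 _ (mul_inv_max_mem z) hz)
  refine ⟨L, hL.mono (subset_univ _), fun z hz => ?_⟩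
  have := h (mem_univ z)
  simp only [Function.comp, mul_inv_max_eq hz] at this
  exact this

open Metric in
theorem exists_zero_of_near_id {g : ℂ → ℂ} (hg : ContinuousOn g (closedBall 0 1))
    (hnear : ∀ z ∈ sphere (0:ℂ) 1, ‖g z - z‖ < 1) : ∃ z ∈ closedBall (0:ℂ) 1, g z = 0 := by
  by_contra! h0
  obtain ⟨L, hL, hexp⟩ := exists_log_closedBall hg h0
  have hsl : ∀ z ∈ sphere (0:ℂ) 1, g z / z ∈ Complex.slitPlane := fun z hz => by
    have hz1 : ‖z‖ = 1 := by simpa using hz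
    have hz0 : z ≠ 0 := by rintro rfl; simp at hz1
    have : ‖g z / z - 1‖ < 1 := by
      rw [div_sub_one hz0, norm_div, hz1, div_one]; exact hnear z hz
    have h2 := Complex.abs_re_le_norm (g z / z - 1)
    left
    have := abs_lt.1 (lt_of_le_of_lt h2 this)
    simp only [Complex.sub_re, Complex.one_re] at this
    linarith [this.1]
  apply not_exists_log_circle
  refine ⟨fun z => L z - Complex.log (g z / z), ?_, fun z hz => ?_⟩
  · refine (hL.mono sphere_subset_closedBall).sub (ContinuousOn.clog ?_ hsl)
    refine (hg.mono sphere_subset_closedBall).div continuousOn_id ?_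
    rintro z hz rfl; simp at hz
  · have hz1 : ‖z‖ = 1 := by simpa using hz
    have hz0 : z ≠ 0 := by rintro rfl; simp at hz1
    have hg0 := h0 z (sphere_subset_closedBall hz)
    rw [Complex.exp_sub, hexp z (sphere_subset_closedBall hz),
      Complex.exp_log (div_ne_zero hg0 hz0)]
    field_simp

open Metric in
theorem mem_interior_image_closedBall {f : ℂ → ℂ} (hf : ContinuousOn f (closedBall 0 1))
    (hinj : InjOn f (closedBall 0 1)) : f 0 ∈ interior (f '' closedBall 0 1) := by
  by_contra hq
  set X := f '' closedBall (0:ℂ) 1 with hX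
  have hXc : IsCompact X := (isCompact_closedBall _ _).image_of_continuousOn hf
  -- a continuous extension of the inverse
  obtain ⟨G, hG⟩ : ∃ G : C(ℂ, ℂ), ∀ z ∈ closedBall (0:ℂ) 1, G (f z) = z := by
    let e : closedBall (0:ℂ) 1 → X := fun z => ⟨f z, mem_image_of_mem f z.2⟩
    have he : Continuous e := (continuousOn_iff_continuous_domRestrict.1 hf).subtype_mk _
    have hb : Function.Bijective e := by
      constructor
      · intro a b hab
        exact Subtype.ext (hinj a.2 b.2 (congrArg Subtype.val hab))
      · rintro ⟨y, z, hz, rfl⟩; exact ⟨⟨z, hz⟩, rfl⟩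
    have : CompactSpace (closedBall (0:ℂ) 1) := isCompact_iff_compactSpace.1 (isCompact_closedBall _ _)
    let E : closedBall (0:ℂ) 1 ≃ₜ X :=
      Continuous.homeoOfEquivCompactToT2 (f := Equiv.ofBijective e hb) he
    let g : C(X, ℂ) := ⟨fun y => (E.symm y : ℂ), by fun_prop⟩
    obtain ⟨G, hG⟩ := ContinuousMap.exists_restrict_eq hXc.isClosed g
    refine ⟨G, fun z hz => ?_⟩
    have h1 := DFunLike.congr_fun hG ⟨f z, mem_image_of_mem f hz⟩
    have h2 : E.symm (E ⟨z, hz⟩) = ⟨z, hz⟩ := E.symm_apply_apply _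
    exact h1.trans (congrArg Subtype.val h2)
  have h0 : (0:ℂ) ∈ closedBall (0:ℂ) 1 := by simp
  have hG0 : G (f 0) = 0 := hG 0 h0
  obtain ⟨ρ, hρ, hGρ⟩ : ∃ ρ > 0, ∀ y ∈ ball (f 0) ρ, ‖G y‖ < 1 := by
    have := Metric.continuous_iff.1 G.continuous (f 0) 1 one_pos
    obtain ⟨ρ, hρ, h⟩ := this
    exact ⟨ρ, hρ, fun y hy => by simpa [hG0] using h y hy⟩
  obtain ⟨c, hcX, hcq⟩ : ∃ c, c ∉ X ∧ dist c (f 0) < ρ / 2 := by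
    by_contra! hc
    apply hq
    rw [mem_interior_iff_mem_nhds, Metric.mem_nhds_iff]
    refine ⟨ρ / 2, by positivity, fun y hy => ?_⟩
    by_contra hy'
    exact absurd (hc y hy') (not_le.2 hy)
  obtain ⟨m, hm, hmG⟩ : ∃ m > 0, ∀ y ∈ X, y ∉ ball c (ρ / 2) → m ≤ ‖G y‖ := by
    have hK : IsCompact (X \ ball c (ρ / 2)) := hXc.diff isOpen_ball
    rcases (X \ ball c (ρ / 2)).eq_empty_or_nonempty with he | hne
    · refine ⟨1, one_pos, fun y hy hy' => ?_⟩
      exact absurd (show y ∈ X \ ball c (ρ/2) from ⟨hy, hy'⟩) (by simp [he])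
    · obtain ⟨y0, hy0, hmin⟩ := hK.exists_isMinOn hne (f := fun y => ‖G y‖) (by fun_prop)
      refine ⟨‖G y0‖, norm_pos_iff.2 ?_, fun y hy hy' => hmin ⟨hy, hy'⟩⟩
      obtain ⟨⟨z, hz, rfl⟩, hz'⟩ := hy0
      rw [hG z hz]
      rintro rfl
      apply hz'
      rw [mem_ball, dist_comm]; exact hcq
  set δ := min m 1 / 2 with hδ
  have hδ0 : 0 < δ := by positivity
  obtain ⟨P, hP, hPG, -⟩ := Continuous.exists_contDiff_approx (F := ℂ) (f := G) 1
    (ε := fun _ => δ) G.continuous continuous_const (fun _ => hδ0)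
  obtain ⟨v, hv, hvP⟩ : ∃ v, ‖v‖ < δ ∧ v ∉ P '' sphere c (ρ / 2) := by
    have hmeas : MeasureTheory.volume (P '' sphere c (ρ / 2)) = 0 :=
      MeasureTheory.addHaar_image_eq_zero_of_differentiableOn_of_addHaar_eq_zero _
        ((hP.differentiable (by simp)).differentiableOn)
        (MeasureTheory.Measure.addHaar_sphere _ _ _)
    by_contra! hv
    have : ball (0:ℂ) δ ⊆ P '' sphere c (ρ / 2) := fun v hv' => hv v (by simpa using hv')
    have h1 := MeasureTheory.measure_mono_null this hmeas
    exact (isOpen_ball.measure_pos MeasureTheory.volume ⟨0, by simpa using hδ0⟩).ne' h1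
  have hPv : ∀ y, ‖P y - v - G y‖ < m ∧ ‖P y - v - G y‖ < 1 := fun y => by
    have h1 : ‖P y - G y‖ < δ := by rw [← dist_eq_norm]; exact hPG y
    have h2 : ‖P y - v - G y‖ ≤ ‖P y - G y‖ + ‖v‖ := by
      rw [sub_right_comm]; exact norm_sub_le _ _
    have h3 : δ + δ = min m 1 := by rw [hδ]; ring
    have h4 := min_le_left m 1
    have h5 := min_le_right m 1
    constructor <;> linarith
  let π : ℂ → ℂ := fun y => c + ((max 1 (ρ / 2 / ‖y - c‖) : ℝ) : ℂ) * (y - c)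
  have hne : ∀ z ∈ closedBall (0:ℂ) 1, f z - c ≠ 0 := fun z hz h => by
    apply hcX; rw [← sub_eq_zero.1 h]; exact mem_image_of_mem f hz
  have hπout : ∀ y, y ∉ ball c (ρ / 2) → π y = y := fun y hy => by
    have h1 : ρ / 2 ≤ ‖y - c‖ := by rw [← dist_eq_norm]; simpa using hy
    have h2 : ρ / 2 / ‖y - c‖ ≤ 1 := div_le_one_of_le₀ h1 (norm_nonneg _)
    simp [π, max_eq_left h2]
  have hπin : ∀ y, y ∈ ball c (ρ / 2) → y - c ≠ 0 → π y ∈ sphere c (ρ / 2) := fun y hy hyc => by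
    have h1 : ‖y - c‖ < ρ / 2 := by rw [← dist_eq_norm]; simpa using hy
    have h0 : 0 < ‖y - c‖ := norm_pos_iff.2 hyc
    have h2 : 1 ≤ ρ / 2 / ‖y - c‖ := by rw [le_div_iff₀ h0]; linarith
    simp only [π, max_eq_right h2, mem_sphere, dist_eq_norm, add_sub_cancel_left, norm_mul,
      Complex.norm_real]
    rw [Real.norm_of_nonneg (by positivity)]
    field_simp
  have hcont : ContinuousOn (fun z => P (π (f z)) - v) (closedBall 0 1) := by
    have h1 : ContinuousOn (fun z => ρ / 2 / ‖f z - c‖) (closedBall 0 1) :=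
      continuousOn_const.div (hf.sub continuousOn_const).norm
        (fun z hz => norm_ne_zero_iff.2 (hne z hz))
    have h2 : ContinuousOn (fun z => π (f z)) (closedBall 0 1) := by
      refine continuousOn_const.add (ContinuousOn.mul ?_ (hf.sub continuousOn_const))
      exact Complex.continuous_ofReal.comp_continuousOn (continuousOn_const.sup h1)
    exact (hP.continuous.comp_continuousOn h2).sub continuousOn_const
  obtain ⟨z, hz, hz0⟩ := exists_zero_of_near_id hcont (by
    intro z hz
    have hz' := sphere_subset_closedBall hz
    have hout : f z ∉ ball c (ρ / 2) := fun hin => by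
      have : f z ∈ ball (f 0) ρ := by
        rw [mem_ball] at hin ⊢
        linarith [dist_triangle (f z) c (f 0)]
      have := hGρ _ this
      rw [hG z hz'] at this
      have hz1 : ‖z‖ = 1 := by simpa using hz
      linarith
    rw [hπout _ hout]
    have := (hPv (f z)).2
    rwa [hG z hz'] at this)
  by_cases hin : f z ∈ ball c (ρ / 2)
  · exact hvP ⟨π (f z), hπin _ hin (hne z hz), sub_eq_zero.1 hz0⟩
  · simp only [hπout _ hin] at hz0
    have h1 := (hPv (f z)).1
    rw [hz0, zero_sub, norm_neg] at h1
    exact absurd (hmG _ (mem_image_of_mem f hz) hin) (not_le.2 h1)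

open Metric in
/-- Invariance of domain in the plane. -/
theorem isOpen_image_of_injOn {f : ℂ → ℂ} {U : Set ℂ} (hU : IsOpen U) (hf : ContinuousOn f U)
    (hinj : InjOn f U) : IsOpen (f '' U) := by
  rw [isOpen_iff_mem_nhds]
  rintro _ ⟨x, hx, rfl⟩
  obtain ⟨ρ, hρ, hsub⟩ := Metric.nhds_basis_closedBall.mem_iff.1 (hU.mem_nhds hx)
  have hmaps : MapsTo (fun z : ℂ => x + ρ * z) (closedBall 0 1) (closedBall x ρ) := by
    intro z hz
    rw [mem_closedBall_zero_iff] at hz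
    rw [mem_closedBall, dist_eq_norm, add_sub_cancel_left, norm_mul, Complex.norm_real,
      Real.norm_of_nonneg hρ.le]
    nlinarith
  have h := mem_interior_image_closedBall (f := fun z => f (x + ρ * z))
    (hf.comp (by fun_prop) (hmaps.mono_right hsub)) (by
      intro a ha b hb hab
      have := hinj (hsub (hmaps ha)) (hsub (hmaps hb)) hab
      have hρ' : (ρ : ℂ) ≠ 0 := by exact_mod_cast hρ.ne'
      simpa [hρ'] using this)
  simp only [mul_zero, add_zero] at h
  refine Filter.mem_of_superset (mem_interior_iff_mem_nhds.1 h) ?_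
  rintro _ ⟨z, hz, rfl⟩
  exact mem_image_of_mem f (hsub (hmaps hz))

open Metric Filter Topology in
theorem isOpen_image_of_locInj {f : ℂ → ℂ} {U : Set ℂ} (hU : IsOpen U) (hf : ContinuousOn f U)
    (hloc : ∀ x ∈ U, ∃ N ∈ 𝓝 x, InjOn f N) : IsOpen (f '' U) := by
  rw [isOpen_iff_mem_nhds]
  rintro _ ⟨x, hx, rfl⟩
  obtain ⟨N, hN, hinj⟩ := hloc x hx
  have hV : IsOpen (interior N ∩ U) := isOpen_interior.inter hU
  have := isOpen_image_of_injOn hV (hf.mono inter_subset_right)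
    (hinj.mono (inter_subset_left.trans interior_subset))
  refine Filter.mem_of_superset (this.mem_nhds (mem_image_of_mem f ⟨mem_interior_iff_mem_nhds.2 hN, hx⟩))
    (image_mono inter_subset_right)

open Metric Filter Topology in
/-- If all points of the fibre over `y` lie in the open set `N`, the same holds for nearby fibres,
provided `f` is proper over `Y`. -/
theorem eventually_fiber_subset {f : ℂ → ℂ} {U Y : Set ℂ} (hY : IsOpen Y) (hf : ContinuousOn f U)
    (hprop : ∀ Q ⊆ Y, IsCompact Q → IsCompact (U ∩ f ⁻¹' Q)) {N : Set ℂ} (hN : IsOpen N)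
    {y : ℂ} (hy : y ∈ Y) (hfib : ∀ x ∈ U, f x = y → x ∈ N) :
    ∀ᶠ y' in 𝓝 y, ∀ x ∈ U, f x = y' → x ∈ N := by
  obtain ⟨ρ, hρ, hsub⟩ := Metric.nhds_basis_closedBall.mem_iff.1 (hY.mem_nhds hy)
  have h1 := (hprop _ hsub (isCompact_closedBall _ _)).diff hN
  have h2 : IsCompact (f '' ((U ∩ f ⁻¹' closedBall y ρ) \ N)) :=
    h1.image_of_continuousOn (hf.mono (sdiff_subset.trans inter_subset_left))
  have h3 : y ∉ f '' ((U ∩ f ⁻¹' closedBall y ρ) \ N) := by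
    rintro ⟨x, ⟨⟨hxU, -⟩, hxN⟩, hxy⟩
    exact hxN (hfib x hxU hxy)
  filter_upwards [h2.isClosed.isOpen_compl.mem_nhds h3, closedBall_mem_nhds y hρ] with y' h4 h5 x hx hxy
  by_contra hxN
  exact h4 ⟨x, ⟨⟨hx, by rw [mem_preimage, hxy]; exact h5⟩, hxN⟩, hxy⟩

open Metric Filter Topology in
theorem isOpen_double_points {f : ℂ → ℂ} {U : Set ℂ} (hU : IsOpen U)
    (hf : ContinuousOn f U) (hloc : ∀ x ∈ U, ∃ N ∈ 𝓝 x, InjOn f N) :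
    IsOpen {y | ∃ x ∈ U, ∃ x' ∈ U, x ≠ x' ∧ f x = y ∧ f x' = y} := by
  rw [isOpen_iff_mem_nhds]
  rintro y ⟨x, hx, x', hx', hne, rfl, hxx⟩
  obtain ⟨A, B, hA, hB, hxA, hxB, hAB⟩ := t2_separation hne
  have h1 := isOpen_image_of_locInj (hU.inter hA) (hf.mono inter_subset_left)
    (fun z hz => hloc z hz.1)
  have h2 := isOpen_image_of_locInj (hU.inter hB) (hf.mono inter_subset_left)
    (fun z hz => hloc z hz.1)
  filter_upwards [h1.mem_nhds (mem_image_of_mem f ⟨hx, hxA⟩),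
    h2.mem_nhds (hxx ▸ mem_image_of_mem f ⟨hx', hxB⟩)] with y hy1 hy2
  obtain ⟨a, ha, rfl⟩ := hy1
  obtain ⟨b, hb, hab⟩ := hy2
  exact ⟨a, ha.1, b, hb.1, fun h => disjoint_left.1 hAB ha.2 (h ▸ hb.2), rfl, hab⟩

open Metric Filter Topology in
theorem isOpen_diff_double_points {f : ℂ → ℂ} {U Y : Set ℂ} (hY : IsOpen Y)
    (hf : ContinuousOn f U) (hloc : ∀ x ∈ U, ∃ N ∈ 𝓝 x, InjOn f N)
    (hprop : ∀ Q ⊆ Y, IsCompact Q → IsCompact (U ∩ f ⁻¹' Q)) :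
    IsOpen (Y \ {y | ∃ x ∈ U, ∃ x' ∈ U, x ≠ x' ∧ f x = y ∧ f x' = y}) := by
  rw [isOpen_iff_mem_nhds]
  rintro y ⟨hy, hyE⟩
  obtain ⟨N, hN, hinj, hfib⟩ : ∃ N, IsOpen N ∧ InjOn f N ∧ ∀ x ∈ U, f x = y → x ∈ N := by
    by_cases hex : ∃ x ∈ U, f x = y
    · obtain ⟨x, hx, hxy⟩ := hex
      obtain ⟨N, hN, hinj⟩ := hloc x hx
      refine ⟨interior N, isOpen_interior, hinj.mono interior_subset, fun x' hx' hxy' => ?_⟩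
      have : x = x' := by
        by_contra hne
        exact hyE ⟨x, hx, x', hx', hne, hxy, hxy'⟩
      exact this ▸ mem_interior_iff_mem_nhds.2 hN
    · push Not at hex
      exact ⟨∅, isOpen_empty, injOn_empty _, fun x hx hxy => (hex x hx hxy).elim⟩
  filter_upwards [hY.mem_nhds hy, eventually_fiber_subset hY hf hprop hN hy hfib] with y' h1 h2
  refine ⟨h1, ?_⟩
  rintro ⟨x, hx, x', hx', hne, hxy, hxy'⟩
  exact hne (hinj (h2 x hx hxy) (h2 x' hx' hxy') (hxy.trans hxy'.symm))

open Metric Filter Topology in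
theorem isOpen_diff_image {f : ℂ → ℂ} {U Y : Set ℂ} (hY : IsOpen Y)
    (hf : ContinuousOn f U)
    (hprop : ∀ Q ⊆ Y, IsCompact Q → IsCompact (U ∩ f ⁻¹' Q)) :
    IsOpen (Y \ f '' U) := by
  rw [isOpen_iff_mem_nhds]
  rintro y ⟨hy, hyE⟩
  filter_upwards [hY.mem_nhds hy, eventually_fiber_subset hY hf hprop isOpen_empty hy
    (fun x hx hxy => hyE ⟨x, hx, hxy⟩)] with y' h1 h2
  refine ⟨h1, ?_⟩
  rintro ⟨x, hx, hxy⟩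
  exact h2 x hx hxy

open Metric Filter Topology in
theorem bijOn_of_proper_of_fiber {f : ℂ → ℂ} {U Y : Set ℂ} (hU : IsOpen U) (hY : IsOpen Y)
    (hYc : IsPreconnected Y) (hmaps : MapsTo f U Y)
    (hf : ContinuousOn f U) (hloc : ∀ x ∈ U, ∃ N ∈ 𝓝 x, InjOn f N)
    (hprop : ∀ Q ⊆ Y, IsCompact Q → IsCompact (U ∩ f ⁻¹' Q))
    {x₀ : ℂ} (hx₀ : x₀ ∈ U) (hfib : ∀ x ∈ U, f x = f x₀ → x = x₀) : BijOn f U Y := by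
  refine ⟨hmaps, fun x hx x' hx' hxx => ?_, ?_⟩
  · by_contra hne
    have h1 := isOpen_double_points hU hf hloc
    have h2 := isOpen_diff_double_points hY hf hloc hprop
    obtain ⟨z, hz, hz1, hz2⟩ := hYc _ _ h1 h2 (fun y hy => by
      by_cases h : y ∈ {y | ∃ x ∈ U, ∃ x' ∈ U, x ≠ x' ∧ f x = y ∧ f x' = y}
      · exact Or.inl h
      · exact Or.inr ⟨hy, h⟩) ⟨f x, hmaps hx, x, hx, x', hx', hne, rfl, hxx.symm⟩
      ⟨f x₀, hmaps hx₀, hmaps hx₀, by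
        rintro ⟨a, ha, b, hb, hab, h3, h4⟩
        exact hab ((hfib a ha h3).trans (hfib b hb h4).symm)⟩
    exact hz2.2 hz1
  · intro y hy
    by_contra hne
    obtain ⟨z, hz, hz1, hz2⟩ := hYc _ _ (isOpen_image_of_locInj hU hf hloc)
      (isOpen_diff_image hY hf hprop) (fun y hy => by
      by_cases h : y ∈ f '' U
      · exact Or.inl h
      · exact Or.inr ⟨hy, h⟩) ⟨f x₀, hmaps hx₀, mem_image_of_mem f hx₀⟩ ⟨y, hy, hy, hne⟩
    exact hz2.2 hz1

open Metric Filter Topology in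
theorem eq_empty_of_isOpen_of_subset_isCompact {E Y Q : Set ℂ} (hE : IsOpen E)
    (hEY : IsOpen (Y \ E)) (hQ : IsCompact Q) (hEQ : E ⊆ Q) (hQY : Q ⊆ Y) : E = ∅ := by
  have h1 : E = Q \ (Y \ E) := by
    ext x
    constructor
    · exact fun hx => ⟨hEQ hx, fun h => h.2 hx⟩
    · rintro ⟨hx, hx'⟩
      by_contra h
      exact hx' ⟨hQY hx, h⟩
  have hc : IsCompact E := h1 ▸ hQ.diff hEY
  by_contra hne
  have h2 : E = univ := IsClopen.eq_univ ⟨hc.isClosed, hE⟩ (nonempty_iff_ne_empty.2 hne)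
  exact noncompact_univ ℂ (h2 ▸ hc)

open Metric Filter Topology in
/-- A locally injective map which agrees with a homeomorphism `h : U → Y` off a compact set is
a bijection. -/
theorem bijOn_of_eqOn_compl_compact {f h : ℂ → ℂ} {U Y C : Set ℂ} (hU : IsOpen U)
    (hh : BijOn h U Y) (hhc : ContinuousOn h U)
    (hC : IsCompact C) (hCU : C ⊆ U)
    (hmaps : MapsTo f U Y) (hf : ContinuousOn f U) (hloc : ∀ x ∈ U, ∃ N ∈ 𝓝 x, InjOn f N)
    (heq : ∀ x ∈ U, x ∉ C → f x = h x) : BijOn f U Y := by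
  have hY : IsOpen Y := by
    rw [← hh.image_eq]; exact isOpen_image_of_injOn hU hhc hh.injOn
  have hproph : ∀ Q ⊆ Y, IsCompact Q → IsCompact (U ∩ h ⁻¹' Q) := by
    intro Q hQY hQ
    rw [isCompact_iff_ultrafilter_le_nhds]
    intro F hF
    rw [le_principal_iff] at hF
    obtain ⟨y, hy, hFy⟩ := isCompact_iff_ultrafilter_le_nhds.1 hQ (F.map h) (by
      rw [le_principal_iff]
      exact show h ⁻¹' Q ∈ (F : Filter ℂ) from mem_of_superset hF inter_subset_right)
    obtain ⟨x, hx, rfl⟩ := hh.surjOn (hQY hy)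
    refine ⟨x, ⟨hx, hy⟩, ?_⟩
    intro N hN
    have h1 : IsOpen (h '' (interior N ∩ U)) := isOpen_image_of_injOn
      (isOpen_interior.inter hU) (hhc.mono inter_subset_right) (hh.injOn.mono inter_subset_right)
    have h2 := hFy (h1.mem_nhds (mem_image_of_mem h ⟨mem_interior_iff_mem_nhds.2 hN, hx⟩))
    have h2' : h ⁻¹' (h '' (interior N ∩ U)) ∈ (F : Filter ℂ) := h2
    filter_upwards [hF, h2'] with z hz1 hz2
    obtain ⟨w, hw, hwz⟩ := hz2
    have := hh.injOn hw.2 hz1.1 hwz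
    exact interior_subset (this ▸ hw.1)
  have hprop : ∀ Q ⊆ Y, IsCompact Q → IsCompact (U ∩ f ⁻¹' Q) := by
    intro Q hQY hQ
    have h1 : IsCompact (C ∪ (U ∩ h ⁻¹' Q)) := hC.union (hproph Q hQY hQ)
    have h3 : C ∪ (U ∩ h ⁻¹' Q) ⊆ U := union_subset hCU inter_subset_left
    have h2 : U ∩ f ⁻¹' Q = (C ∪ (U ∩ h ⁻¹' Q)) ∩ f ⁻¹' Q := by
      ext x
      constructor
      · rintro ⟨hx, hxQ⟩
        refine ⟨?_, hxQ⟩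
        by_cases hxC : x ∈ C
        · exact Or.inl hxC
        · exact Or.inr ⟨hx, by rw [mem_preimage, ← heq x hx hxC]; exact hxQ⟩
      · rintro ⟨hx, hxQ⟩
        exact ⟨h3 hx, hxQ⟩
    rw [h2]
    obtain ⟨Z, hZ, hZeq⟩ := continuousOn_iff_isClosed.1 (hf.mono h3) Q hQ.isClosed
    rw [inter_comm, hZeq, inter_comm]
    exact h1.inter_right hZ
  refine ⟨hmaps, fun x hx x' hx' hxx => ?_, ?_⟩
  · by_contra hne
    have h1 := eq_empty_of_isOpen_of_subset_isCompact (isOpen_double_points hU hf hloc)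
      (isOpen_diff_double_points hY hf hloc hprop) (hC.image_of_continuousOn (hf.mono hCU))
      (by
        rintro y ⟨a, ha, b, hb, hab, h3, h4⟩
        by_cases haC : a ∈ C
        · exact ⟨a, haC, h3⟩
        by_cases hbC : b ∈ C
        · exact ⟨b, hbC, h4⟩
        exact absurd (hh.injOn ha hb (by rw [← heq a ha haC, ← heq b hb hbC, h3, h4])) hab)
      (hmaps.mono_left hCU).image_subset
    have h2 : f x ∈ (∅ : Set ℂ) := h1 ▸ ⟨x, hx, x', hx', hne, rfl, hxx.symm⟩
    exact h2
  · have hdiff : Y \ (Y \ f '' U) = f '' U := by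
      rw [sdiff_sdiff_cancel_left hmaps.image_subset]
    have h1 := eq_empty_of_isOpen_of_subset_isCompact (isOpen_diff_image hY hf hprop)
      (by rw [hdiff]; exact isOpen_image_of_locInj hU hf hloc)
      (hC.image_of_continuousOn (hhc.mono hCU))
      (by
        rintro y ⟨hy, hyf⟩
        obtain ⟨x, hx, rfl⟩ := hh.surjOn hy
        by_cases hxC : x ∈ C
        · exact ⟨x, hxC, rfl⟩
        · exact absurd ⟨x, hx, heq x hx hxC⟩ hyf)
      (hh.mapsTo.mono_left hCU).image_subset
    exact sdiff_eq_empty.1 h1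

open Filter Topology in
/-- `h` is of class `C^n` with invertible derivative at `x`. -/
def RegAt (n : WithTop ℕ∞) (h : ℂ → ℂ) (x : ℂ) : Prop :=
  (∀ᶠ y in 𝓝 x, ContDiffAt ℝ n h y) ∧ (fderiv ℝ h x).det ≠ 0

namespace RegAt
open Filter Topology

variable {n : WithTop ℕ∞} {h g : ℂ → ℂ} {x : ℂ}

theorem contDiffAt (H : RegAt n h x) : ContDiffAt ℝ n h x := H.1.self_of_nhds

theorem congr (H : RegAt n h x) (e : g =ᶠ[𝓝 x] h) : RegAt n g x := by
  refine ⟨?_, by rw [e.fderiv_eq]; exact H.2⟩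
  filter_upwards [H.1, e.eventuallyEq_nhds] with y h1 h2
  exact h1.congr_of_eventuallyEq h2

theorem of_isOpen {U : Set ℂ} (hU : IsOpen U) (hx : x ∈ U) (hc : ContDiffOn ℝ n h U)
    (hd : (fderiv ℝ h x).det ≠ 0) : RegAt n h x := by
  refine ⟨?_, hd⟩
  filter_upwards [hU.mem_nhds hx] with y hy
  exact hc.contDiffAt (hU.mem_nhds hy)

theorem hasStrictFDerivAt (hn : 1 ≤ n) (H : RegAt n h x) :
    HasStrictFDerivAt h (fderiv ℝ h x) x :=
  H.contDiffAt.hasStrictFDerivAt (by intro h0; simp [h0] at hn)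

theorem eventually (hn : 1 ≤ n) (H : RegAt n h x) : ∀ᶠ y in 𝓝 x, RegAt n h y := by
  have hc : ContinuousAt (fun y => (fderiv ℝ h y).det) x := by
    have h1 : ContinuousAt (fderiv ℝ h) x :=
      (H.contDiffAt.fderiv_right (m := 0) (by simpa using hn)).continuousAt
    exact ContinuousLinearMap.continuous_det.continuousAt.comp h1
  filter_upwards [H.1.eventually_nhds, hc.eventually_ne H.2] with y h1 h2
  exact ⟨h1, h2⟩

theorem isOpen_setOf (hn : 1 ≤ n) (h : ℂ → ℂ) : IsOpen {x | RegAt n h x} :=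
  isOpen_iff_mem_nhds.2 fun _ hx => RegAt.eventually hn hx

theorem continuousAt (H : RegAt n h x) : ContinuousAt h x := H.contDiffAt.continuousAt

theorem comp (hn : 1 ≤ n) (Hg : RegAt n g (h x)) (Hh : RegAt n h x) :
    RegAt n (fun z => g (h z)) x := by
  have h0 : n ≠ 0 := by intro h0; simp [h0] at hn
  constructor
  · filter_upwards [Hh.1, Hh.continuousAt.eventually Hg.1] with y h1 h2
    exact h2.comp y h1
  · have h1 : fderiv ℝ (fun z => g (h z)) x = (fderiv ℝ g (h x)).comp (fderiv ℝ h x) :=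
      fderiv_comp x (Hg.contDiffAt.differentiableAt h0) (Hh.contDiffAt.differentiableAt h0)
    rw [h1]
    have : ((fderiv ℝ g (h x)).comp (fderiv ℝ h x)).det
        = (fderiv ℝ g (h x)).det * (fderiv ℝ h x).det := by
      simp [ContinuousLinearMap.det, LinearMap.det_comp]
    rw [this]
    exact mul_ne_zero Hg.2 Hh.2

theorem exists_injOn (hn : 1 ≤ n) (H : RegAt n h x) : ∃ N ∈ 𝓝 x, InjOn h N := by
  let e := (fderiv ℝ h x).toContinuousLinearEquivOfDetNeZero H.2
  have h1 : HasStrictFDerivAt h (e : ℂ →L[ℝ] ℂ) x := by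
    simpa [e] using H.hasStrictFDerivAt hn
  exact ⟨_, h1.toOpenPartialHomeomorph.open_source.mem_nhds
    h1.mem_toOpenPartialHomeomorph_source, h1.toOpenPartialHomeomorph.injOn⟩

/-- A continuous left inverse of a regular map is regular. -/
theorem leftInverse (hn : 1 ≤ n) {U : Set ℂ} (hU : IsOpen U) (hx : x ∈ U)
    (hinj : InjOn h U) (hc : ContinuousOn h U) (hinv : ∀ z ∈ U, g (h z) = z)
    (H : RegAt n h x) : RegAt n g (h x) := by
  have h0 : n ≠ 0 := by intro h0; simp [h0] at hn
  have hopen := isOpen_image_of_injOn hU hc hinj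
  have key : ∀ y ∈ U, RegAt n h y → ContDiffAt ℝ n g (h y) := by
    intro y hy Hy
    let e := (fderiv ℝ h y).toContinuousLinearEquivOfDetNeZero Hy.2
    have h1 : HasFDerivAt h (e : ℂ →L[ℝ] ℂ) y := by
      simpa [e] using (Hy.hasStrictFDerivAt hn).hasFDerivAt
    have h2 := Hy.contDiffAt.to_localInverse h1 h0
    have h3 : HasStrictFDerivAt h (e : ℂ →L[ℝ] ℂ) y := by
      simpa [e] using (Hy.hasStrictFDerivAt hn)
    refine h2.congr_of_eventuallyEq ?_
    have h4 := h3.eventually_right_inverse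
    have h5 : ∀ᶠ w in 𝓝 (h y), (h3.localInverse h e y) w ∈ U := by
      have : ContinuousAt (h3.localInverse h e y) (h y) := h3.localInverse_continuousAt
      apply this.eventually
      rw [h3.localInverse_apply_image]
      exact hU.mem_nhds hy
    filter_upwards [h4, h5] with w h6 h7
    have := hinv _ h7
    rw [h6] at this
    exact this
  constructor
  · have h1 : IsOpen (h '' (U ∩ {y | RegAt n h y})) := isOpen_image_of_injOn
      (hU.inter (isOpen_setOf hn h)) (hc.mono inter_subset_left) (hinj.mono inter_subset_left)
    filter_upwards [h1.mem_nhds (mem_image_of_mem h ⟨hx, H⟩)] with w hw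
    obtain ⟨y, hy, rfl⟩ := hw
    exact key y hy.1 hy.2
  · have h1 : fderiv ℝ (fun z => g (h z)) x = (fderiv ℝ g (h x)).comp (fderiv ℝ h x) :=
      fderiv_comp x ((key x hx H).differentiableAt h0) (H.contDiffAt.differentiableAt h0)
    have h2 : (fun z => g (h z)) =ᶠ[𝓝 x] id := by
      filter_upwards [hU.mem_nhds hx] with z hz using hinv z hz
    rw [h2.fderiv_eq, fderiv_id] at h1
    have h3 := congrArg ContinuousLinearMap.det h1
    intro h4
    have h5 : ((fderiv ℝ g (h x)).comp (fderiv ℝ h x)).det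
        = (fderiv ℝ g (h x)).det * (fderiv ℝ h x).det := by
      simp [ContinuousLinearMap.det, LinearMap.det_comp]
    rw [h5, h4, zero_mul] at h3
    simp [ContinuousLinearMap.det] at h3

theorem of_analyticAt (ha : AnalyticAt ℂ h x) (hd : deriv h x ≠ 0) : RegAt n h x := by
  constructor
  · filter_upwards [ha.eventually_analyticAt] with y hy
    exact hy.contDiffAt.restrict_scalars ℝ
  · have h1 : HasFDerivAt h ((ContinuousLinearMap.toSpanSingleton ℂ (deriv h x)).restrictScalars ℝ) x :=
      (ha.differentiableAt.hasDerivAt.hasFDerivAt).restrictScalars ℝ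
    rw [h1.fderiv]
    intro h2
    have h3 := LinearMap.det_eq_zero_iff_ker_ne_bot.1 h2
    apply h3
    rw [LinearMap.ker_eq_bot']
    intro m hm
    simpa [hd] using hm

end RegAt

open Metric Filter Topology in
/-- The inverse of an injective holomorphic function is holomorphic near each value where the
derivative does not vanish. -/
theorem hasDerivAt_leftInverse {f g : ℂ → ℂ} {U : Set ℂ} (hU : IsOpen U)
    (hf : DifferentiableOn ℂ f U) (hinj : InjOn f U) (hg : ∀ z ∈ U, g (f z) = z) {a : ℂ}
    (ha : a ∈ U) (hd : deriv f a ≠ 0) : HasDerivAt g (deriv f a)⁻¹ (f a) := by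
  have hopen : ∀ V ⊆ U, IsOpen V → IsOpen (f '' V) := fun V hV hVo =>
    isOpen_image_of_injOn hVo (hf.continuousOn.mono hV) (hinj.mono hV)
  have hcont : ContinuousAt g (f a) := by
    rw [ContinuousAt, hg a ha]
    intro N hN
    rw [Filter.mem_map]
    have := hopen (interior N ∩ U) inter_subset_right (isOpen_interior.inter hU)
    filter_upwards [this.mem_nhds (mem_image_of_mem f ⟨mem_interior_iff_mem_nhds.2 hN, ha⟩)]
      with w hw
    obtain ⟨z, hz, rfl⟩ := hw
    rw [mem_preimage, hg z hz.2]
    exact interior_subset hz.1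
  have h1 : HasDerivAt f (deriv f a) (g (f a)) := by
    rw [hg a ha]
    exact ((hf a ha).differentiableAt (hU.mem_nhds ha)).hasDerivAt
  refine h1.of_local_left_inverse hcont hd ?_
  filter_upwards [(hopen U Subset.rfl hU).mem_nhds (mem_image_of_mem f ha)] with w hw
  obtain ⟨z, hz, rfl⟩ := hw
  rw [hg z hz]

open Metric Filter Topology in
theorem deriv_ne_zero_of_injOn {f : ℂ → ℂ} {U : Set ℂ} (hU : IsOpen U)
    (hf : DifferentiableOn ℂ f U) (hinj : InjOn f U) {a : ℂ} (ha : a ∈ U) : deriv f a ≠ 0 := by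
  have hfa : AnalyticAt ℂ f a := hf.analyticAt (hU.mem_nhds ha)
  have hev : ∀ᶠ z in 𝓝[≠] a, deriv f z ≠ 0 := by
    rcases hfa.deriv.eventually_eq_zero_or_eventually_ne_zero with h | h
    · exfalso
      obtain ⟨ρ, hρ, hsub⟩ := Metric.eventually_nhds_iff_ball.1 (h.and (hU.mem_nhds ha))
      have hb : a + (ρ / 2 : ℝ) ∈ ball a ρ := by
        rw [mem_ball, dist_eq_norm, add_sub_cancel_left, Complex.norm_real,
          Real.norm_of_nonneg (by positivity)]
        linarith
      have h1 : f a = f (a + (ρ / 2 : ℝ)) :=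
        (convex_ball a ρ).is_const_of_fderivWithin_eq_zero (𝕜 := ℂ)
          (fun z hz => (hf z (hsub z hz).2).mono (fun w hw => (hsub w hw).2))
          (fun z hz => by
            rw [fderivWithin_of_isOpen isOpen_ball hz]
            ext
            simpa using (hsub z hz).1) (mem_ball_self hρ) hb
      have h2 := hinj ha (hsub _ hb).2 h1
      have h3 : ((ρ / 2 : ℝ) : ℂ) = 0 := by linear_combination -h2
      have h4 : ρ / 2 = 0 := by exact_mod_cast h3
      linarith
    · exact h
  obtain ⟨N, hN, hNo, haN⟩ : ∃ N ⊆ U, IsOpen N ∧ a ∈ N ∧ ∀ z ∈ N, z ≠ a → deriv f z ≠ 0 := by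
    obtain ⟨N, hN, hNo, haN⟩ := _root_.mem_nhds_iff.1 (inter_mem (hU.mem_nhds ha) (eventually_nhdsWithin_iff.1 hev))
    exact ⟨N, fun z hz => (hN hz).1, hNo, haN, fun z hz => (hN hz).2⟩
  obtain ⟨haN, hne⟩ := haN
  let g := Function.invFunOn f N
  have hgl : ∀ z ∈ N, g (f z) = z := fun z hz => (hinj.mono hN).leftInvOn_invFunOn hz
  have hopen : ∀ V ⊆ U, IsOpen V → IsOpen (f '' V) := fun V hV hVo =>
    isOpen_image_of_injOn hVo (hf.continuousOn.mono hV) (hinj.mono hV)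
  have hdiff : DifferentiableOn ℂ g (f '' N) := by
    rw [← Complex.differentiableOn_compl_singleton_and_continuousAt_iff
      ((hopen N hN hNo).mem_nhds (mem_image_of_mem f haN))]
    constructor
    · rintro _ ⟨⟨z, hz, rfl⟩, hza⟩
      have hza' : z ≠ a := by rintro rfl; exact hza rfl
      exact (hasDerivAt_leftInverse hNo (hf.mono hN) (hinj.mono hN) hgl hz
        (hne z hz hza')).differentiableAt.differentiableWithinAt
    · rw [ContinuousAt, hgl a haN]
      intro M hM
      rw [Filter.mem_map]
      have := hopen (interior M ∩ N) (inter_subset_right.trans hN) (isOpen_interior.inter hNo)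
      filter_upwards [this.mem_nhds (mem_image_of_mem f ⟨mem_interior_iff_mem_nhds.2 hM, haN⟩)]
        with w hw
      obtain ⟨z, hz, rfl⟩ := hw
      rw [mem_preimage, hgl z hz.2]
      exact interior_subset hz.1
  intro h0
  have h1 : DifferentiableAt ℂ g (f a) :=
    hdiff.differentiableAt ((hopen N hN hNo).mem_nhds (mem_image_of_mem f haN))
  have h2 := h1.hasDerivAt.comp a hfa.differentiableAt.hasDerivAt
  have h3 : (g ∘ f) =ᶠ[𝓝 a] id := by
    filter_upwards [hNo.mem_nhds haN] with z hz using hgl z hz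
  have h4 := h2.congr_of_eventuallyEq h3.symm |>.unique (hasDerivAt_id a)
  rw [h0, mul_zero] at h4
  exact zero_ne_one h4

open Metric Filter Topology in
/-- The Montel theorem in ultrafilter form. -/
theorem exists_tendstoLocallyUniformlyOn {E : Set ℂ} (hE : IsOpen E) (F : ℕ → ℂ → ℂ)
    (hF : ∀ k, DifferentiableOn ℂ (F k) E) (hb : ∀ k, MapsTo (F k) E (closedBall 0 1))
    (𝒰 : Ultrafilter ℕ) : ∃ f, TendstoLocallyUniformlyOn F f 𝒰 E ∧
      MapsTo f E (closedBall 0 1) := by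
  have hlim : ∀ z, ∃ w, z ∈ E → w ∈ closedBall (0:ℂ) 1 ∧ Tendsto (fun k => F k z) 𝒰 (𝓝 w) := by
    intro z
    by_cases hz : z ∈ E
    · obtain ⟨w, hw, h⟩ := isCompact_iff_ultrafilter_le_nhds.1 (isCompact_closedBall (0:ℂ) 1)
        (𝒰.map fun k => F k z) (by
          rw [le_principal_iff]
          exact show (fun k => F k z) ⁻¹' _ ∈ (𝒰 : Filter ℕ) from
            univ_mem' (fun k => hb k hz))
      exact ⟨w, fun _ => ⟨hw, h⟩⟩
    · exact ⟨0, fun h => absurd h hz⟩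
  choose f hf using hlim
  refine ⟨f, ?_, fun z hz => (hf z hz).1⟩
  rw [Metric.tendstoLocallyUniformlyOn_iff]
  intro ε hε z hz
  obtain ⟨ρ, hρ, hsub⟩ := Metric.isOpen_iff.1 hE z hz
  have hlip : ∀ k, ∀ x ∈ ball z ρ, dist (F k x) (F k z) ≤ 2 / ρ * dist x z := fun k x hx =>
    Complex.dist_le_div_mul_dist_of_mapsTo_ball ((hF k).mono hsub) (fun y hy => by
      have h1 := hb k (hsub hy)
      have h2 := hb k hz
      rw [mem_closedBall, dist_eq_norm]
      rw [mem_closedBall_zero_iff] at h1 h2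
      linarith [norm_sub_le (F k y) (F k z)]) hx
  have hlip' : ∀ x ∈ ball z ρ, dist (f x) (f z) ≤ 2 / ρ * dist x z := fun x hx =>
    le_of_tendsto ((hf x (hsub hx)).2.dist (hf z hz).2) (Eventually.of_forall fun k => hlip k x hx)
  set δ := min ρ (ρ * ε / 8) with hδ
  have hδ0 : 0 < δ := by positivity
  refine ⟨ball z δ, mem_nhdsWithin_of_mem_nhds (ball_mem_nhds z hδ0), ?_⟩
  have h3 := (Metric.tendsto_nhds.1 (hf z hz).2) (ε / 4) (by positivity)
  filter_upwards [h3] with k hk x hx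
  have hxρ : x ∈ ball z ρ := ball_subset_ball (min_le_left _ _) hx
  have h4 : 2 / ρ * dist x z ≤ ε / 4 := by
    have : dist x z ≤ ρ * ε / 8 := (mem_ball.1 hx).le.trans (min_le_right _ _)
    calc 2 / ρ * dist x z ≤ 2 / ρ * (ρ * ε / 8) := by gcongr
      _ = ε / 4 := by field_simp; ring
  have h5 := hlip k x hxρ
  have h6 := hlip' x hxρ
  calc dist (f x) (F k x) ≤ dist (f x) (f z) + dist (f z) (F k z) + dist (F k z) (F k x) :=
        dist_triangle4 _ _ _ _
    _ < ε := by
        rw [dist_comm (f z) (F k z), dist_comm (F k z) (F k x)]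
        linarith

open Metric Filter Topology in
theorem hurwitz_aux {E : Set ℂ} (hE : IsOpen E) {ι : Type*} {𝒰 : Filter ι} {F : ι → ℂ → ℂ}
    {f : ℂ → ℂ} (hlu : TendstoLocallyUniformlyOn F f 𝒰 E)
    (hF : ∀ k, DifferentiableOn ℂ (F k) E) (hinj : ∀ k, InjOn (F k) E)
    (hf : DifferentiableOn ℂ f E) {a : ℂ} (ha : a ∈ E) (hne : ∀ᶠ z in 𝓝[≠] a, f z ≠ f a)
    {N : Set ℂ} (hN : N ∈ 𝓝 a) : ∀ᶠ k in 𝒰, f a ∈ F k '' (N ∩ E) := by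
  obtain ⟨ρ, hρ, hsub⟩ := Metric.nhds_basis_closedBall.mem_iff.1
    (inter_mem (inter_mem hN (hE.mem_nhds ha)) (eventually_nhdsWithin_iff.1 hne))
  have hsubE : closedBall a ρ ⊆ E := fun z hz => (hsub hz).1.2
  have hsn : (sphere a ρ).Nonempty := NormedSpace.sphere_nonempty.2 hρ.le
  obtain ⟨z0, hz0, hmin⟩ := (isCompact_sphere a ρ).exists_isMinOn hsn (f := fun z => ‖f z - f a‖)
    ((hf.continuousOn.mono (sphere_subset_closedBall.trans hsubE)).sub continuousOn_const).norm
  set m := ‖f z0 - f a‖ with hm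
  have hm0 : 0 < m := by
    rw [hm, norm_pos_iff, sub_ne_zero]
    exact (hsub (sphere_subset_closedBall hz0)).2 (ne_of_mem_sphere hz0 hρ.ne')
  have hu := (tendstoLocallyUniformlyOn_iff_forall_isCompact hE).1 hlu _ hsubE
    (isCompact_closedBall a ρ)
  rw [Metric.tendstoUniformlyOn_iff] at hu
  filter_upwards [hu (m / 8) (by positivity)] with k hk
  have hcl : DiffContOnCl ℂ (F k) (ball a ρ) := by
    refine DifferentiableOn.diffContOnCl ?_
    rw [closure_ball _ hρ.ne']
    exact (hF k).mono hsubE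
  have hka := hk a (mem_closedBall_self hρ.le)
  have h1 := hcl.ball_subset_image_closedBall (ε := m / 2) hρ (fun z hz => by
      have h2 := hk z (sphere_subset_closedBall hz)
      have h3 : m ≤ ‖f z - f a‖ := hmin hz
      rw [← dist_eq_norm] at h3 ⊢
      have h4 := dist_triangle4 (f z) (F k z) (F k a) (f a)
      rw [dist_comm (F k a) (f a)] at h4
      linarith) (by
      have : ∀ᶠ z in 𝓝[≠] a, F k z ≠ F k a := by
        rw [eventually_nhdsWithin_iff]
        filter_upwards [hE.mem_nhds ha] with z hz hza h
        exact hza (hinj k hz ha h)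
      exact this.frequently.filter_mono nhdsWithin_le_nhds)
  obtain ⟨z, hz, hzf⟩ := h1 (show f a ∈ ball (F k a) (m / 2 / 2) by
    rw [mem_ball]; linarith)
  exact ⟨z, ⟨(hsub hz).1.1, hsubE hz⟩, hzf⟩

open Metric Filter Topology in
/-- Hurwitz: a nonconstant locally uniform limit of injective holomorphic maps is injective. -/
theorem injOn_of_tendstoLocallyUniformlyOn {E : Set ℂ} (hE : IsOpen E) (hpc : IsPreconnected E)
    {ι : Type*} {𝒰 : Filter ι} [𝒰.NeBot] {F : ι → ℂ → ℂ}
    {f : ℂ → ℂ} (hlu : TendstoLocallyUniformlyOn F f 𝒰 E)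
    (hF : ∀ k, DifferentiableOn ℂ (F k) E) (hinj : ∀ k, InjOn (F k) E)
    {p : ℂ} (hp : p ∈ E) (hd : deriv f p ≠ 0) : InjOn f E := by
  have hf : DifferentiableOn ℂ f E := hlu.differentiableOn (Eventually.of_forall hF) hE
  have hne : ∀ a ∈ E, ∀ᶠ z in 𝓝[≠] a, f z ≠ f a := by
    intro a ha
    have han : AnalyticOnNhd ℂ f E := hf.analyticOnNhd hE
    have h1 : AnalyticAt ℂ (fun z => f z - f a) a := (han a ha).sub analyticAt_const
    rcases h1.eventually_eq_zero_or_eventually_ne_zero with h | h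
    · exfalso
      have h2 : EqOn f (fun _ => f a) E :=
        han.eqOn_of_preconnected_of_eventuallyEq analyticOnNhd_const hpc ha (by
          filter_upwards [h] with z hz using sub_eq_zero.1 hz)
      apply hd
      have h3 : f =ᶠ[𝓝 p] fun _ => f a := by
        filter_upwards [hE.mem_nhds hp] with z hz using h2 hz
      rw [h3.deriv_eq, deriv_const]
    · filter_upwards [h] with z hz using sub_ne_zero.1 hz
  intro a ha b hb hab
  by_contra hne'
  obtain ⟨A, B, hA, hB, haA, hbB, hAB⟩ := t2_separation hne'
  have h1 := hurwitz_aux hE hlu hF hinj hf ha (hne a ha) (hA.mem_nhds haA)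
  have h2 := hurwitz_aux hE hlu hF hinj hf hb (hne b hb) (hB.mem_nhds hbB)
  obtain ⟨k, ⟨x, hx, hxa⟩, ⟨y, hy, hyb⟩⟩ := (h1.and h2).exists
  have : x = y := hinj k hx.2 hy.2 (by rw [hxa, hyb, hab])
  exact disjoint_left.1 hAB hx.1 (this ▸ hy.1)

/-- The disc automorphism exchanging `0` and `w`. -/
def discInv (w z : ℂ) : ℂ := (w - z) / (1 - (starRingEnd ℂ) w * z)

theorem one_sub_conj_mul_ne_zero {w z : ℂ} (hw : ‖w‖ < 1) (hz : ‖z‖ < 1) :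
    1 - (starRingEnd ℂ) w * z ≠ 0 := by
  intro h
  have h1 : (starRingEnd ℂ) w * z = 1 := (sub_eq_zero.1 h).symm
  have h2 := congrArg norm h1
  rw [norm_mul, RCLike.norm_conj, norm_one] at h2
  nlinarith [norm_nonneg w, norm_nonneg z]

theorem norm_discInv_lt {w z : ℂ} (hw : ‖w‖ < 1) (hz : ‖z‖ < 1) : ‖discInv w z‖ < 1 := by
  have h0 := one_sub_conj_mul_ne_zero hw hz
  rw [discInv, norm_div, div_lt_one (norm_pos_iff.2 h0)]
  have h1 : Complex.normSq (1 - (starRingEnd ℂ) w * z) - Complex.normSq (w - z)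
      = (1 - Complex.normSq w) * (1 - Complex.normSq z) := by
    simp only [Complex.normSq_apply, Complex.sub_re, Complex.sub_im, Complex.one_re,
      Complex.one_im, Complex.mul_re, Complex.mul_im, Complex.conj_re, Complex.conj_im]
    ring
  simp only [Complex.normSq_eq_norm_sq] at h1
  have h2 : 0 < (1 - ‖w‖ ^ 2) * (1 - ‖z‖ ^ 2) := by
    apply mul_pos <;> nlinarith [norm_nonneg w, norm_nonneg z]
  exact lt_of_pow_lt_pow_left₀ 2 (norm_nonneg _) (by linarith)

theorem discInv_injOn {w : ℂ} (hw : ‖w‖ < 1) : InjOn (discInv w) (Metric.ball 0 1) := by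
  intro a ha b hb hab
  rw [mem_ball_zero_iff] at ha hb
  have h1 := one_sub_conj_mul_ne_zero hw ha
  have h2 := one_sub_conj_mul_ne_zero hw hb
  rw [discInv, discInv, div_eq_div_iff h1 h2] at hab
  have h3 : (1 - (starRingEnd ℂ) w * w) * (a - b) = 0 := by linear_combination -hab
  have h4 := one_sub_conj_mul_ne_zero hw hw
  exact sub_eq_zero.1 ((mul_eq_zero.1 h3).resolve_left h4)

theorem hasDerivAt_discInv {w z : ℂ} (hw : ‖w‖ < 1) (hz : ‖z‖ < 1) :
    HasDerivAt (discInv w)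
      (-(1 - (starRingEnd ℂ) w * w) / (1 - (starRingEnd ℂ) w * z) ^ 2) z := by
  have h0 := one_sub_conj_mul_ne_zero hw hz
  have h1 : HasDerivAt (fun z => w - z) (-1) z := by simpa using (hasDerivAt_id z).const_sub w
  have h2 : HasDerivAt (fun z => 1 - (starRingEnd ℂ) w * z) (-((starRingEnd ℂ) w)) z := by
    simpa using ((hasDerivAt_id z).const_mul ((starRingEnd ℂ) w)).const_sub 1
  refine (h1.div h2 h0).congr_deriv ?_
  congr 1
  ring

theorem differentiableOn_discInv {w : ℂ} (hw : ‖w‖ < 1) :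
    DifferentiableOn ℂ (discInv w) (Metric.ball 0 1) := fun z hz =>
  (hasDerivAt_discInv hw (mem_ball_zero_iff.1 hz)).differentiableAt.differentiableWithinAt

theorem discInv_self (w : ℂ) : discInv w w = 0 := by simp [discInv]
theorem discInv_zero (w : ℂ) : discInv w 0 = w := by simp [discInv]

open Metric Filter Topology in
theorem hasDerivAt_sqrt {f g : ℂ → ℂ} {E : Set ℂ} (hE : IsOpen E) (hf : DifferentiableOn ℂ f E)
    (hg : ContinuousOn g E) (hgf : ∀ z ∈ E, g z ^ 2 = f z) {z : ℂ} (hz : z ∈ E) (h0 : g z ≠ 0) :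
    HasDerivAt g (deriv f z / (g z + g z)) z := by
  have hfz := ((hf z hz).differentiableAt (hE.mem_nhds hz)).hasDerivAt
  rw [hasDerivAt_iff_tendsto_slope] at hfz ⊢
  have hgc : ContinuousAt g z := hg.continuousAt (hE.mem_nhds hz)
  have h1 : Tendsto (fun w => g w + g z) (𝓝[≠] z) (𝓝 (g z + g z)) :=
    (hgc.add continuousAt_const).tendsto.mono_left nhdsWithin_le_nhds
  have h2 : g z + g z ≠ 0 := by
    rw [← two_mul]; exact mul_ne_zero two_ne_zero h0
  refine (hfz.div h1 h2).congr' ?_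
  filter_upwards [h1.eventually_ne h2, mem_nhdsWithin_of_mem_nhds (hE.mem_nhds hz),
    self_mem_nhdsWithin] with w h3 h4 h5
  have h6 : w - z ≠ 0 := sub_ne_zero.2 h5
  simp only [slope_def_field, Pi.div_apply]
  rw [← hgf w h4, ← hgf z hz]
  field_simp
  ring

open Metric Filter Topology in
/-- The Koebe trick: if the image misses a point of the disc the derivative can be increased. -/
theorem exists_larger_deriv {E : Set ℂ} (hE : IsOpen E)
    (hsqrt : ∀ f : ℂ → ℂ, DifferentiableOn ℂ f E → (∀ z ∈ E, f z ≠ 0) →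
      ∃ g : ℂ → ℂ, ContinuousOn g E ∧ ∀ z ∈ E, g z ^ 2 = f z)
    {p : ℂ} (hp : p ∈ E) {f : ℂ → ℂ} (hf : DifferentiableOn ℂ f E) (hfm : MapsTo f E (ball 0 1))
    (hinj : InjOn f E) (hfp : f p = 0) {w : ℂ} (hw : ‖w‖ < 1) (hwf : ∀ z ∈ E, f z ≠ w) :
    ∃ h : ℂ → ℂ, DifferentiableOn ℂ h E ∧ MapsTo h E (ball 0 1) ∧ InjOn h E ∧ h p = 0 ∧
      ‖deriv f p‖ < ‖deriv h p‖ := by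
  have hw0 : w ≠ 0 := fun h => hwf p hp (hfp.trans h.symm)
  have hφd : DifferentiableOn ℂ (fun z => discInv w (f z)) E :=
    (differentiableOn_discInv hw).comp hf hfm
  have hfn : ∀ z ∈ E, ‖f z‖ < 1 := fun z hz => mem_ball_zero_iff.1 (hfm hz)
  have hφ0 : ∀ z ∈ E, discInv w (f z) ≠ 0 := by
    intro z hz h
    rw [discInv, div_eq_zero_iff] at h
    rcases h with h | h
    · exact hwf z hz (sub_eq_zero.1 h).symm
    · exact one_sub_conj_mul_ne_zero hw (hfn z hz) h
  obtain ⟨g, hgc, hg⟩ := hsqrt _ hφd hφ0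
  have hg0 : ∀ z ∈ E, g z ≠ 0 := fun z hz h => hφ0 z hz (by rw [← hg z hz, h]; simp)
  have hgd : ∀ z ∈ E, HasDerivAt g _ z := fun z hz => hasDerivAt_sqrt hE hφd hgc hg hz (hg0 z hz)
  have hgn : ∀ z ∈ E, ‖g z‖ < 1 := fun z hz => by
    have h1 := norm_discInv_lt hw (hfn z hz)
    rw [← hg z hz, norm_pow] at h1
    nlinarith [norm_nonneg (g z)]
  have hv := hgn p hp
  have hgE : DifferentiableOn ℂ g E :=
    fun z hz => (hgd z hz).differentiableAt.differentiableWithinAt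
  have hgm : MapsTo g E (ball 0 1) := fun z hz => mem_ball_zero_iff.2 (hgn z hz)
  refine ⟨fun z => discInv (g p) (g z), (differentiableOn_discInv hv).comp hgE hgm,
    fun z hz => mem_ball_zero_iff.2 (norm_discInv_lt hv (hgn z hz)), ?_, discInv_self _, ?_⟩
  · intro a ha b hb hab
    have h1 := discInv_injOn hv (hgm ha) (hgm hb) hab
    have h2 : discInv w (f a) = discInv w (f b) := by
      rw [← hg a ha, ← hg b hb, h1]
    exact hinj ha hb (discInv_injOn hw (hfm ha) (hfm hb) h2)
  · have hfp' : HasDerivAt f (deriv f p) p :=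
      ((hf p hp).differentiableAt (hE.mem_nhds hp)).hasDerivAt
    have h1 : deriv (fun z => discInv w (f z)) p = -(1 - (starRingEnd ℂ) w * w) * deriv f p := by
      have h2 := hasDerivAt_discInv hw (hfn p hp)
      have h2' : HasDerivAt (fun z => discInv w (f z)) _ p := h2.comp p hfp'
      rw [h2'.deriv, hfp]
      simp
    have h3 : deriv (fun z => discInv (g p) (g z)) p
        = -(1 - (starRingEnd ℂ) (g p) * g p) / (1 - (starRingEnd ℂ) (g p) * g p) ^ 2
          * (-(1 - (starRingEnd ℂ) w * w) * deriv f p / (g p + g p)) := by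
      have h2 := (hasDerivAt_discInv hv hv).comp p (hgd p hp)
      rw [h1] at h2
      have h2' : HasDerivAt (fun z => discInv (g p) (g z)) _ p := h2
      exact h2'.deriv
    have h4 : ‖g p‖ ^ 2 = ‖w‖ := by
      rw [← norm_pow, hg p hp, hfp, discInv_zero]
    have hdf : deriv f p ≠ 0 := deriv_ne_zero_of_injOn hE hf hinj hp
    have hcm : ∀ u : ℂ, ‖u‖ < 1 → ‖1 - (starRingEnd ℂ) u * u‖ = 1 - ‖u‖ ^ 2 := by
      intro u hu
      rw [mul_comm, Complex.mul_conj, Complex.normSq_eq_norm_sq, ← Complex.ofReal_one,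
        ← Complex.ofReal_sub, Complex.norm_real, Real.norm_of_nonneg]
      nlinarith [norm_nonneg u]
    set t := ‖g p‖ with ht
    have ht0 : 0 < t := norm_pos_iff.2 (hg0 p hp)
    have ht1 : t < 1 := hv
    rw [h3, norm_mul, norm_div, norm_div, norm_mul, norm_neg, norm_neg, norm_pow, hcm _ hv,
      hcm _ hw, ← two_mul, norm_mul, ← h4]
    simp only [Complex.norm_ofNat, ← ht]
    have hd0 : 0 < ‖deriv f p‖ := norm_pos_iff.2 hdf
    have h5 : 0 < 1 - t ^ 2 := by nlinarith
    have h6 : (1 - t ^ 2) / (1 - t ^ 2) ^ 2 * ((1 - (t ^ 2) ^ 2) * ‖deriv f p‖ / (2 * t))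
        = (1 + t ^ 2) / (2 * t) * ‖deriv f p‖ := by
      have : (1 - (t ^ 2) ^ 2) = (1 - t ^ 2) * (1 + t ^ 2) := by ring
      rw [this]
      field_simp
    rw [h6]
    have h7 : 1 < (1 + t ^ 2) / (2 * t) := by
      rw [lt_div_iff₀ (by positivity)]
      nlinarith [sq_pos_of_pos (sub_pos.2 ht1)]
    nlinarith

open Metric Filter Topology in
/-- Riemann mapping theorem for bounded domains with square roots. -/
theorem exists_conformal_to_disc {E : Set ℂ} (hE : IsOpen E) (hb : Bornology.IsBounded E)
    (hpc : IsPreconnected E)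
    (hsqrt : ∀ f : ℂ → ℂ, DifferentiableOn ℂ f E → (∀ z ∈ E, f z ≠ 0) →
      ∃ g : ℂ → ℂ, ContinuousOn g E ∧ ∀ z ∈ E, g z ^ 2 = f z)
    {p : ℂ} (hp : p ∈ E) :
    ∃ f : ℂ → ℂ, DifferentiableOn ℂ f E ∧ BijOn f E (ball 0 1) ∧ f p = 0 := by
  let 𝓕 : Set (ℂ → ℂ) := {f | DifferentiableOn ℂ f E ∧ MapsTo f E (ball 0 1) ∧ InjOn f E ∧ f p = 0}
  let D : Set ℝ := (fun f : ℂ → ℂ => ‖deriv f p‖) '' 𝓕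
  obtain ⟨R, hR, hER⟩ : ∃ R > 0, E ⊆ ball p R := by
    obtain ⟨R, hR⟩ := hb.subset_ball p
    exact ⟨max R 1, by positivity, hR.trans (ball_subset_ball (le_max_left _ _))⟩
  have hne : D.Nonempty := by
    have hR' : (R : ℂ) ≠ 0 := by exact_mod_cast hR.ne'
    refine ⟨_, fun z => (z - p) / R, ⟨by fun_prop, ?_, ?_, by simp⟩, rfl⟩
    · intro z hz
      have h1 := hER hz
      rw [mem_ball, dist_eq_norm] at h1
      rw [mem_ball_zero_iff, norm_div, Complex.norm_real, Real.norm_of_nonneg hR.le,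
        div_lt_one hR]
      exact h1
    · intro a _ b _ hab
      simpa [div_left_inj' hR'] using hab
  obtain ⟨ρ, hρ, hρE⟩ := Metric.isOpen_iff.1 hE p hp
  have hbd : BddAbove D := by
    refine ⟨1 / ρ, ?_⟩
    rintro _ ⟨f, ⟨hf, hfm, -, hfp⟩, rfl⟩
    refine Complex.norm_deriv_le_div_of_mapsTo_ball (hf.mono hρE) ?_ hρ
    rw [hfp]
    exact (hfm.mono_left hρE).mono_right ball_subset_closedBall
  obtain ⟨u, -, hu, huD⟩ := exists_seq_tendsto_sSup hne hbd
  choose F hF hFu using huD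
  let 𝒰 : Ultrafilter ℕ := hyperfilter ℕ
  obtain ⟨f, hlu, hfm⟩ := exists_tendstoLocallyUniformlyOn hE F (fun k => (hF k).1)
    (fun k => (hF k).2.1.mono_right ball_subset_closedBall) 𝒰
  have hfd : DifferentiableOn ℂ f E :=
    hlu.differentiableOn (Eventually.of_forall fun k => (hF k).1) hE
  have hder : ‖deriv f p‖ = sSup D := by
    have h1 := (hlu.deriv (Eventually.of_forall fun k => (hF k).1) hE).tendsto_at hp
    have h2 : Tendsto u 𝒰 (𝓝 (sSup D)) :=
      hu.mono_left (by rw [← Nat.cofinite_eq_atTop]; exact hyperfilter_le_cofinite)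
    have h3 : Tendsto u 𝒰 (𝓝 ‖deriv f p‖) := by
      refine h1.norm.congr fun k => ?_
      exact hFu k
    exact tendsto_nhds_unique h3 h2
  have hpos : 0 < sSup D := by
    obtain ⟨_, f, hf, rfl⟩ := hne
    exact lt_of_lt_of_le (norm_pos_iff.2 (deriv_ne_zero_of_injOn hE hf.1 hf.2.2.1 hp))
      (le_csSup hbd ⟨f, hf, rfl⟩)
  have hinj : InjOn f E := injOn_of_tendstoLocallyUniformlyOn hE hpc hlu (fun k => (hF k).1)
    (fun k => (hF k).2.2.1) hp (by rw [← norm_pos_iff, hder]; exact hpos)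
  have hmaps : MapsTo f E (ball 0 1) := by
    have h1 := isOpen_image_of_injOn hE hfd.continuousOn hinj
    have h2 : f '' E ⊆ interior (closedBall 0 1) := interior_maximal hfm.image_subset h1
    rw [interior_closedBall _ one_ne_zero] at h2
    exact fun z hz => h2 (mem_image_of_mem f hz)
  have hfp : f p = 0 := by
    have h1 := hlu.tendsto_at hp
    have h2 : (fun k => F k p) = fun _ => 0 := funext fun k => (hF k).2.2.2
    rw [h2] at h1
    exact tendsto_nhds_unique h1 tendsto_const_nhds
  refine ⟨f, hfd, ⟨hmaps, hinj, ?_⟩, hfp⟩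
  intro w hw
  by_contra hwf
  obtain ⟨h, h1, h2, h3, h4, h5⟩ := exists_larger_deriv hE hsqrt hp hfd hmaps hinj hfp
    (mem_ball_zero_iff.1 hw) (fun z hz hzw => hwf ⟨z, hz, hzw⟩)
  have h6 : ‖deriv h p‖ ≤ sSup D := le_csSup hbd ⟨h, ⟨h1, h2, h3, h4⟩, rfl⟩
  rw [← hder] at h6
  exact absurd h6 (not_le.2 h5)

open Metric Filter Topology in
/-- The image of the disc under an injective continuous map is conformally a disc. -/
theorem exists_riemann_map {h : ℂ → ℂ} (hc : ContinuousOn h (closedBall 0 1))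
    (hinj : InjOn h (closedBall 0 1)) :
    ∃ ψ : ℂ → ℂ, DifferentiableOn ℂ ψ (ball 0 1) ∧ BijOn ψ (ball 0 1) (h '' ball 0 1) ∧
      ψ 0 = h 0 := by
  have hcb : ContinuousOn h (ball 0 1) := hc.mono ball_subset_closedBall
  have hib : InjOn h (ball 0 1) := hinj.mono ball_subset_closedBall
  have hE : IsOpen (h '' ball 0 1) := isOpen_image_of_injOn isOpen_ball hcb hib
  have hb : Bornology.IsBounded (h '' ball 0 1) :=
    ((isCompact_closedBall 0 1).image_of_continuousOn hc).isBounded.subset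
      (image_mono ball_subset_closedBall)
  have hpc : IsPreconnected (h '' ball 0 1) :=
    (convex_ball (0:ℂ) 1).isPreconnected.image h hcb
  have h0 : (0:ℂ) ∈ ball (0:ℂ) 1 := mem_ball_self one_pos
  have hcinv : ContinuousOn (Function.invFunOn h (ball 0 1)) (h '' ball 0 1) := by
    rintro _ ⟨z, hz, rfl⟩
    refine ContinuousAt.continuousWithinAt ?_
    rw [ContinuousAt, hib.leftInvOn_invFunOn hz]
    intro N hN
    rw [Filter.mem_map]
    have := isOpen_image_of_injOn (isOpen_interior.inter isOpen_ball)
      (hcb.mono inter_subset_right) (hib.mono (inter_subset_right (s := interior N)))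
    filter_upwards [this.mem_nhds (mem_image_of_mem h ⟨mem_interior_iff_mem_nhds.2 hN, hz⟩)]
      with w hw
    obtain ⟨y, hy, rfl⟩ := hw
    rw [mem_preimage, hib.leftInvOn_invFunOn hy.2]
    exact interior_subset hy.1
  obtain ⟨f, hfd, hfb, hf0⟩ := exists_conformal_to_disc hE hb hpc (by
    intro f hf hf0
    have hs : IsSimplyConnected (ball (0:ℂ) 1) := by
      have : ContractibleSpace (ball (0:ℂ) 1) :=
        (convex_ball (0:ℂ) 1).contractibleSpace ⟨0, h0⟩
      exact (inferInstance : SimplyConnectedSpace (ball (0:ℂ) 1))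
    obtain ⟨L, hL, hLe⟩ := Complex.exists_continuousOn_eqOn_exp_comp hs isOpen_ball
      (g := fun z => f (h z)) (hf.continuousOn.comp hcb (mapsTo_image h _))
      (by rintro ⟨z, hz, hz0⟩; exact hf0 _ (mem_image_of_mem h hz) hz0)
    refine ⟨fun w => Complex.exp (L (Function.invFunOn h (ball 0 1) w) / 2), ?_, ?_⟩
    · refine Complex.continuous_exp.comp_continuousOn (ContinuousOn.div_const ?_ _)
      refine hL.comp hcinv ?_
      rintro _ ⟨z, hz, rfl⟩
      rw [hib.leftInvOn_invFunOn hz]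
      exact hz
    · rintro _ ⟨z, hz, rfl⟩
      have h1 : Complex.exp (L z) = f (h z) := hLe hz
      simp only [hib.leftInvOn_invFunOn hz]
      rw [← Complex.exp_nat_mul, ← h1]
      congr 1
      push_cast
      ring) (mem_image_of_mem h h0)
  refine ⟨Function.invFunOn f (h '' ball 0 1), ?_, hfb.symm ?_, ?_⟩
  · intro w hw
    obtain ⟨z, hz, rfl⟩ := hfb.surjOn hw
    exact (hasDerivAt_leftInverse hE hfd hfb.injOn (fun _ hz => hfb.injOn.leftInvOn_invFunOn hz)
      hz (deriv_ne_zero_of_injOn hE hfd hfb.injOn hz)).differentiableAt.differentiableWithinAt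
  · exact ⟨fun w hw => Function.invFunOn_eq (hfb.surjOn hw), hfb.injOn.leftInvOn_invFunOn⟩
  · have h1 := hfb.injOn.leftInvOn_invFunOn (mem_image_of_mem h h0)
    rwa [hf0] at h1

theorem det_smul_one_complex (c : ℂ) :
    (c • (1 : ℂ →L[ℝ] ℂ)).det = ‖c‖ ^ 2 := by
  rw [← Complex.normSq_eq_norm_sq]
  have := congrArg (fun f => f c) Algebra.norm_complex_eq
  simp only [Algebra.norm_apply] at this
  rw [ContinuousLinearMap.det]
  convert this using 2
  · ext x
    simp [Algebra.lmul]
  · rfl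

open Metric Filter Topology MeasureTheory in
theorem exists_short_crosscut {f : ℂ → ℂ}
    (hf : DifferentiableOn ℂ f {z | z.im ∈ Ioo 0 Real.pi})
    (hinj : InjOn f {z | z.im ∈ Ioo 0 Real.pi})
    (hb : Bornology.IsBounded (f '' {z | z.im ∈ Ioo 0 Real.pi})) {ε : ℝ} (hε : 0 < ε) (x₀ : ℝ) :
    ∃ x < x₀, ∀ y₁ ∈ Ioo 0 Real.pi, ∀ y₂ ∈ Ioo 0 Real.pi,
      ‖f ⟨x, y₁⟩ - f ⟨x, y₂⟩‖ ≤ ε := by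
  set S : Set ℂ := {z | z.im ∈ Ioo 0 Real.pi} with hS
  have hSo : IsOpen S := isOpen_Ioo.preimage Complex.continuous_im
  have hd : ∀ z ∈ S, HasDerivAt f (deriv f z) z := fun z hz =>
    (hf.differentiableAt (hSo.mem_nhds hz)).hasDerivAt
  have harea := lintegral_abs_det_fderiv_eq_addHaar_image volume hSo.measurableSet
    (f' := fun z => deriv f z • (1 : ℂ →L[ℝ] ℂ))
    (fun z hz => (hd z hz).complexToReal_fderiv.hasFDerivWithinAt) hinj
  have hfin : ∫⁻ z in S, ENNReal.ofReal (‖deriv f z‖ ^ 2) < ⊤ := by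
    have : ∫⁻ z in S, ENNReal.ofReal (‖deriv f z‖ ^ 2) = volume (f '' S) := by
      rw [← harea]
      refine lintegral_congr fun z => ?_
      rw [det_smul_one_complex, abs_of_nonneg (by positivity)]
    rw [this]
    exact hb.measure_lt_top
  have hmeas : Measurable fun p : ℝ × ℝ => ENNReal.ofReal (‖deriv f ⟨p.1, p.2⟩‖ ^ 2) := by
    have h1 : Measurable fun p : ℝ × ℝ => (⟨p.1, p.2⟩ : ℂ) :=
      Complex.measurableEquivRealProd.symm.measurable
    exact (((measurable_deriv f).comp h1).norm.pow_const 2).ennreal_ofReal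
  have hprod : ∫⁻ x : ℝ, ∫⁻ y in Ioo 0 Real.pi, ENNReal.ofReal (‖deriv f ⟨x, y⟩‖ ^ 2) < ⊤ := by
    have h1 := Complex.volume_preserving_equiv_real_prod.symm.setLIntegral_comp_preimage_emb
      Complex.measurableEquivRealProd.symm.measurableEmbedding
      (fun z => ENNReal.ofReal (‖deriv f z‖ ^ 2)) S
    have h2 : Complex.measurableEquivRealProd.symm ⁻¹' S = univ ×ˢ Ioo 0 Real.pi := by
      ext p
      simp [hS, Complex.measurableEquivRealProd_symm_apply]
    rw [h2] at h1
    simp only [Complex.measurableEquivRealProd_symm_apply] at h1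
    rw [Measure.volume_eq_prod, setLIntegral_prod _ hmeas.aemeasurable] at h1
    rw [Measure.restrict_univ] at h1
    rw [h1]
    exact hfin
  set t := ε / (2 * Real.pi) with ht
  have hpi := Real.pi_pos
  have htpos : 0 < t := by positivity
  obtain ⟨x, hx, hax⟩ : ∃ x < x₀, ∫⁻ y in Ioo 0 Real.pi, ENNReal.ofReal (‖deriv f ⟨x, y⟩‖ ^ 2)
      < ENNReal.ofReal (2 * t * ε) := by
    by_contra! hcon
    have h1 : ∫⁻ x in Iio x₀, ENNReal.ofReal (2 * t * ε) ≤
        ∫⁻ x in Iio x₀, ∫⁻ y in Ioo 0 Real.pi, ENNReal.ofReal (‖deriv f ⟨x, y⟩‖ ^ 2) :=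
      setLIntegral_mono' measurableSet_Iio hcon
    have h2 := h1.trans (setLIntegral_le_lintegral _ _)
    rw [setLIntegral_const, Real.volume_Iio, ENNReal.mul_top] at h2
    · exact absurd hprod (not_lt.2 h2)
    · have : 0 < 2 * t * ε := by positivity
      simpa using this
  refine ⟨x, hx, ?_⟩
  have key : ∀ y₁ ∈ Ioo 0 Real.pi, ∀ y₂ ∈ Ioo 0 Real.pi, y₁ ≤ y₂ →
      ‖f ⟨x, y₂⟩ - f ⟨x, y₁⟩‖ ≤ ε := by
    intro y₁ h₁ y₂ h₂ h12
    have hsub : Icc y₁ y₂ ⊆ Ioo 0 Real.pi := fun y hy => ⟨h₁.1.trans_le hy.1, hy.2.trans_lt h₂.2⟩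
    have hline : ∀ y : ℝ, HasDerivAt (fun y : ℝ => (⟨x, y⟩ : ℂ)) Complex.I y := by
      intro y
      have := ((Complex.ofRealCLM.hasDerivAt (x := y)).mul_const Complex.I).const_add (x : ℂ)
      simp only [Complex.ofRealCLM_apply, Complex.ofReal_one, one_mul] at this
      have e : (fun y : ℝ => (⟨x, y⟩ : ℂ)) = fun y : ℝ => (x : ℂ) + y * Complex.I :=
        funext fun y => Complex.mk_eq_add_mul_I x y
      rw [e]
      exact this
    have hlc : Continuous (fun y : ℝ => (⟨x, y⟩ : ℂ)) :=
      continuous_iff_continuousAt.2 fun y => (hline y).continuousAt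
    have hder : ∀ y ∈ uIcc y₁ y₂, HasDerivAt (fun y : ℝ => f ⟨x, y⟩)
        (deriv f ⟨x, y⟩ * Complex.I) y := by
      intro y hy
      rw [uIcc_of_le h12] at hy
      exact (hd ⟨x, y⟩ (hsub hy)).comp_of_eq y (hline y) rfl
    have hdc : ContinuousOn (fun y : ℝ => deriv f ⟨x, y⟩) (uIcc y₁ y₂) := by
      rw [uIcc_of_le h12]
      exact (hf.deriv hSo).continuousOn.comp hlc.continuousOn fun y hy => hsub hy
    have hdi : IntervalIntegrable (fun y : ℝ => deriv f ⟨x, y⟩ * Complex.I) volume y₁ y₂ :=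
      (hdc.mul continuousOn_const).intervalIntegrable
    have hni : IntervalIntegrable (fun y : ℝ => ‖deriv f ⟨x, y⟩‖ ^ 2) volume y₁ y₂ :=
      (hdc.norm.pow 2).intervalIntegrable
    rw [← intervalIntegral.integral_eq_sub_of_hasDerivAt hder hdi]
    refine (intervalIntegral.norm_integral_le_integral_norm h12).trans ?_
    have hle : ∫ y in y₁..y₂, ‖deriv f ⟨x, y⟩ * Complex.I‖ ≤
        ∫ y in y₁..y₂, (‖deriv f ⟨x, y⟩‖ ^ 2 * (1 / (4 * t)) + t) := by
      refine intervalIntegral.integral_mono_on h12 hdi.norm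
        ((hni.mul_const _).add intervalIntegrable_const) fun y _ => ?_
      rw [norm_mul, Complex.norm_I, mul_one, ← sub_nonneg]
      set n := ‖deriv f ⟨x, y⟩‖
      have : n ^ 2 * (1 / (4 * t)) + t - n = (n - 2 * t) ^ 2 / (4 * t) := by
        field_simp; ring
      rw [this]; positivity
    refine hle.trans ?_
    rw [intervalIntegral.integral_add (hni.mul_const _) intervalIntegrable_const,
      intervalIntegral.integral_mul_const, intervalIntegral.integral_const, smul_eq_mul]
    have hA : ∫ y in y₁..y₂, ‖deriv f ⟨x, y⟩‖ ^ 2 ≤ 2 * t * ε := by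
      rw [intervalIntegral.integral_of_le h12]
      rw [intervalIntegrable_iff_integrableOn_Ioc_of_le h12] at hni
      rw [← ENNReal.ofReal_le_ofReal_iff (by positivity),
        ofReal_integral_eq_lintegral_ofReal hni (ae_of_all _ fun y => by positivity)]
      refine le_trans (lintegral_mono_set ?_) hax.le
      exact Ioc_subset_Icc_self.trans hsub
    have h3 : (∫ y in y₁..y₂, ‖deriv f ⟨x, y⟩‖ ^ 2) * (1 / (4 * t)) ≤ ε / 2 := by
      calc _ ≤ 2 * t * ε * (1 / (4 * t)) := by gcongr
        _ = ε / 2 := by field_simp; ring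
    have h4 : (y₂ - y₁) * t ≤ Real.pi * t := by
      have := h₁.1; have := h₂.2
      gcongr; linarith
    have h5 : Real.pi * t = ε / 2 := by rw [ht]; field_simp
    linarith
  intro y₁ h₁ y₂ h₂
  rcases le_total y₁ y₂ with h | h
  · rw [norm_sub_rev]; exact key y₁ h₁ y₂ h₂ h
  · exact key y₂ h₂ y₁ h₁ h

open Metric in
theorem isPreconnected_ball_diff_closedBall {q : ℂ} (hq : ‖q‖ = 1) {d : ℝ} (hd : 0 < d) :
    IsPreconnected {z : ℂ | ‖z‖ < 1 ∧ d < ‖z - q‖} := by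
  have hq0 : q ≠ 0 := by
    rintro rfl
    simp at hq
  have hhalf : ∀ s : ℂ, s ≠ 0 → (‖1 - s⁻¹‖ < 1 ↔ 1 / 2 < s.re) := by
    intro s hs
    have h1 : 1 - s⁻¹ = (s - 1) / s := by field_simp
    rw [h1, norm_div, div_lt_one (norm_pos_iff.2 hs), ← sq_lt_sq₀ (norm_nonneg _) (norm_nonneg _),
      ← Complex.normSq_eq_norm_sq, ← Complex.normSq_eq_norm_sq, Complex.normSq_apply,
      Complex.normSq_apply]
    simp only [Complex.sub_re, Complex.one_re, Complex.sub_im, Complex.one_im]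
    constructor <;> intro h <;> nlinarith
  have hC : Convex ℝ ({s : ℂ | 1 / 2 < s.re} ∩ ball 0 (1 / d)) :=
    (convex_halfSpace_re_gt _).inter (convex_ball _ _)
  have hne : ∀ s ∈ ({s : ℂ | 1 / 2 < s.re} ∩ ball 0 (1 / d)), s ≠ 0 := by
    rintro s ⟨hs, -⟩ rfl
    norm_num at hs
  have himg : {z : ℂ | ‖z‖ < 1 ∧ d < ‖z - q‖} =
      (fun s : ℂ => q * (1 - s⁻¹)) '' ({s : ℂ | 1 / 2 < s.re} ∩ ball 0 (1 / d)) := by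
    ext z
    constructor
    · rintro ⟨h1, h2⟩
      have hzq : z ≠ q := by
        rintro rfl
        linarith
      have hqz : q - z ≠ 0 := sub_ne_zero.2 hzq.symm
      have hs : q / (q - z) ≠ 0 := div_ne_zero hq0 hqz
      have he : q * (1 - (q / (q - z))⁻¹) = z := by field_simp; ring
      refine ⟨q / (q - z), ⟨?_, ?_⟩, he⟩
      · rw [mem_ofPred_eq, ← hhalf _ hs]
        have := congrArg norm he
        rw [norm_mul, hq, one_mul] at this
        rwa [this]
      · rw [mem_ball_zero_iff, norm_div, hq, norm_sub_rev]
        exact one_div_lt_one_div_of_lt hd h2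
    · rintro ⟨s, hs, rfl⟩
      have hs0 := hne s hs
      have hsn := norm_pos_iff.2 hs0
      refine ⟨?_, ?_⟩
      · rw [norm_mul, hq, one_mul]
        exact (hhalf s hs0).2 hs.1
      · have e : q * (1 - s⁻¹) - q = - (q * s⁻¹) := by ring
        rw [e, norm_neg, norm_mul, hq, one_mul, norm_inv]
        have := hs.2
        rw [mem_ball_zero_iff] at this
        rw [lt_inv_comm₀ hd hsn]
        simpa using this
  rw [himg]
  refine hC.isPreconnected.image _ ?_
  exact continuousOn_const.mul (continuousOn_const.sub (continuousOn_id.inv₀ hne))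

open Metric Filter Topology in
theorem exists_uniform_leftInverse {h : ℂ → ℂ} {C : Set ℂ} (hC : IsCompact C)
    (hc : ContinuousOn h C) (hinj : InjOn h C) {δ : ℝ} (hδ : 0 < δ) :
    ∃ ε > 0, ∀ x ∈ C, ∀ y ∈ C, ‖h x - h y‖ ≤ ε → ‖x - y‖ < δ := by
  by_contra! hcon
  have hP : IsCompact ((C ×ˢ C) ∩ {p : ℂ × ℂ | δ ≤ ‖p.1 - p.2‖}) :=
    (hC.prod hC).inter_right (isClosed_le continuous_const (by fun_prop))
  have hcont : ContinuousOn (fun p : ℂ × ℂ => ‖h p.1 - h p.2‖)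
      ((C ×ˢ C) ∩ {p : ℂ × ℂ | δ ≤ ‖p.1 - p.2‖}) :=
    ((hc.comp continuousOn_fst fun p hp => hp.1.1).sub
      (hc.comp continuousOn_snd fun p hp => hp.1.2)).norm
  obtain ⟨x, hx, y, hy, -, hxy⟩ := hcon 1 one_pos
  obtain ⟨p, hp, hmin⟩ := hP.exists_isMinOn ⟨(x, y), ⟨hx, hy⟩, hxy⟩ hcont
  have hpos : 0 < ‖h p.1 - h p.2‖ := by
    rw [norm_pos_iff, sub_ne_zero]
    intro he
    have := hp.2
    rw [mem_ofPred_eq, hinj hp.1.1 hp.1.2 he, sub_self, norm_zero] at this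
    linarith
  obtain ⟨x, hx, y, hy, hle, hxy⟩ := hcon (‖h p.1 - h p.2‖ / 2) (by positivity)
  have : ‖h p.1 - h p.2‖ ≤ ‖h x - h y‖ := hmin (a := (x, y)) ⟨⟨hx, hy⟩, hxy⟩
  linarith

open Metric in
theorem cayley_im_pos {z : ℂ} (hz : ‖z‖ < 1) : 0 < (Complex.I * (1 - z) / (1 + z)).im := by
  have hz2 : z.re ^ 2 + z.im ^ 2 < 1 := by
    have := (sq_lt_one_iff₀ (norm_nonneg z)).2 hz
    rw [← Complex.normSq_eq_norm_sq, Complex.normSq_apply] at this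
    nlinarith
  have h0 : (1 + z) ≠ 0 := by
    intro h
    have := congrArg Complex.re h
    simp at this
    nlinarith [sq_nonneg z.im]
  have hN := Complex.normSq_pos.2 h0
  rw [Complex.div_im, ← sub_div]
  refine div_pos ?_ hN
  simp
  nlinarith

theorem cayley_inv {w : ℂ} (hw : 0 < w.im) : ‖(Complex.I - w) / (Complex.I + w)‖ < 1 ∧
    Complex.I + w ≠ 0 := by
  have h0 : Complex.I + w ≠ 0 := by
    intro h
    have := congrArg Complex.im h
    simp at this
    linarith
  refine ⟨?_, h0⟩
  rw [norm_div, div_lt_one (norm_pos_iff.2 h0), ← sq_lt_sq₀ (norm_nonneg _) (norm_nonneg _),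
      ← Complex.normSq_eq_norm_sq, ← Complex.normSq_eq_norm_sq, Complex.normSq_apply,
      Complex.normSq_apply]
  simp
  nlinarith

open Metric Filter Topology in
theorem continuousOn_leftInverse_of_isOpen {f g : ℂ → ℂ} {U : Set ℂ} (hU : IsOpen U)
    (hf : ContinuousOn f U) (hinj : InjOn f U) (hg : ∀ x ∈ U, g (f x) = x) :
    ContinuousOn g (f '' U) := by
  rintro _ ⟨x, hx, rfl⟩
  refine ContinuousAt.continuousWithinAt ?_
  rw [ContinuousAt, hg x hx]
  intro N hN
  rw [Filter.mem_map]
  obtain ⟨O, hON, hO, hxO⟩ := _root_.mem_nhds_iff.1 (inter_mem hN (hU.mem_nhds hx))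
  have hOU : O ⊆ U := fun y hy => (hON hy).2
  have := (isOpen_image_of_injOn hO (hf.mono hOU) (hinj.mono hOU)).mem_nhds (mem_image_of_mem f hxO)
  filter_upwards [this]
  rintro _ ⟨y, hy, rfl⟩
  rw [mem_preimage, hg y (hOU hy)]
  exact (hON hy).1

open Metric Filter Topology in
theorem exists_crosscut_nhds {h ψ Φ : ℂ → ℂ} (hc : ContinuousOn h (closedBall 0 1))
    (hinj : InjOn h (closedBall 0 1)) (hψ : DifferentiableOn ℂ ψ (ball 0 1))
    (hψi : InjOn ψ (ball 0 1)) (hΦc : ContinuousOn Φ (ball 0 1))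
    (hΦb : BijOn Φ (ball 0 1) (ball 0 1)) (hΦ0 : Φ 0 = 0)
    (hΦ : ∀ z ∈ ball (0 : ℂ) 1, h (Φ z) = ψ z) {δ : ℝ} (hδ : 0 < δ) :
    ∃ q : ℂ, ‖q‖ = 1 ∧ ∀ᶠ z in 𝓝[ball 0 1] (1 : ℂ), ‖Φ z - q‖ ≤ δ := by
  wlog hδ1 : δ ≤ 1 / 2 generalizing δ
  · obtain ⟨q, hq, hev⟩ := this (δ := 1 / 2) (by norm_num) le_rfl
    exact ⟨q, hq, hev.mono fun z hz => hz.trans (not_le.1 hδ1).le⟩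
  obtain ⟨ε, hε, hunif⟩ := exists_uniform_leftInverse (isCompact_closedBall (0 : ℂ) 1) hc hinj
    (half_pos hδ)
  have hbc := ball_subset_closedBall (x := (0 : ℂ)) (ε := 1)
  -- the chart of the disc by the strip
  set Z : ℂ → ℂ := fun w => (Complex.I - Complex.exp w) / (Complex.I + Complex.exp w) with hZ
  set S : Set ℂ := {z | z.im ∈ Ioo 0 Real.pi} with hS
  have hexp : ∀ w ∈ S, 0 < (Complex.exp w).im := fun w hw => by
    rw [Complex.exp_im]
    exact mul_pos (Real.exp_pos _) (Real.sin_pos_of_pos_of_lt_pi hw.1 hw.2)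
  have hZm : ∀ w ∈ S, Z w ∈ ball (0 : ℂ) 1 := fun w hw => by
    rw [mem_ball_zero_iff]; exact (cayley_inv (hexp w hw)).1
  have hZd : ∀ w : ℂ, Complex.I + Complex.exp w ≠ 0 → DifferentiableAt ℂ Z w := fun w hw => by
    fun_prop (disch := exact hw)
  have hZi : InjOn Z S := by
    intro w hw w' hw' he
    have h1 := (cayley_inv (hexp w hw)).2
    have h2 := (cayley_inv (hexp w' hw')).2
    simp only [hZ] at he
    rw [div_eq_div_iff h1 h2] at he
    have he' : Complex.exp w = Complex.exp w' := by
      have : 2 * Complex.I * (Complex.exp w - Complex.exp w') = 0 := by linear_combination -he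
      simpa [sub_eq_zero] using this
    rw [← Complex.log_exp (x := w) (by linarith [hw.1, Real.pi_pos]) hw.2.le, he',
      Complex.log_exp (by linarith [hw'.1, Real.pi_pos]) hw'.2.le]
  obtain ⟨x, hx, hosc⟩ := exists_short_crosscut (f := fun w => ψ (Z w))
    (hψ.comp (fun w hw => (hZd w (cayley_inv (hexp w hw)).2).differentiableWithinAt) hZm)
    (hψi.comp hZi hZm)
    (((isCompact_closedBall (0 : ℂ) 1).image_of_continuousOn hc).isBounded.subset (by
      rintro _ ⟨w, hw, rfl⟩
      exact ⟨Φ (Z w), hbc (hΦb.mapsTo (hZm w hw)), hΦ _ (hZm w hw)⟩)) hε 0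
  have hΦosc : ∀ y₁ ∈ Ioo 0 Real.pi, ∀ y₂ ∈ Ioo 0 Real.pi,
      ‖Φ (Z ⟨x, y₁⟩) - Φ (Z ⟨x, y₂⟩)‖ < δ / 2 := by
    intro y₁ h₁ y₂ h₂
    have m₁ := hZm ⟨x, y₁⟩ h₁
    have m₂ := hZm ⟨x, y₂⟩ h₂
    refine hunif _ (hbc (hΦb.mapsTo m₁)) _ (hbc (hΦb.mapsTo m₂)) ?_
    rw [hΦ _ m₁, hΦ _ m₂]
    exact hosc y₁ h₁ y₂ h₂
  -- the inverse of `Φ`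
  set Θ := Function.invFunOn Φ (ball 0 1)
  have hinv := hΦb.invOn_invFunOn
  have hΘm : MapsTo Θ (ball 0 1) (ball 0 1) := hΦb.surjOn.mapsTo_invFunOn
  have hΘc : ContinuousOn Θ (ball 0 1) := by
    have := continuousOn_leftInverse_of_isOpen (g := Θ) isOpen_ball hΦc hΦb.injOn
      fun x hx => hinv.1 hx
    rwa [hΦb.image_eq] at this
  have hΘ0 : Θ 0 = 0 := by
    have := hinv.1 (mem_ball_self (x := (0 : ℂ)) one_pos)
    rwa [hΦ0] at this
  -- the crosscut has a point with image near the circle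
  obtain ⟨y₀, hy₀, hfar⟩ : ∃ y ∈ Ioo 0 Real.pi, 1 - δ / 2 < ‖Φ (Z ⟨x, y⟩)‖ := by
    by_contra! hcon
    have hsub : closedBall (0 : ℂ) (1 - δ / 2) ⊆ ball 0 1 := closedBall_subset_ball (by linarith)
    have hcomp : IsCompact (Θ '' closedBall 0 (1 - δ / 2)) :=
      (isCompact_closedBall _ _).image_of_continuousOn (hΘc.mono hsub)
    have hmem : ∀ y ∈ Ioo 0 Real.pi, Z ⟨x, y⟩ ∈ Θ '' closedBall 0 (1 - δ / 2) := fun y hy =>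
      ⟨Φ (Z ⟨x, y⟩), mem_closedBall_zero_iff.2 (hcon y hy), hinv.1 (hZm ⟨x, y⟩ hy)⟩
    have h0 : Complex.I + Complex.exp (⟨x, 0⟩ : ℂ) ≠ 0 := by
      intro h
      have := congrArg Complex.im h
      simp [Complex.exp_im] at this
    have hcont : ContinuousAt (fun y : ℝ => Z ⟨x, y⟩) 0 := by
      have h1 : Continuous (fun y : ℝ => (⟨x, y⟩ : ℂ)) := by
        have e : (fun y : ℝ => (⟨x, y⟩ : ℂ)) = fun y : ℝ => (x : ℂ) + y * Complex.I :=
          funext fun y => Complex.mk_eq_add_mul_I x y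
        rw [e]; fun_prop
      exact ContinuousAt.comp (f := fun y : ℝ => (⟨x, y⟩ : ℂ)) (hZd ⟨x, 0⟩ h0).continuousAt
        h1.continuousAt
    have hlim : Tendsto (fun y : ℝ => Z ⟨x, y⟩) (𝓝[>] 0) (𝓝 (Z ⟨x, 0⟩)) :=
      hcont.mono_left nhdsWithin_le_nhds
    have hin := hcomp.isClosed.mem_of_tendsto hlim (by
      filter_upwards [Ioo_mem_nhdsGT Real.pi_pos] with y hy using hmem y hy)
    obtain ⟨w, hw, hwe⟩ := hin
    have h3 := hΘm (hsub hw)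
    rw [hwe, mem_ball_zero_iff] at h3
    have : ‖Z ⟨x, 0⟩‖ = 1 := by
      simp only [hZ]
      rw [norm_div, div_eq_one_iff_eq (norm_pos_iff.2 h0).ne',
        ← sq_eq_sq₀ (norm_nonneg _) (norm_nonneg _), ← Complex.normSq_eq_norm_sq,
        ← Complex.normSq_eq_norm_sq, Complex.normSq_apply, Complex.normSq_apply]
      simp [Complex.exp_im]
    linarith
  set p := Φ (Z ⟨x, y₀⟩) with hp
  have hplt : ‖p‖ < 1 := mem_ball_zero_iff.1 (hΦb.mapsTo (hZm ⟨x, y₀⟩ hy₀))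
  have hppos : 0 < ‖p‖ := by linarith
  set q : ℂ := ((‖p‖⁻¹ : ℝ) : ℂ) * p with hq
  have hqn : ‖q‖ = 1 := by
    rw [hq, norm_mul, Complex.norm_real, norm_inv, norm_norm, inv_mul_cancel₀ hppos.ne']
  have hpq : ‖p - q‖ < δ / 2 := by
    have : p - q = ((1 - ‖p‖⁻¹ : ℝ) : ℂ) * p := by rw [hq]; push_cast; ring
    rw [this, norm_mul, Complex.norm_real, Real.norm_eq_abs, abs_of_nonpos, neg_sub, sub_mul,
      inv_mul_cancel₀ hppos.ne']
    · linarith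
    · rw [sub_nonpos]
      exact (one_le_inv₀ hppos).2 hplt.le
  have hcross : ∀ y ∈ Ioo 0 Real.pi, ‖Φ (Z ⟨x, y⟩) - q‖ < δ := by
    intro y hy
    have h1 := hΦosc y hy y₀ hy₀
    calc _ ≤ ‖Φ (Z ⟨x, y⟩) - p‖ + ‖p - q‖ := norm_sub_le_norm_sub_add_norm_sub _ _ _
      _ < δ := by linarith
  refine ⟨q, hqn, ?_⟩
  set W : ℂ → ℂ := fun z => Complex.I * (1 - z) / (1 + z) with hW
  have hWc : ∀ z : ℂ, 1 + z ≠ 0 → ContinuousAt (fun z => ‖W z‖) z := fun z hz => by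
    have : ContinuousAt W z := by
      simp only [hW]
      exact ContinuousAt.div (by fun_prop) (by fun_prop) hz
    exact this.norm
  have hne : ∀ z ∈ ball (0 : ℂ) 1, 1 + z ≠ 0 := by
    intro z hz h
    have : z = -1 := by linear_combination h
    rw [this, mem_ball_zero_iff, norm_neg, norm_one] at hz
    exact lt_irrefl _ hz
  have hN : ∀ᶠ z in 𝓝[ball 0 1] (1 : ℂ), ‖W z‖ < Real.exp x := by
    refine nhdsWithin_le_nhds ((hWc 1 (by norm_num)).eventually_lt_const ?_)
    simp [hW, Real.exp_pos]
  filter_upwards [hN, self_mem_nhdsWithin] with z hzN hz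
  by_contra! hcon
  have hE := isPreconnected_ball_diff_closedBall hqn hδ
  have hEb : {z : ℂ | ‖z‖ < 1 ∧ δ < ‖z - q‖} ⊆ ball 0 1 := fun z hz => mem_ball_zero_iff.2 hz.1
  have hΘE := hE.image Θ (hΘc.mono hEb)
  have hWE : ContinuousOn (fun z => ‖W z‖) (Θ '' {z : ℂ | ‖z‖ < 1 ∧ δ < ‖z - q‖}) := by
    rintro _ ⟨y, hy, rfl⟩
    exact (hWc _ (hne _ (hΘm (hEb hy)))).continuousWithinAt
  have hz1 : z ∈ Θ '' {z : ℂ | ‖z‖ < 1 ∧ δ < ‖z - q‖} :=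
    ⟨Φ z, ⟨mem_ball_zero_iff.1 (hΦb.mapsTo hz), hcon⟩, hinv.1 hz⟩
  have hz0 : (0 : ℂ) ∈ Θ '' {z : ℂ | ‖z‖ < 1 ∧ δ < ‖z - q‖} :=
    ⟨0, ⟨by simp, by rw [zero_sub, norm_neg, hqn]; linarith⟩, hΘ0⟩
  obtain ⟨_, ⟨y, hy, rfl⟩, hWy⟩ := hΘE.intermediate_value hz1 hz0 hWE
    (show Real.exp x ∈ Icc _ _ from ⟨hzN.le, by simp [hW, hx.le]⟩)
  have hyb := hΘm (hEb hy)
  have him := cayley_im_pos (mem_ball_zero_iff.1 hyb)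
  have hWne : W (Θ y) ≠ 0 := by
    intro h
    simp only [hW] at h
    rw [h] at him
    simp at him
  set w := Complex.log (W (Θ y)) with hw
  have hwre : w.re = x := by
    rw [hw, Complex.log_re]
    simp only at hWy
    rw [hWy, Real.log_exp]
  have hwim : w.im ∈ Ioo 0 Real.pi := by
    rw [hw, Complex.log_im]
    exact ⟨(Complex.arg_nonneg_iff.2 him.le).lt_of_ne fun h => by
      rw [eq_comm, Complex.arg_eq_zero_iff] at h
      exact him.ne' h.2, (Complex.arg_le_pi _).lt_of_ne fun h => by
      rw [Complex.arg_eq_pi_iff] at h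
      exact him.ne' h.2⟩
  have hZw : Z w = Θ y := by
    have h1 := (cayley_inv him).2
    have h2 := hne _ hyb
    simp only [hZ, hw, Complex.exp_log hWne]
    rw [div_eq_iff h1]
    simp only [hW]
    field_simp
    ring
  have hwx : w = ⟨x, w.im⟩ := Complex.ext hwre rfl
  have := hcross w.im hwim
  rw [← hwx, hZw, hinv.2 (hEb hy)] at this
  exact absurd this (not_lt.2 hy.2.le)

open Metric in
theorem exists_mem_sphere_side {ζ₁ ζ₂ : ℂ} (h₁ : ‖ζ₁‖ = 1) (h₂ : ‖ζ₂‖ = 1) (hne : ζ₁ ≠ ζ₂)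
    (σ : ℝ) (hσ : σ = 1 ∨ σ = -1) :
    ∃ ζ : ℂ, ‖ζ‖ = 1 ∧ 0 < σ * ((ζ - ζ₁) * (starRingEnd ℂ) (ζ₂ - ζ₁)).im := by
  set d := ζ₂ - ζ₁ with hd
  have hd0 : 0 < ‖d‖ := norm_pos_iff.2 (sub_ne_zero.2 hne.symm)
  set m := (ζ₁ + ζ₂) / 2 with hm
  have hm1 : ‖m‖ ≤ 1 := by
    rw [hm, norm_div]
    have := norm_add_le ζ₁ ζ₂
    simp
    linarith
  have hpar : ‖m‖ ^ 2 + ‖d‖ ^ 2 / 4 = 1 := by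
    have := parallelogram_law_with_norm ℝ ζ₁ ζ₂
    have e1 : ‖m‖ = ‖ζ₁ + ζ₂‖ / 2 := by rw [hm, norm_div]; simp
    have e2 : ‖d‖ = ‖ζ₁ - ζ₂‖ := by rw [hd, norm_sub_rev]
    rw [e1, e2]
    rw [h₁, h₂] at this
    nlinarith
  have hσ1 : |σ| = 1 := by rcases hσ with rfl | rfl <;> simp
  have hcont : Continuous fun s : ℝ => ‖m + ((σ * s : ℝ) : ℂ) * (Complex.I * d)‖ := by fun_prop
  have h0 : ‖m + ((σ * 0 : ℝ) : ℂ) * (Complex.I * d)‖ ≤ 1 := by simpa using hm1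
  have hT : 1 ≤ ‖m + ((σ * (2 / ‖d‖) : ℝ) : ℂ) * (Complex.I * d)‖ := by
    have e : ‖((σ * (2 / ‖d‖) : ℝ) : ℂ) * (Complex.I * d)‖ = 2 := by
      rw [norm_mul, norm_mul, Complex.norm_I, one_mul, Complex.norm_real, Real.norm_eq_abs, abs_mul,
        hσ1, one_mul, abs_of_nonneg (by positivity)]
      field_simp
    have := norm_sub_norm_le (((σ * (2 / ‖d‖) : ℝ) : ℂ) * (Complex.I * d)) (-m)
    rw [sub_neg_eq_add, norm_neg, e, add_comm] at this
    linarith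
  obtain ⟨s, hs, hs1⟩ := intermediate_value_Icc (f := fun s : ℝ =>
    ‖m + ((σ * s : ℝ) : ℂ) * (Complex.I * d)‖) (show (0 : ℝ) ≤ 2 / ‖d‖ by positivity)
    hcont.continuousOn ⟨h0, hT⟩
  have hs0 : s ≠ 0 := by
    rintro rfl
    simp at hs1
    rw [hs1] at hpar
    nlinarith
  have hspos : 0 < s := hs.1.lt_of_ne hs0.symm
  refine ⟨_, hs1, ?_⟩
  have e : m + ((σ * s : ℝ) : ℂ) * (Complex.I * d) - ζ₁ =
      ((1 / 2 : ℝ) : ℂ) * d + ((σ * s : ℝ) : ℂ) * (Complex.I * d) := by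
    rw [hm, hd]; push_cast; ring
  rw [e]
  have hσ2 : σ * σ = 1 := by rcases hσ with rfl | rfl <;> norm_num
  have : ((((1 / 2 : ℝ) : ℂ) * d + ((σ * s : ℝ) : ℂ) * (Complex.I * d)) *
      (starRingEnd ℂ) d).im = σ * s * ‖d‖ ^ 2 := by
    rw [← Complex.normSq_eq_norm_sq, Complex.normSq_apply]
    simp
    ring
  rw [this]
  have : σ * (σ * s * ‖d‖ ^ 2) = (σ * σ) * (s * ‖d‖ ^ 2) := by ring
  rw [this, hσ2, one_mul]
  positivity

open Metric in
theorem eq_or_eq_of_mem_chord {ζ₁ ζ₂ z : ℂ} (h₁ : ‖ζ₁‖ = 1) (h₂ : ‖ζ₂‖ = 1) (hne : ζ₁ ≠ ζ₂)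
    (hz : ‖z‖ = 1) (hl : ((z - ζ₁) * (starRingEnd ℂ) (ζ₂ - ζ₁)).im = 0) : z = ζ₁ ∨ z = ζ₂ := by
  have hd : ζ₂ - ζ₁ ≠ 0 := sub_ne_zero.2 hne.symm
  set d := ζ₂ - ζ₁ with hdd
  have hN : 0 < Complex.normSq d := Complex.normSq_pos.2 hd
  obtain ⟨t, ht⟩ : ∃ t : ℝ, z = ζ₁ + t * d := by
    refine ⟨((z - ζ₁) / d).re, ?_⟩
    have : ((z - ζ₁) / d).im = 0 := by
      have : (z - ζ₁) / d = ((z - ζ₁) * (starRingEnd ℂ) d) * ((Complex.normSq d)⁻¹ : ℝ) := by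
        rw [div_eq_mul_inv, Complex.inv_def]; ring
      rw [this, Complex.im_mul_ofReal, hl, zero_mul]
    have e : (((z - ζ₁) / d).re : ℂ) = (z - ζ₁) / d := Complex.ext rfl (by simp [this])
    rw [e, div_mul_cancel₀ _ hd]
    ring
  have hq : ∀ w : ℂ, ‖w‖ = 1 → w.re * w.re + w.im * w.im = 1 := by
    intro w hw
    rw [← Complex.normSq_apply, Complex.normSq_eq_norm_sq, hw, one_pow]
  have q1 := hq _ h₁
  have q2 := hq _ h₂
  have q3 := hq _ hz
  have e2 : ζ₂ = ζ₁ + d := by rw [hdd]; ring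
  rw [e2] at q2
  rw [ht] at q3
  rw [Complex.normSq_apply] at hN
  simp only [Complex.add_re, Complex.add_im, Complex.mul_re, Complex.mul_im, Complex.ofReal_re,
    Complex.ofReal_im, zero_mul, sub_zero, add_zero] at q2 q3
  have : (t * (t - 1)) * (d.re * d.re + d.im * d.im) = 0 := by linear_combination q3 - t * q2 - (1 - t) * q1
  rcases mul_eq_zero.1 this with h | h
  · rcases mul_eq_zero.1 h with h | h
    · left; rw [ht, h]; simp
    · right
      have : t = 1 := by linarith
      rw [ht, this, e2]; simp
  · exact absurd h hN.ne'

open Metric Filter Topology in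
theorem injOn_sphere_of_no_constant_arc {Φ : ℂ → ℂ} (hc : ContinuousOn Φ (closedBall 0 1))
    (hb : BijOn Φ (ball 0 1) (ball 0 1)) (hs : MapsTo Φ (sphere 0 1) (sphere 0 1))
    (hnc : ∀ ζ ∈ sphere (0 : ℂ) 1, ∀ p, ¬ ∀ᶠ z in 𝓝[sphere 0 1] ζ, Φ z = p) :
    InjOn Φ (sphere 0 1) := by
  intro ζ₁ h₁ ζ₂ h₂ he
  by_contra hne
  rw [mem_sphere_zero_iff_norm] at h₁ h₂
  set p := Φ ζ₁ with hp
  have hp1 : ‖p‖ = 1 := mem_sphere_zero_iff_norm.1 (hs (mem_sphere_zero_iff_norm.2 h₁))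
  have hbc := ball_subset_closedBall (x := (0 : ℂ)) (ε := 1)
  set ℓ : ℂ → ℝ := fun z => ((z - ζ₁) * (starRingEnd ℂ) (ζ₂ - ζ₁)).im with hℓ
  have hℓc : Continuous ℓ := by
    have : Continuous fun z : ℂ => (z - ζ₁) * (starRingEnd ℂ) (ζ₂ - ζ₁) := by fun_prop
    exact Complex.continuous_im.comp this
  have hside : ∀ σ : ℝ, σ = 1 ∨ σ = -1 → ∃ ζ ∈ sphere (0 : ℂ) 1, 0 < σ * ℓ ζ ∧ Φ ζ ≠ p := by
    intro σ hσ
    by_contra! hcon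
    obtain ⟨ζ, hζ, hζℓ⟩ := exists_mem_sphere_side h₁ h₂ hne σ hσ
    refine hnc ζ (mem_sphere_zero_iff_norm.2 hζ) p ?_
    have : ∀ᶠ z in 𝓝[sphere 0 1] ζ, 0 < σ * ℓ z :=
      nhdsWithin_le_nhds ((continuous_const.mul hℓc).continuousAt.eventually_const_lt hζℓ)
    filter_upwards [this, self_mem_nhdsWithin] with z hz hzs using hcon z hzs hz
  set J := Φ '' (closedBall 0 1 ∩ {z | ℓ z = 0}) with hJ
  have hJc : IsCompact J :=
    ((isCompact_closedBall _ _).inter_right (isClosed_eq hℓc continuous_const)).image_of_continuousOn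
      (hc.mono inter_subset_left)
  have hJp : ∀ w ∈ J, ‖w‖ = 1 → w = p := by
    rintro _ ⟨z, ⟨hz, hzl⟩, rfl⟩ hw
    have hz1 : ‖z‖ = 1 := by
      refine le_antisymm (mem_closedBall_zero_iff.1 hz) (not_lt.1 fun hlt => ?_)
      have := hb.mapsTo (mem_ball_zero_iff.2 hlt)
      rw [mem_ball_zero_iff, hw] at this
      exact lt_irrefl _ this
    rcases eq_or_eq_of_mem_chord h₁ h₂ hne hz1 hzl with rfl | rfl
    · rfl
    · exact he.symm
  obtain ⟨ζ₃, h₃, hl₃, hp₃⟩ := hside 1 (Or.inl rfl)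
  obtain ⟨ζ₄, h₄, hl₄, hp₄⟩ := hside (-1) (Or.inr rfl)
  have hp0 : p ≠ 0 := by
    intro h
    rw [h, norm_zero] at hp1
    exact zero_ne_one hp1
  set m : ℂ → ℂ := fun s => p * (1 - s⁻¹) with hm
  set μ : ℂ → ℂ := fun w => p / (p - w) with hμ
  have hmμ : ∀ w, w ≠ p → m (μ w) = w ∧ μ w ≠ 0 := by
    intro w hw
    have : p - w ≠ 0 := sub_ne_zero.2 hw.symm
    refine ⟨?_, div_ne_zero hp0 this⟩
    simp only [hm, hμ]
    field_simp
    ring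
  have hnorm : ∀ s : ℂ, s ≠ 0 → ‖m s‖ = ‖s - 1‖ / ‖s‖ := by
    intro s hs
    have h1 : 1 - s⁻¹ = (s - 1) / s := by field_simp
    simp only [hm]
    rw [norm_mul, hp1, one_mul, h1, norm_div]
  have hre : ∀ s : ℂ, ‖s - 1‖ ^ 2 = ‖s‖ ^ 2 + (1 - 2 * s.re) := by
    intro s
    rw [← Complex.normSq_eq_norm_sq, ← Complex.normSq_eq_norm_sq, Complex.normSq_apply,
      Complex.normSq_apply]
    simp
    ring
  have hlt : ∀ s : ℂ, s ≠ 0 → (‖m s‖ < 1 ↔ 1 / 2 < s.re) := by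
    intro s hs
    rw [hnorm s hs, div_lt_one (norm_pos_iff.2 hs), ← sq_lt_sq₀ (norm_nonneg _) (norm_nonneg _),
      hre]
    constructor <;> intro h <;> linarith
  have heq : ∀ s : ℂ, s ≠ 0 → (‖m s‖ = 1 ↔ s.re = 1 / 2) := by
    intro s hs
    rw [hnorm s hs, div_eq_one_iff_eq (norm_pos_iff.2 hs).ne',
      ← sq_eq_sq₀ (norm_nonneg _) (norm_nonneg _), hre]
    constructor <;> intro h <;> linarith
  set s₃ := μ (Φ ζ₃)
  set s₄ := μ (Φ ζ₄)
  have hs₃ : s₃.re = 1 / 2 := by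
    rw [← heq _ (hmμ _ hp₃).2, (hmμ _ hp₃).1]
    exact mem_sphere_zero_iff_norm.1 (hs h₃)
  have hs₄ : s₄.re = 1 / 2 := by
    rw [← heq _ (hmμ _ hp₄).2, (hmμ _ hp₄).1]
    exact mem_sphere_zero_iff_norm.1 (hs h₄)
  have hBre : ∀ s ∈ segment ℝ s₃ s₄, s.re = 1 / 2 := by
    rintro s ⟨a, b, -, -, hab, rfl⟩
    simp [hs₃, hs₄]
    linarith
  have hBne : ∀ s : ℂ, 1 / 2 ≤ s.re → s ≠ 0 := by
    rintro s hs rfl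
    norm_num at hs
  set O : Set ℂ := {s | s ≠ 0} ∩ m ⁻¹' Jᶜ with hO
  have hmc : ContinuousOn m {s | s ≠ 0} :=
    continuousOn_const.mul (continuousOn_const.sub (continuousOn_id.inv₀ fun s hs => hs))
  have hOo : IsOpen O := hmc.isOpen_inter_preimage isOpen_ne hJc.isClosed.isOpen_compl
  have hBO : segment ℝ s₃ s₄ ⊆ O := by
    intro s hs
    have h0 := hBne s (hBre s hs).ge
    refine ⟨h0, fun hsJ => ?_⟩
    have h1 := hJp _ hsJ ((heq s h0).2 (hBre s hs))
    simp only [hm] at h1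
    have h2 : p * s⁻¹ = 0 := by linear_combination -h1
    simp [hp0, h0] at h2
  have hBcomp : IsCompact (segment ℝ s₃ s₄) := by
    rw [segment_eq_image ℝ s₃ s₄]
    exact isCompact_Icc.image (by fun_prop)
  obtain ⟨κ, hκ, hκO⟩ := hBcomp.exists_thickening_subset_open hOo hBO
  set A := m '' (thickening κ (segment ℝ s₃ s₄) ∩ {s | 1 / 2 < s.re}) with hA
  have hAp : IsPreconnected A :=
    (((convex_segment s₃ s₄).thickening κ).inter (convex_halfSpace_re_gt _)).isPreconnected.image _
      (hmc.mono fun s hs => hBne s (le_of_lt hs.2))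
  have hAb : A ⊆ ball 0 1 := by
    rintro _ ⟨s, hs, rfl⟩
    exact mem_ball_zero_iff.2 ((hlt s (hBne s (le_of_lt hs.2))).2 hs.2)
  have hAJ : ∀ w ∈ A, w ∉ J := by
    rintro _ ⟨s, hs, rfl⟩
    exact (hκO hs.1).2
  set Θ := Function.invFunOn Φ (ball 0 1)
  have hinv := hb.invOn_invFunOn
  have hΘm : MapsTo Θ (ball 0 1) (ball 0 1) := hb.surjOn.mapsTo_invFunOn
  have hΘc : ContinuousOn Θ (ball 0 1) := by
    have := continuousOn_leftInverse_of_isOpen (g := Θ) isOpen_ball (hc.mono hbc) hb.injOn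
      fun x hx => hinv.1 hx
    rwa [hb.image_eq] at this
  have hreach : ∀ σ : ℝ, ∀ ζ ∈ sphere (0 : ℂ) 1, 0 < σ * ℓ ζ → Φ ζ ≠ p →
      μ (Φ ζ) ∈ segment ℝ s₃ s₄ → ∃ z ∈ Θ '' A, 0 < σ * ℓ z := by
    intro σ ζ hζ hζl hζp hζs
    have hcl : ζ ∈ closure (ball (0 : ℂ) 1) := by
      rw [closure_ball _ one_ne_zero]
      exact sphere_subset_closedBall hζ
    have : (𝓝[ball 0 1] ζ).NeBot := mem_closure_iff_nhdsWithin_neBot.1 hcl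
    have hΦt : Tendsto Φ (𝓝[ball 0 1] ζ) (𝓝 (Φ ζ)) :=
      (hc ζ (sphere_subset_closedBall hζ)).mono_left (nhdsWithin_mono _ hbc)
    have hμc : ContinuousAt μ (Φ ζ) := by
      simp only [hμ]
      exact ContinuousAt.div (by fun_prop) (by fun_prop) (sub_ne_zero.2 hζp.symm)
    have h1 : ∀ᶠ z in 𝓝[ball 0 1] ζ, 0 < σ * ℓ z :=
      nhdsWithin_le_nhds ((continuous_const.mul hℓc).continuousAt.eventually_const_lt hζl)
    have h2 : ∀ᶠ z in 𝓝[ball 0 1] ζ, μ (Φ z) ∈ thickening κ (segment ℝ s₃ s₄) :=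
      (hμc.tendsto.comp hΦt) (isOpen_thickening.mem_nhds (self_subset_thickening hκ _ hζs))
    have h3 : ∀ᶠ z in 𝓝[ball 0 1] ζ, Φ z ≠ p := hΦt.eventually_ne hζp
    obtain ⟨z, h1, h2, h3, hz⟩ := (h1.and (h2.and (h3.and self_mem_nhdsWithin))).exists
    refine ⟨z, ⟨Φ z, ⟨μ (Φ z), ⟨h2, ?_⟩, (hmμ _ h3).1⟩, hinv.1 hz⟩, h1⟩
    rw [mem_ofPred_eq, ← hlt _ (hmμ _ h3).2, (hmμ _ h3).1]
    exact mem_ball_zero_iff.1 (hb.mapsTo hz)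
  obtain ⟨z, hz, hzl⟩ := hreach 1 ζ₃ h₃ hl₃ hp₃ (left_mem_segment _ _ _)
  obtain ⟨z', hz', hzl'⟩ := hreach (-1) ζ₄ h₄ hl₄ hp₄ (right_mem_segment _ _ _)
  obtain ⟨_, ⟨w, hw, rfl⟩, hwl⟩ := (hAp.image Θ (hΘc.mono hAb)).intermediate_value hz' hz
    hℓc.continuousOn (show (0 : ℝ) ∈ Icc _ _ from ⟨by linarith, by linarith⟩)
  refine hAJ w hw ⟨Θ w, ⟨hbc (hΘm (hAb hw)), hwl⟩, hinv.2 (hAb hw)⟩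

open Metric Filter Topology in
/-- Boundary uniqueness: a function continuous on the closed disc and holomorphic inside that is
constant near a boundary point takes the same value at the centre. -/
theorem apply_zero_eq_of_eventually_eq_const {f : ℂ → ℂ} (hd : DifferentiableOn ℂ f (ball 0 1))
    (hc : ContinuousOn f (closedBall 0 1)) {ζ c : ℂ} (hζ : ‖ζ‖ = 1)
    (hev : ∀ᶠ z in 𝓝[sphere 0 1] ζ, f z = c) : f 0 = c := by
  obtain ⟨δ, hδ, hδf⟩ := Metric.mem_nhdsWithin_iff.1 hev
  have hcov := (isCompact_sphere (0 : ℂ) 1).elim_nhds_subcover'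
    (fun t _ => {z : ℂ | ‖ζ * t⁻¹ * z - ζ‖ < δ}) (by
      intro t ht
      have hcont : Continuous fun z : ℂ => ‖ζ * t⁻¹ * z - ζ‖ := by fun_prop
      refine (isOpen_lt hcont continuous_const).mem_nhds ?_
      have ht0 : t ≠ 0 := ne_of_mem_sphere ht one_ne_zero
      have : ζ * t⁻¹ * t - ζ = 0 := by field_simp; ring
      rw [mem_ofPred_eq, this, norm_zero]
      exact hδ)
  obtain ⟨T, hT⟩ := hcov
  have hrot : ∀ t ∈ sphere (0 : ℂ) 1, ∀ z, ‖ζ * t⁻¹ * z‖ = ‖z‖ := by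
    intro t ht z
    rw [norm_mul, norm_mul, hζ, norm_inv, mem_sphere_zero_iff_norm.1 ht]
    simp
  set g : ℂ → ℂ := fun z => ∏ t ∈ T, (f (ζ * (t : ℂ)⁻¹ * z) - c) with hg
  have hgd : DiffContOnCl ℂ g (ball 0 1) := by
    refine ⟨?_, ?_⟩
    · refine DifferentiableOn.fun_finsetProd fun t _ => ?_
      refine (hd.comp (by fun_prop) fun z hz => ?_).sub_const c
      rw [mem_ball_zero_iff] at hz ⊢
      rwa [hrot t t.2]
    · rw [closure_ball _ one_ne_zero]
      refine continuousOn_finsetProd _ fun t _ => ?_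
      refine (hc.comp (by fun_prop) fun z hz => ?_).sub continuousOn_const
      rw [mem_closedBall_zero_iff] at hz ⊢
      rwa [hrot t t.2]
  have hg0 : ∀ z ∈ frontier (ball (0 : ℂ) 1), ‖g z‖ ≤ 0 := by
    intro z hz
    rw [frontier_ball _ one_ne_zero] at hz
    have := hT hz
    simp only [mem_iUnion] at this
    obtain ⟨t, ht, htz⟩ := this
    rw [norm_le_zero_iff]
    refine Finset.prod_eq_zero ht ?_
    have : f (ζ * (t : ℂ)⁻¹ * z) = c := by
      refine hδf ⟨?_, ?_⟩
      · rw [mem_ball, dist_eq_norm]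
        exact htz
      · rw [mem_sphere_zero_iff_norm, hrot t t.2]
        exact mem_sphere_zero_iff_norm.1 hz
    rw [this, sub_self]
  have := Complex.norm_le_of_forall_mem_frontier_norm_le isBounded_ball hgd hg0
    (subset_closure (mem_ball_self (x := (0 : ℂ)) one_pos))
  rw [norm_le_zero_iff, hg, Finset.prod_eq_zero_iff] at this
  obtain ⟨t, -, ht⟩ := this
  rw [mul_zero] at ht
  exact sub_eq_zero.1 ht

open Metric Filter Topology in
/-- Riemann mapping onto the interior of an embedded closed disc, with continuous extension to the
boundary, expressed through the embedding `h`: the conformal map is `h ∘ Φ`. -/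
theorem exists_caratheodory {h : ℂ → ℂ} (hc : ContinuousOn h (closedBall 0 1))
    (hinj : InjOn h (closedBall 0 1)) :
    ∃ ψ Φ : ℂ → ℂ, DifferentiableOn ℂ ψ (ball 0 1) ∧ ContinuousOn Φ (closedBall 0 1) ∧
      BijOn Φ (closedBall 0 1) (closedBall 0 1) ∧ BijOn Φ (ball 0 1) (ball 0 1) ∧
      BijOn Φ (sphere 0 1) (sphere 0 1) ∧ Φ 0 = 0 ∧ ∀ z ∈ closedBall (0 : ℂ) 1, ψ z = h (Φ z) := by
  obtain ⟨ψ, hψd, hψb, hψ0⟩ := exists_riemann_map hc hinj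
  have hbc := ball_subset_closedBall (x := (0 : ℂ)) (ε := 1)
  have hsc := sphere_subset_closedBall (x := (0 : ℂ)) (ε := 1)
  set Φ₀ : ℂ → ℂ := fun z => Function.invFunOn h (ball 0 1) (ψ z) with hΦ₀
  have hex : ∀ z ∈ ball (0 : ℂ) 1, ∃ w ∈ ball (0 : ℂ) 1, h w = ψ z := fun z hz => hψb.mapsTo hz
  have hm₀ : MapsTo Φ₀ (ball 0 1) (ball 0 1) := fun z hz => Function.invFunOn_mem (hex z hz)
  have hh₀ : ∀ z ∈ ball (0 : ℂ) 1, h (Φ₀ z) = ψ z := fun z hz => Function.invFunOn_eq (hex z hz)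
  have hb₀ : BijOn Φ₀ (ball 0 1) (ball 0 1) := by
    refine ⟨hm₀, fun z hz w hw he => ?_, fun w hw => ?_⟩
    · refine hψb.injOn hz hw ?_
      rw [← hh₀ z hz, ← hh₀ w hw, he]
    · obtain ⟨z, hz, hzw⟩ := hψb.surjOn (mem_image_of_mem h hw)
      refine ⟨z, hz, hinj (hbc (hm₀ hz)) (hbc hw) ?_⟩
      rw [hh₀ z hz, hzw]
  have h0b : (0 : ℂ) ∈ ball (0 : ℂ) 1 := mem_ball_self one_pos
  have h00 : Φ₀ 0 = 0 := hinj (hbc (hm₀ h0b)) (hbc h0b) (by rw [hh₀ 0 h0b, hψ0])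
  have hc₀ : ContinuousOn Φ₀ (ball 0 1) := by
    intro z hz
    refine Metric.tendsto_nhds.2 fun δ hδ => ?_
    obtain ⟨ε, hε, hu⟩ := exists_uniform_leftInverse (isCompact_closedBall (0 : ℂ) 1) hc hinj hδ
    filter_upwards [Metric.tendsto_nhds.1 (hψd.continuousOn z hz) ε hε, self_mem_nhdsWithin]
      with w hw hwb
    rw [dist_eq_norm] at hw ⊢
    refine hu _ (hbc (hm₀ hwb)) _ (hbc (hm₀ hz)) ?_
    rw [hh₀ w hwb, hh₀ z hz]
    exact hw.le
  -- boundary oscillation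
  have hosc : ∀ b ∈ sphere (0 : ℂ) 1, ∀ δ > 0,
      ∃ q : ℂ, ‖q‖ = 1 ∧ ∀ᶠ z in 𝓝[ball 0 1] b, ‖Φ₀ z - q‖ ≤ δ := by
    intro b hb δ hδ
    have hb0 : b ≠ 0 := ne_of_mem_sphere hb one_ne_zero
    have hb1 := mem_sphere_zero_iff_norm.1 hb
    have hrm : ∀ c : ℂ, ‖c‖ = 1 → MapsTo (fun z => c * z) (ball (0 : ℂ) 1) (ball 0 1) := by
      intro c hc z hz
      rw [mem_ball_zero_iff] at hz ⊢
      rwa [norm_mul, hc, one_mul]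
    have hbi : ‖b⁻¹‖ = 1 := by rw [norm_inv, hb1, inv_one]
    have hri : InjOn (fun z => b * z) (ball (0 : ℂ) 1) := (mul_right_injective₀ hb0).injOn
    have hrb : BijOn (fun z => b * z) (ball (0 : ℂ) 1) (ball 0 1) := by
      refine ⟨hrm b hb1, hri, fun z hz => ⟨b⁻¹ * z, hrm _ hbi hz, ?_⟩⟩
      simp only
      rw [mul_inv_cancel_left₀ hb0]
    obtain ⟨q, hq, hev⟩ := exists_crosscut_nhds (ψ := fun z => ψ (b * z)) (Φ := fun z => Φ₀ (b * z))
      hc hinj (hψd.comp (by fun_prop) (hrm b hb1)) (hψb.injOn.comp hri (hrm b hb1))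
      (hc₀.comp (by fun_prop) (hrm b hb1)) (hb₀.comp hrb) (by rw [mul_zero, h00])
      (fun z hz => hh₀ _ (hrm b hb1 hz)) hδ
    refine ⟨q, hq, ?_⟩
    have ht : Tendsto (fun z : ℂ => b⁻¹ * z) (𝓝[ball 0 1] b) (𝓝[ball 0 1] 1) := by
      refine tendsto_nhdsWithin_iff.2 ⟨?_, ?_⟩
      · have : ContinuousAt (fun z : ℂ => b⁻¹ * z) b := by fun_prop
        have h1 := this.tendsto
        rw [inv_mul_cancel₀ hb0] at h1
        exact h1.mono_left nhdsWithin_le_nhds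
      · filter_upwards [self_mem_nhdsWithin] with z hz using hrm _ hbi hz
    filter_upwards [ht.eventually hev] with z hz
    rwa [mul_inv_cancel_left₀ hb0] at hz
  have hcl : closure (ball (0 : ℂ) 1) = closedBall 0 1 := closure_ball _ one_ne_zero
  have hneBot : ∀ b ∈ closedBall (0 : ℂ) 1, (𝓝[ball 0 1] b).NeBot := fun b hb =>
    mem_closure_iff_nhdsWithin_neBot.1 (hcl.ge hb)
  have hlim : ∀ b ∈ closedBall (0 : ℂ) 1, ∃ y, Tendsto Φ₀ (𝓝[ball 0 1] b) (𝓝 y) := by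
    intro b hb
    rcases (mem_closedBall_zero_iff.1 hb).lt_or_eq with hlt | heq
    · exact ⟨_, hc₀ b (mem_ball_zero_iff.2 hlt)⟩
    · have hne := hneBot b hb
      refine cauchy_map_iff_exists_tendsto.1 ?_
      rw [Metric.cauchy_iff]
      refine ⟨hne.map _, fun δ hδ => ?_⟩
      obtain ⟨q, hq, hev⟩ := hosc b (mem_sphere_zero_iff_norm.2 heq) (δ / 3) (by positivity)
      refine ⟨closedBall q (δ / 3), ?_, fun x hx y hy => ?_⟩
      · rw [Filter.mem_map]
        filter_upwards [hev] with z hz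
        rw [mem_preimage, mem_closedBall, dist_eq_norm]
        exact hz
      · have := dist_triangle_right x y q
        rw [mem_closedBall] at hx hy
        linarith
  set Φ : ℂ → ℂ := extendFrom (ball 0 1) Φ₀ with hΦ
  have hΦc : ContinuousOn Φ (closedBall 0 1) := continuousOn_extendFrom hcl.ge hlim
  have hΦe : ∀ z ∈ ball (0 : ℂ) 1, Φ z = Φ₀ z := fun z hz =>
    extendFrom_eq (subset_closure hz) (hc₀ z hz)
  have hΦt : ∀ b ∈ closedBall (0 : ℂ) 1, Tendsto Φ₀ (𝓝[ball 0 1] b) (𝓝 (Φ b)) := fun b hb =>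
    tendsto_extendFrom (hlim b hb)
  have hΦb : BijOn Φ (ball 0 1) (ball 0 1) := hb₀.congr fun z hz => (hΦe z hz).symm
  have hΦs : MapsTo Φ (sphere 0 1) (sphere 0 1) := by
    intro b hb
    rw [mem_sphere_zero_iff_norm]
    have hne := hneBot b (hsc hb)
    refine eq_of_forall_dist_le fun δ hδ => ?_
    obtain ⟨q, hq, hev⟩ := hosc b hb δ hδ
    have : ‖Φ b - q‖ ≤ δ := le_of_tendsto ((hΦt b (hsc hb)).sub_const q).norm hev
    rw [Real.dist_eq, ← hq]
    exact (abs_norm_sub_norm_le _ _).trans this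
  have hΦm : MapsTo Φ (closedBall 0 1) (closedBall 0 1) := by
    intro z hz
    rcases (mem_closedBall_zero_iff.1 hz).lt_or_eq with hlt | heq
    · exact hbc (hΦb.mapsTo (mem_ball_zero_iff.2 hlt))
    · exact hsc (hΦs (mem_sphere_zero_iff_norm.2 heq))
  have hΦsurj : SurjOn Φ (closedBall 0 1) (closedBall 0 1) := by
    have hcomp := ((isCompact_closedBall (0 : ℂ) 1).image_of_continuousOn hΦc).isClosed
    intro w hw
    rw [← hcl] at hw
    refine closure_minimal ?_ hcomp hw
    intro w hw
    obtain ⟨z, hz, rfl⟩ := hΦb.surjOn hw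
    exact mem_image_of_mem _ (hbc hz)
  have hhΦ : ∀ z ∈ ball (0 : ℂ) 1, h (Φ z) = ψ z := fun z hz => by rw [hΦe z hz, hh₀ z hz]
  have hψcont : ContinuousOn (fun z => h (Φ z)) (closedBall 0 1) := hc.comp hΦc hΦm
  have hψdiff : DifferentiableOn ℂ (fun z => h (Φ z)) (ball 0 1) := hψd.congr hhΦ
  have hΦ0 : Φ 0 = 0 := by rw [hΦe 0 h0b, h00]
  have hΦsi : InjOn Φ (sphere 0 1) := by
    refine injOn_sphere_of_no_constant_arc hΦc hΦb hΦs fun ζ hζ p hev => ?_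
    have h1 := apply_zero_eq_of_eventually_eq_const hψdiff hψcont (mem_sphere_zero_iff_norm.1 hζ)
      (hev.mono fun z hz => by rw [hz])
    have hp := hev.self_of_nhdsWithin hζ
    have hps : p ∈ sphere (0 : ℂ) 1 := hp ▸ hΦs hζ
    have h2 := hinj (hbc (hΦ0.symm ▸ h0b)) (hsc hps) h1
    rw [← h2, hΦ0, mem_sphere_zero_iff_norm, norm_zero] at hps
    exact zero_ne_one hps
  have hmem : ∀ z ∈ closedBall (0 : ℂ) 1, z ∈ ball (0 : ℂ) 1 ∨ z ∈ sphere (0 : ℂ) 1 := fun z hz => by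
    rcases (mem_closedBall_zero_iff.1 hz).lt_or_eq with h | h
    · exact Or.inl (mem_ball_zero_iff.2 h)
    · exact Or.inr (mem_sphere_zero_iff_norm.2 h)
  have hdisj : ∀ z ∈ ball (0 : ℂ) 1, z ∉ sphere (0 : ℂ) 1 := fun z hz hs => by
    rw [mem_ball_zero_iff] at hz
    rw [mem_sphere_zero_iff_norm] at hs
    linarith
  have hΦinj : InjOn Φ (closedBall 0 1) := by
    intro z hz w hw he
    rcases hmem z hz with hz | hz <;> rcases hmem w hw with hw | hw
    · exact hΦb.injOn hz hw he
    · exact absurd (hΦs hw) (he ▸ hdisj _ (hΦb.mapsTo hz))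
    · exact absurd (hΦs hz) (he ▸ hdisj _ (hΦb.mapsTo hw))
    · exact hΦsi hz hw he
  refine ⟨fun z => h (Φ z), Φ, hψdiff, hΦc, ⟨hΦm, hΦinj, hΦsurj⟩, hΦb, ⟨hΦs, hΦsi, ?_⟩, hΦ0,
    fun z _ => rfl⟩
  intro w hw
  obtain ⟨z, hz, rfl⟩ := hΦsurj (hsc hw)
  rcases hmem z hz with h | h
  · exact absurd hw (hdisj _ (hΦb.mapsTo h))
  · exact ⟨z, h, rfl⟩

open Metric Filter Topology in
theorem exists_analytic_leftInverse {e : ℂ → ℂ} {a : ℂ} (ha : AnalyticAt ℂ e a)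
    (hd : deriv e a ≠ 0) :
    ∃ L : ℂ → ℂ, AnalyticAt ℂ L (e a) ∧ deriv L (e a) ≠ 0 ∧ L (e a) = a ∧
      (∀ᶠ u in 𝓝 a, L (e u) = u) ∧ ∀ᶠ w in 𝓝 (e a), e (L w) = w := by
  obtain ⟨N, hN, hNi⟩ := (RegAt.of_analyticAt (n := 1) ha hd).exists_injOn le_rfl
  obtain ⟨U, hUN, hU, haU⟩ := _root_.mem_nhds_iff.1 (inter_mem hN ha.eventually_analyticAt)
  have hinj : InjOn e U := hNi.mono fun x hx => (hUN hx).1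
  have hdiff : DifferentiableOn ℂ e U := fun x hx =>
    (hUN hx).2.differentiableAt.differentiableWithinAt
  set L := Function.invFunOn e U
  have hL : ∀ x ∈ U, L (e x) = x := fun x hx => hinj.leftInvOn_invFunOn hx
  have hopen := isOpen_image_of_injOn hU hdiff.continuousOn hinj
  have hder : ∀ x ∈ U, HasDerivAt L (deriv e x)⁻¹ (e x) := fun x hx =>
    hasDerivAt_leftInverse hU hdiff hinj hL hx (deriv_ne_zero_of_injOn hU hdiff hinj hx)
  have hLd : DifferentiableOn ℂ L (e '' U) := by
    rintro _ ⟨x, hx, rfl⟩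
    exact (hder x hx).differentiableAt.differentiableWithinAt
  have hmem := hopen.mem_nhds (mem_image_of_mem e haU)
  refine ⟨L, hLd.analyticAt hmem, ?_, hL a haU, ?_, ?_⟩
  · rw [(hder a haU).deriv]
    exact inv_ne_zero hd
  · filter_upwards [hU.mem_nhds haU] with x hx using hL x hx
  · filter_upwards [hmem]
    rintro _ ⟨x, hx, rfl⟩
    rw [hL x hx]

open Metric Complex in
/-- The real line is removable for continuous functions. -/
theorem differentiableOn_ball_of_continuousOn_of_im_ne_zero {f : ℂ → ℂ} {δ : ℝ}
    (hc : ContinuousOn f (ball 0 δ)) (hd : ∀ z ∈ ball (0 : ℂ) δ, z.im ≠ 0 → DifferentiableAt ℂ f z) :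
    DifferentiableOn ℂ f (ball 0 δ) := by
  rw [← isConservativeOn_and_continuousOn_iff_isDifferentiableOn isOpen_ball]
  refine ⟨fun z w hzw => ?_, hc⟩
  rw [← add_eq_zero_iff_eq_neg, wedgeIntegral_add_wedgeIntegral_eq]
  have key : ∀ z w : ℂ, Rectangle z w ⊆ ball 0 δ →
      (0 : ℝ) ∉ Ioo (min z.im w.im) (max z.im w.im) →
      (∫ x : ℝ in z.re..w.re, f (x + z.im * I)) - (∫ x : ℝ in z.re..w.re, f (x + w.im * I)) +
      I • (∫ y : ℝ in z.im..w.im, f (re w + y * I)) -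
      I • (∫ y : ℝ in z.im..w.im, f (re z + y * I)) = 0 := by
    intro z w h h0
    refine integral_boundary_rect_eq_zero_of_continuousOn_of_differentiableOn f z w (hc.mono h) ?_
    intro u hu
    refine (hd u (h ⟨?_, ?_⟩) ?_).differentiableWithinAt
    · exact Ioo_subset_Icc_self hu.1
    · exact Ioo_subset_Icc_self hu.2
    · intro h1
      have := hu.2
      rw [mem_preimage, h1] at this
      exact h0 this
  by_cases h0 : (0 : ℝ) ∈ Ioo (min z.im w.im) (max z.im w.im)
  swap
  · exact key z w hzw h0
  have h0' : (0 : ℝ) ∈ uIcc z.im w.im := Ioo_subset_Icc_self h0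
  have hs1 : Rectangle z ⟨w.re, 0⟩ ⊆ ball 0 δ := fun u hu =>
    hzw ⟨hu.1, uIcc_subset_uIcc_left h0' hu.2⟩
  have hs2 : Rectangle ⟨z.re, 0⟩ w ⊆ ball 0 δ := fun u hu =>
    hzw ⟨hu.1, uIcc_subset_uIcc_right h0' hu.2⟩
  have k1 := key z ⟨w.re, 0⟩ hs1 (by
    rintro ⟨h1, h2⟩
    rcases le_total z.im 0 with h | h
    · simp [h] at h2
    · simp [h] at h1)
  have k2 := key ⟨z.re, 0⟩ w hs2 (by
    rintro ⟨h1, h2⟩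
    rcases le_total w.im 0 with h | h
    · simp [h] at h2
    · simp [h] at h1)
  have h_intg : ∀ x ∈ uIcc z.re w.re, ∀ a ∈ uIcc z.im w.im, ∀ b ∈ uIcc z.im w.im,
      IntervalIntegrable (fun y : ℝ => f (x + y * I)) MeasureTheory.volume a b := by
    intro x hx a ha b hb
    refine ContinuousOn.intervalIntegrable (hc.comp (by fun_prop) fun y hy => hzw ⟨?_, ?_⟩)
    · simpa using hx
    · simpa using uIcc_subset_uIcc ha hb hy
  have hsplit : ∀ x ∈ uIcc z.re w.re, (∫ y : ℝ in z.im..0, f (x + y * I)) +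
      (∫ y : ℝ in 0..w.im, f (x + y * I)) = ∫ y : ℝ in z.im..w.im, f (x + y * I) := fun x hx =>
    intervalIntegral.integral_add_adjacent_intervals (h_intg x hx _ left_mem_uIcc _ h0')
      (h_intg x hx _ h0' _ right_mem_uIcc)
  have e1 := hsplit w.re right_mem_uIcc
  have e2 := hsplit z.re left_mem_uIcc
  simp only [smul_eq_mul] at k1 k2 ⊢
  rw [← e1, ← e2]
  linear_combination k1 + k2

open Metric Filter Topology in
/-- Schwarz reflection for an injective function on a half disc. -/
theorem exists_reflection {f : ℂ → ℂ} {δ : ℝ} (hδ : 0 < δ)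
    (hc : ContinuousOn f (ball 0 δ ∩ {u | 0 ≤ u.im}))
    (hd : ∀ u ∈ ball (0 : ℂ) δ, 0 < u.im → DifferentiableAt ℂ f u)
    (hinj : InjOn f (ball 0 δ ∩ {u | 0 ≤ u.im}))
    (hreal : ∀ u ∈ ball (0 : ℂ) δ, u.im = 0 → (f u).im = 0)
    (hne : ∀ u ∈ ball (0 : ℂ) δ, 0 < u.im → (f u).im ≠ 0) :
    ∃ F : ℂ → ℂ, AnalyticAt ℂ F 0 ∧ deriv F 0 ≠ 0 ∧
      ∀ u ∈ ball (0 : ℂ) δ, 0 ≤ u.im → F u = f u := by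
  set c := starRingEnd ℂ with hcd
  have hcb : ∀ u ∈ ball (0 : ℂ) δ, c u ∈ ball (0 : ℂ) δ := fun u hu => by
    rw [mem_ball_zero_iff] at hu ⊢
    rwa [hcd, Complex.norm_conj]
  set F : ℂ → ℂ := fun u => if 0 ≤ u.im then f u else c (f (c u)) with hF
  have hF1 : ∀ u : ℂ, 0 ≤ u.im → F u = f u := fun u hu => if_pos hu
  have hF2 : ∀ u ∈ ball (0 : ℂ) δ, u.im ≤ 0 → F u = c (f (c u)) := by
    intro u hu h
    rcases h.lt_or_eq with h | h
    · exact if_neg (not_le.2 h)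
    · rw [hF1 u h.ge]
      have e : c u = u := Complex.conj_eq_iff_im.2 h
      rw [e, Complex.conj_eq_iff_im.2 (hreal u hu h)]
  have hFc : ContinuousOn F (ball 0 δ) := by
    have h1 : ContinuousOn F (ball 0 δ ∩ {u | 0 ≤ u.im}) := hc.congr fun u hu => hF1 u hu.2
    have h2 : ContinuousOn F (ball 0 δ ∩ {u | u.im ≤ 0}) := by
      refine ContinuousOn.congr (f := fun u => c (f (c u))) ?_ fun u hu => hF2 u hu.1 hu.2
      refine Complex.continuous_conj.comp_continuousOn (hc.comp Complex.continuous_conj.continuousOn ?_)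
      intro u hu
      refine ⟨hcb u hu.1, ?_⟩
      have := hu.2
      simp only [mem_ofPred_eq] at this
      simpa [hcd] using this
    have hcl1 : IsClosed {u : ℂ | 0 ≤ u.im} := isClosed_le continuous_const Complex.continuous_im
    have hcl2 : IsClosed {u : ℂ | u.im ≤ 0} := isClosed_le Complex.continuous_im continuous_const
    intro u hu
    have hun : ball (0 : ℂ) δ ⊆ (ball 0 δ ∩ {u | 0 ≤ u.im}) ∪ (ball 0 δ ∩ {u | u.im ≤ 0}) := by
      intro u hu
      rcases le_total 0 u.im with h | h
      · exact Or.inl ⟨hu, h⟩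
      · exact Or.inr ⟨hu, h⟩
    refine ContinuousWithinAt.mono (ContinuousWithinAt.union ?_ ?_) hun
    · by_cases h : 0 ≤ u.im
      · exact h1 u ⟨hu, h⟩
      · exact continuousWithinAt_of_notMem_closure fun h' =>
          h (closure_minimal inter_subset_right hcl1 h')
    · by_cases h : u.im ≤ 0
      · exact h2 u ⟨hu, h⟩
      · exact continuousWithinAt_of_notMem_closure fun h' =>
          h (closure_minimal inter_subset_right hcl2 h')
  have hFd : DifferentiableOn ℂ F (ball 0 δ) := by
    refine differentiableOn_ball_of_continuousOn_of_im_ne_zero hFc fun u hu h => ?_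
    rcases lt_or_gt_of_ne h with h | h
    · have h1 : DifferentiableAt ℂ (fun u => c (f (c u))) u := by
        have h2 : DifferentiableAt ℂ f (c u) := hd _ (hcb u hu) (by simpa [hcd] using h)
        have h3 := h2.star_star
        simpa [Function.comp_def, hcd] using h3
      refine h1.congr_of_eventuallyEq ?_
      filter_upwards [isOpen_ball.mem_nhds hu,
        (isOpen_lt Complex.continuous_im continuous_const).mem_nhds h] with v hv hv'
      exact hF2 v hv (le_of_lt hv')
    · refine (hd u hu h).congr_of_eventuallyEq ?_
      filter_upwards [(isOpen_lt continuous_const Complex.continuous_im).mem_nhds h] with v hv'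
      exact hF1 v (le_of_lt hv')
  have hsign : ∀ u ∈ ball (0 : ℂ) δ, ∀ v ∈ ball (0 : ℂ) δ, 0 < u.im → 0 < v.im →
      0 < (f u).im → 0 < (f v).im := by
    intro u hu v hv hui hvi h
    by_contra hcon
    have hpre : IsPreconnected (ball (0 : ℂ) δ ∩ {u | 0 < u.im}) :=
      ((convex_ball _ _).inter (convex_halfSpace_im_gt 0)).isPreconnected
    have hcont : ContinuousOn (fun u => (f u).im) (ball (0 : ℂ) δ ∩ {u | 0 < u.im}) :=
      Complex.continuous_im.comp_continuousOn (hc.mono fun u hu => ⟨hu.1, (show (0:ℝ) < u.im from hu.2).le⟩)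
    obtain ⟨w, hw, hw0⟩ := hpre.intermediate_value ⟨hv, hvi⟩ ⟨hu, hui⟩ hcont
      (show (0 : ℝ) ∈ Icc _ _ from ⟨not_lt.1 hcon, h.le⟩)
    exact hne w hw.1 hw.2 hw0
  have hzero : ∀ u ∈ ball (0 : ℂ) δ, (F u).im = 0 → u.im = 0 := by
    intro u hu h
    by_contra hcon
    rcases lt_or_gt_of_ne hcon with h1 | h1
    · rw [hF2 u hu h1.le] at h
      refine hne (c u) (hcb u hu) (by simpa [hcd] using h1) ?_
      simpa [hcd] using h
    · rw [hF1 u h1.le] at h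
      exact hne u hu h1 h
  have hFi : InjOn F (ball 0 δ) := by
    have hmix : ∀ u ∈ ball (0 : ℂ) δ, ∀ v ∈ ball (0 : ℂ) δ, 0 ≤ u.im → v.im < 0 → F u ≠ F v := by
      intro u hu v hv hui hvi he
      have hcv : 0 < (c v).im := by simpa [hcd] using hvi
      rcases hui.lt_or_eq with hui | hui
      · have h1 := hF1 u hui.le
        have h2 := hF2 v hv hvi.le
        rw [h1, h2] at he
        have him : (f u).im = - (f (c v)).im := by rw [he]; simp [hcd]
        rcases lt_or_gt_of_ne (hne u hu hui) with h | h
        · have := hsign (c v) (hcb v hv) u hu hcv hui (by linarith)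
          linarith
        · have := hsign u hu (c v) (hcb v hv) hui hcv h
          linarith
      · have h1 : (F u).im = 0 := by rw [hF1 u hui.le]; exact hreal u hu hui.symm
        exact hvi.ne (hzero v hv (he ▸ h1))
    intro u hu v hv he
    rcases le_or_gt 0 u.im with hui | hui <;> rcases le_or_gt 0 v.im with hvi | hvi
    · rw [hF1 u hui, hF1 v hvi] at he
      exact hinj ⟨hu, hui⟩ ⟨hv, hvi⟩ he
    · exact absurd he (hmix u hu v hv hui hvi)
    · exact absurd he.symm (hmix v hv u hu hvi hui)
    · rw [hF2 u hu hui.le, hF2 v hv hvi.le] at he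
      have h1 := hinj ⟨hcb u hu, by simpa [hcd] using hui.le⟩ ⟨hcb v hv, by simpa [hcd] using hvi.le⟩
        ((starRingEnd ℂ).injective he)
      exact (starRingEnd ℂ).injective h1
  have h0 : (0 : ℂ) ∈ ball (0 : ℂ) δ := mem_ball_self hδ
  exact ⟨F, hFd.analyticAt (isOpen_ball.mem_nhds h0), deriv_ne_zero_of_injOn isOpen_ball hFd hFi h0,
    fun u _ hu => hF1 u hu⟩

theorem norm_mul_cexp_I_mul {b : ℂ} (hb : ‖b‖ = 1) (u : ℂ) :
    ‖b * Complex.exp (Complex.I * u)‖ = Real.exp (-u.im) := by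
  rw [norm_mul, hb, one_mul, Complex.norm_exp]
  simp

open Metric Filter Topology in
/-- A map analytic in the disc, injective up to the boundary, with analytic regular boundary arc
near `b` extends analytically and regularly across `b`. -/
theorem exists_analytic_extension_of_boundary {ψ Φ η : ℂ → ℂ} {s₀ b : ℂ} (hs₀ : ‖s₀‖ = 1)
    (hb : ‖b‖ = 1) (hη : AnalyticAt ℂ η s₀) (hη' : deriv η s₀ ≠ 0)
    (hψc : ContinuousOn ψ (closedBall 0 1)) (hψd : DifferentiableOn ℂ ψ (ball 0 1))
    (hψi : InjOn ψ (closedBall 0 1)) (hΦc : ContinuousOn Φ (closedBall 0 1))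
    (hΦs : MapsTo Φ (sphere 0 1) (sphere 0 1)) (hΦb : Φ b = s₀)
    (heq : ∀ᶠ s in 𝓝 s₀, ∀ z : ℂ, ‖z‖ = 1 → Φ z = s → ψ z = η s)
    (hout : ∀ᶠ s in 𝓝 s₀, ‖s‖ = 1 → η s ∉ ψ '' ball 0 1) :
    ∃ Ψ : ℂ → ℂ, AnalyticAt ℂ Ψ b ∧ deriv Ψ b ≠ 0 ∧
      ∀ᶠ z in 𝓝 b, z ∈ closedBall (0 : ℂ) 1 → Ψ z = ψ z := by
  have hs₀0 : s₀ ≠ 0 := by rintro rfl; simp at hs₀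
  have hb0 : b ≠ 0 := by rintro rfl; simp at hb
  set H : Set ℂ := {u | 0 ≤ u.im} with hH
  have hψb : ψ b = η s₀ := heq.self_of_nhds b hb hΦb
  set q : ℂ → ℂ := fun u => s₀ * Complex.exp (Complex.I * u) with hq
  set p : ℂ → ℂ := fun u => b * Complex.exp (Complex.I * u) with hp
  have hq0 : q 0 = s₀ := by simp [hq]
  have hp0 : p 0 = b := by simp [hp]
  have hqd : HasDerivAt q (s₀ * Complex.I) 0 := by
    have h1 : HasDerivAt (fun u : ℂ => Complex.I * u) Complex.I 0 := by
      simpa using (hasDerivAt_id (0 : ℂ)).const_mul Complex.I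
    have := (h1.cexp).const_mul s₀
    simpa [hq] using this
  have hqa : AnalyticAt ℂ q 0 := by
    have : Differentiable ℂ q := by
      intro x; fun_prop
    exact this.analyticAt 0
  have hpdiff : Differentiable ℂ p := by intro x; fun_prop
  set e : ℂ → ℂ := fun u => η (q u) with he
  have hea : AnalyticAt ℂ e 0 := by
    have : AnalyticAt ℂ η (q 0) := by rwa [hq0]
    exact this.comp hqa
  have hed : deriv e 0 ≠ 0 := by
    have h1 : HasDerivAt η (deriv η s₀) (q 0) := by
      rw [hq0]; exact hη.differentiableAt.hasDerivAt
    have h2 : HasDerivAt e (deriv η s₀ * (s₀ * Complex.I)) 0 := h1.comp 0 hqd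
    rw [h2.deriv]
    exact mul_ne_zero hη' (mul_ne_zero hs₀0 Complex.I_ne_zero)
  obtain ⟨L, hLa, -, hL0, hLe, heL⟩ := exists_analytic_leftInverse hea hed
  have he0 : e 0 = ψ b := by simp only [he]; rw [hq0, hψb]
  rw [he0] at hLa hL0 heL
  set f : ℂ → ℂ := fun u => L (ψ (p u)) with hf
  have hpn : ∀ u, ‖p u‖ = Real.exp (-u.im) := norm_mul_cexp_I_mul hb
  have hpH : MapsTo p H (closedBall 0 1) := by
    intro u hu
    have hu' : 0 ≤ u.im := hu
    rw [mem_closedBall_zero_iff, hpn]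
    simpa using hu'
  have hpcont : ContinuousAt p 0 := hpdiff.continuous.continuousAt
  have hptend : Tendsto p (𝓝[H] 0) (𝓝[closedBall 0 1] b) := by
    have := hpcont.continuousWithinAt.tendsto_nhdsWithin hpH
    rwa [hp0] at this
  have hbB : b ∈ closedBall (0 : ℂ) 1 := by simp [hb]
  have hψp : Tendsto (fun u => ψ (p u)) (𝓝[H] 0) (𝓝 (ψ b)) :=
    (hψc b hbB).tendsto.comp hptend
  have hΦp : Tendsto (fun u => Φ (p u)) (𝓝[H] 0) (𝓝 s₀) := by
    have := (hΦc b hbB).tendsto.comp hptend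
    rwa [hΦb] at this
  have e1 := hψp.eventually hLa.eventually_analyticAt
  have e2 := hψp.eventually heL
  have e3 : ∀ᶠ u in 𝓝[H] 0, ‖q (L (ψ (p u)))‖ = 1 → η (q (L (ψ (p u)))) ∉ ψ '' ball 0 1 := by
    have : Tendsto (fun u => q (L (ψ (p u)))) (𝓝[H] 0) (𝓝 s₀) := by
      have h1 : Tendsto L (𝓝 (ψ b)) (𝓝 0) := by simpa only [hL0] using hLa.continuousAt.tendsto
      have h2 : Tendsto q (𝓝 0) (𝓝 s₀) := by simpa only [hq0] using hqa.continuousAt.tendsto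
      exact h2.comp (h1.comp hψp)
    exact this.eventually hout
  have e4 : ∀ᶠ u in 𝓝[H] 0, u.im = 0 → (f u).im = 0 := by
    have hlog : ContinuousAt (fun s : ℂ => ((Complex.arg (s / s₀) : ℝ) : ℂ)) s₀ := by
      have : ContinuousAt Complex.arg (s₀ / s₀) := by
        rw [div_self hs₀0]
        exact Complex.continuousAt_arg (by simp)
      exact Complex.continuous_ofReal.continuousAt.comp
        (ContinuousAt.comp (f := fun s : ℂ => s / s₀) this (continuousAt_id.div_const s₀))
    have h1 : ∀ᶠ s in 𝓝 s₀, L (e ((Complex.arg (s / s₀) : ℝ) : ℂ)) =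
        ((Complex.arg (s / s₀) : ℝ) : ℂ) := by
      have : Tendsto (fun s : ℂ => ((Complex.arg (s / s₀) : ℝ) : ℂ)) (𝓝 s₀) (𝓝 0) := by
        have := hlog.tendsto
        simpa [div_self hs₀0] using this
      exact this.eventually hLe
    filter_upwards [hΦp.eventually h1, hΦp.eventually heq] with u hu1 hu2 hui
    have hpu : ‖p u‖ = 1 := by rw [hpn, hui]; simp
    have hs : ‖Φ (p u)‖ = 1 := by
      have := hΦs (show p u ∈ sphere (0 : ℂ) 1 by simpa using hpu)
      simpa using this
    have hqs : q ((Complex.arg (Φ (p u) / s₀) : ℝ) : ℂ) = Φ (p u) := by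
      have := Complex.norm_mul_exp_arg_mul_I (Φ (p u) / s₀)
      rw [norm_div, hs, hs₀, div_one, Complex.ofReal_one, one_mul] at this
      simp only [hq]
      rw [mul_comm Complex.I, this, mul_div_cancel₀ _ hs₀0]
    have : f u = ((Complex.arg (Φ (p u) / s₀) : ℝ) : ℂ) := by
      rw [← hu1]
      simp only [hf, he]
      rw [hqs, hu2 (p u) hpu rfl]
    rw [this, Complex.ofReal_im]
  obtain ⟨δ', hδ', hball⟩ := Metric.mem_nhdsWithin_iff.1
    (e1.and (e2.and (e3.and e4)))
  set δ := min δ' 1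
  have hδ : 0 < δ := lt_min hδ' one_pos
  have hsub : ∀ u ∈ ball (0 : ℂ) δ, 0 ≤ u.im → AnalyticAt ℂ L (ψ (p u)) ∧
      e (L (ψ (p u))) = ψ (p u) ∧
      (‖q (L (ψ (p u)))‖ = 1 → η (q (L (ψ (p u)))) ∉ ψ '' ball 0 1) ∧
      (u.im = 0 → (f u).im = 0) := fun u hu hui =>
    hball ⟨ball_subset_ball (min_le_left _ _) hu, hui⟩
  have hpin : ∀ u : ℂ, 0 < u.im → p u ∈ ball (0 : ℂ) 1 := by
    intro u hu
    rw [mem_ball_zero_iff, hpn]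
    simpa using hu
  obtain ⟨F, hFa, hFd, hFf⟩ := exists_reflection (f := f) hδ
    (fun u hu => by
      have h1 : ContinuousWithinAt (fun u => ψ (p u)) (ball 0 δ ∩ {u | 0 ≤ u.im}) u :=
        (hψc (p u) (hpH hu.2)).comp hpdiff.continuous.continuousWithinAt fun v hv => hpH hv.2
      exact ContinuousAt.comp_continuousWithinAt (g := L) (f := fun u => ψ (p u))
        (hsub u hu.1 hu.2).1.continuousAt h1)
    (fun u hu hui => by
      have h1 : DifferentiableAt ℂ ψ (p u) :=
        (hψd _ (hpin u hui)).differentiableAt (isOpen_ball.mem_nhds (hpin u hui))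
      have h2 : DifferentiableAt ℂ (fun u => ψ (p u)) u := h1.comp u hpdiff.differentiableAt
      exact DifferentiableAt.comp u (hsub u hu hui.le).1.differentiableAt h2)
    (fun u hu v hv huv => by
      have h1 : ψ (p u) = ψ (p v) := by
        rw [← (hsub u hu.1 hu.2).2.1, ← (hsub v hv.1 hv.2).2.1]
        exact congrArg e huv
      have h2 : p u = p v := hψi (hpH hu.2) (hpH hv.2) h1
      have h3 := mul_left_cancel₀ hb0 h2
      obtain ⟨k, hk⟩ := Complex.exp_eq_exp_iff_exists_int.1 h3
      have h4 : u - v = k * (2 * Real.pi) := by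
        have : Complex.I * (u - v - k * (2 * Real.pi)) = 0 := by linear_combination hk
        rcases mul_eq_zero.1 this with h | h
        · exact absurd h Complex.I_ne_zero
        · linear_combination h
      have h5 : ‖u - v‖ < 2 := by
        have hu1 := mem_ball_zero_iff.1 hu.1
        have hv1 := mem_ball_zero_iff.1 hv.1
        have := norm_sub_le u v
        have := min_le_right δ' 1
        linarith
      have hk0 : k = 0 := by
        by_contra hk0
        have h6 : (1 : ℝ) ≤ |(k : ℝ)| := by
          exact_mod_cast Int.one_le_abs hk0
        have h7 : ‖u - v‖ = |(k : ℝ)| * (2 * Real.pi) := by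
          rw [h4, norm_mul, norm_mul]
          simp [abs_of_pos Real.pi_pos]
        have := Real.pi_gt_three
        nlinarith
      rw [hk0] at h4
      simpa [sub_eq_zero] using h4)
    (fun u hu hui => (hsub u hu hui.ge).2.2.2 hui)
    (fun u hu hui h0 => by
      obtain ⟨-, h2, h3, -⟩ := hsub u hu hui.le
      refine h3 ?_ ⟨p u, hpin u hui, h2.symm⟩
      rw [hq, norm_mul_cexp_I_mul hs₀]
      have : (L (ψ (p u))).im = 0 := h0
      rw [this]; simp)
  have hF0 : F 0 = 0 := by
    rw [hFf 0 (mem_ball_self hδ) (by simp)]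
    simp only [hf]
    rw [hp0, hL0]
  set ℓ : ℂ → ℂ := fun z => -Complex.I * Complex.log (z / b) with hℓ
  have hℓb : ℓ b = 0 := by simp [hℓ, div_self hb0]
  have hℓa : AnalyticAt ℂ ℓ b := by
    have : AnalyticAt ℂ (fun z : ℂ => z / b) b := analyticAt_id.div_const
    exact analyticAt_const.mul (this.clog (by simp [div_self hb0]))
  have hℓd : HasDerivAt ℓ (-Complex.I * (1 / b)) b := by
    have h1 : HasDerivAt (fun z : ℂ => z / b) (1 / b) b := (hasDerivAt_id b).div_const b
    have := (h1.clog (by simp [div_self hb0])).const_mul (-Complex.I)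
    simpa [hℓ, div_self hb0] using this
  have hFa' : AnalyticAt ℂ F (ℓ b) := by rwa [hℓb]
  have hea' : AnalyticAt ℂ e (F (ℓ b)) := by rwa [hℓb, hF0]
  refine ⟨fun z => e (F (ℓ z)), ?_, ?_, ?_⟩
  · have h1 : AnalyticAt ℂ (fun z => F (ℓ z)) b := hFa'.comp hℓa
    exact AnalyticAt.comp (g := e) (f := fun z => F (ℓ z)) hea' h1
  · have h1 : HasDerivAt (fun z => F (ℓ z)) (deriv F (ℓ b) * (-Complex.I * (1 / b))) b :=
      hFa'.differentiableAt.hasDerivAt.comp b hℓd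
    have h2 : HasDerivAt (fun z => e (F (ℓ z)))
        (deriv e (F (ℓ b)) * (deriv F (ℓ b) * (-Complex.I * (1 / b)))) b :=
      HasDerivAt.comp (h₂ := e) (h := fun z => F (ℓ z)) b
        hea'.differentiableAt.hasDerivAt h1
    rw [h2.deriv, hℓb, hF0]
    exact mul_ne_zero hed (mul_ne_zero hFd
      (mul_ne_zero (neg_ne_zero.2 Complex.I_ne_zero) (one_div_ne_zero hb0)))
  · have hℓt : Tendsto ℓ (𝓝 b) (𝓝 0) := by simpa only [hℓb] using hℓa.continuousAt.tendsto
    filter_upwards [hℓt.eventually (ball_mem_nhds 0 hδ),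
      isOpen_ne.mem_nhds (show b ≠ 0 from hb0)] with z hz hz0 hzB
    have hz0' : z ≠ 0 := hz0
    have hpz : p (ℓ z) = z := by
      simp only [hp, hℓ]
      rw [← mul_assoc, mul_neg, Complex.I_mul_I, neg_neg, one_mul,
        Complex.exp_log (div_ne_zero hz0' hb0), mul_div_cancel₀ _ hb0]
    have him : 0 ≤ (ℓ z).im := by
      have := hpn (ℓ z)
      rw [hpz] at this
      have h1 : ‖z‖ ≤ 1 := by simpa using hzB
      rw [this, Real.exp_le_one_iff] at h1
      linarith
    change e (F (ℓ z)) = ψ z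
    rw [hFf _ hz him]
    have := (hsub _ hz him).2.1
    rw [hpz] at this
    simp only [hf]
    rw [hpz, this]

theorem cexp_I_mul_ofReal_eq_iff {x y : ℝ} :
    Complex.exp (Complex.I * x) = Complex.exp (Complex.I * y) ↔
      ∃ m : ℤ, x = y + m * (2 * Real.pi) := by
  rw [Complex.exp_eq_exp_iff_exists_int]
  constructor
  · rintro ⟨m, hm⟩
    refine ⟨m, ?_⟩
    have : Complex.I * (x - (y + m * (2 * Real.pi))) = 0 := by linear_combination hm
    rcases mul_eq_zero.1 this with h | h
    · exact absurd h Complex.I_ne_zero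
    · exact_mod_cast sub_eq_zero.1 h
  · rintro ⟨m, hm⟩
    refine ⟨m, ?_⟩
    rw [hm]; push_cast; ring

theorem norm_cexp_I_mul_ofReal (x : ℝ) : ‖Complex.exp (Complex.I * x)‖ = 1 := by
  rw [mul_comm]; exact Complex.norm_exp_ofReal_mul_I x

/-- A continuous map from the line to the unit circle has a continuous argument. -/
theorem exists_continuous_arg {g : ℝ → ℂ} (hg : Continuous g) (hn : ∀ t, ‖g t‖ = 1) :
    ∃ β : ℝ → ℝ, Continuous β ∧ ∀ t, g t = Complex.exp (Complex.I * β t) := by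
  have hs : IsSimplyConnected (univ : Set ℝ) := by
    have : ContractibleSpace (univ : Set ℝ) := convex_univ.contractibleSpace univ_nonempty
    exact (inferInstance : SimplyConnectedSpace (univ : Set ℝ))
  obtain ⟨L, hL, h⟩ := Complex.exists_continuousOn_eqOn_exp_comp hs isOpen_univ hg.continuousOn
    (by rintro ⟨t, -, ht⟩; have := hn t; rw [ht] at this; simp at this)
  refine ⟨fun t => (L t).im, Complex.continuous_im.comp (continuousOn_univ.1 hL), fun t => ?_⟩
  have h1 : Complex.exp (L t) = g t := h (mem_univ t)
  have h2 : (L t).re = 0 := by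
    have := hn t
    rw [← h1, Complex.norm_exp] at this
    simpa using this
  rw [← h1]
  congr 1
  apply Complex.ext <;> simp [h2]

/-- The argument of a homeomorphism of the circle. -/
theorem exists_strictMono_arg {G : ℂ → ℂ} (hc : ContinuousOn G (Metric.sphere 0 1))
    (hm : MapsTo G (Metric.sphere 0 1) (Metric.sphere 0 1))
    (hi : InjOn G (Metric.sphere 0 1)) :
    ∃ β : ℝ → ℝ, Continuous β ∧
      (∀ t : ℝ, G (Complex.exp (Complex.I * t)) = Complex.exp (Complex.I * β t)) ∧
      ((StrictMono β ∧ ∀ t, β (t + 2 * Real.pi) = β t + 2 * Real.pi) ∨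
       (StrictAnti β ∧ ∀ t, β (t + 2 * Real.pi) = β t - 2 * Real.pi)) := by
  have hmem : ∀ t : ℝ, Complex.exp (Complex.I * t) ∈ Metric.sphere (0 : ℂ) 1 := fun t => by
    simpa using norm_cexp_I_mul_ofReal t
  have hgc : Continuous fun t : ℝ => G (Complex.exp (Complex.I * t)) :=
    hc.comp_continuous (by fun_prop) hmem
  obtain ⟨β, hβ, hβe⟩ := exists_continuous_arg hgc fun t => by simpa using hm (hmem t)
  have hpi := Real.pi_pos
  have key : ∀ x y : ℝ, (∃ m : ℤ, β x = β y + m * (2 * Real.pi)) →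
      ∃ m : ℤ, x = y + m * (2 * Real.pi) := by
    intro x y h
    rw [← cexp_I_mul_ofReal_eq_iff] at h ⊢
    rw [← hβe, ← hβe] at h
    exact hi (hmem x) (hmem y) h
  have hper0 : ∀ t, ∃ k : ℤ, β (t + 2 * Real.pi) = β t + k * (2 * Real.pi) := by
    intro t
    rw [← cexp_I_mul_ofReal_eq_iff, ← hβe, ← hβe]
    congr 1
    rw [cexp_I_mul_ofReal_eq_iff]
    exact ⟨1, by simp⟩
  obtain ⟨k, hk⟩ : ∃ k : ℤ, ∀ t, β (t + 2 * Real.pi) = β t + k * (2 * Real.pi) := by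
    choose k hk using hper0
    have hcont : Continuous fun t => ((k t : ℤ) : ℝ) := by
      have : (fun t => ((k t : ℤ) : ℝ)) =
          fun t => (β (t + 2 * Real.pi) - β t) / (2 * Real.pi) := by
        funext t; rw [hk t]; field_simp; ring
      rw [this]; fun_prop
    have hkc : Continuous k := Int.isClosedEmbedding_coe_real.isInducing.continuous_iff.2 hcont
    exact ⟨k 0, fun t => by rw [hk t, PreconnectedSpace.constant inferInstance hkc (y := 0)]⟩
  have hk' : ∀ (m : ℕ) (t : ℝ), β (t + m * (2 * Real.pi)) = β t + m * (k * (2 * Real.pi)) := by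
    intro m
    induction m with
    | zero => intro t; simp
    | succ m ih =>
      intro t
      have : t + ((m + 1 : ℕ) : ℝ) * (2 * Real.pi) = (t + m * (2 * Real.pi)) + 2 * Real.pi := by
        push_cast; ring
      rw [this, hk, ih]; push_cast; ring
  have hk0 : k ≠ 0 := by
    rintro rfl
    set φ : ℝ → ℝ := fun t => β (t + Real.pi) - β t with hφ
    have hφc : Continuous φ := by fun_prop
    have h1 : φ Real.pi = -φ 0 := by
      have := hk 0
      simp only [Int.cast_zero, zero_mul, add_zero, zero_add] at this
      simp only [hφ]
      rw [← two_mul, this, zero_add]; ring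
    obtain ⟨t, ht⟩ : ∃ t, φ t = 0 := by
      have hz : (0 : ℝ) ∈ uIcc (φ 0) (φ Real.pi) := by
        rw [h1, mem_uIcc]
        rcases le_total 0 (φ 0) with h | h
        · right; constructor <;> linarith
        · left; constructor <;> linarith
      obtain ⟨t, -, ht⟩ := intermediate_value_uIcc hφc.continuousOn hz
      exact ⟨t, ht⟩
    obtain ⟨m, hm⟩ := key (t + Real.pi) t ⟨0, by simp only [hφ] at ht; push_cast; linarith⟩
    have h2 : (m : ℝ) * 2 = 1 := by
      have : Real.pi * (m * 2 - 1) = 0 := by linear_combination -hm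
      rcases mul_eq_zero.1 this with h | h
      · exact absurd h hpi.ne'
      · linarith
    have h3 : m * 2 = 1 := by exact_mod_cast h2
    omega
  have hinj : Function.Injective β := by
    have aux : ∀ x y, β x = β y → y ≤ x → x = y := by
      intro x y hxy hle
      obtain ⟨m, hm⟩ := key x y ⟨0, by simpa using hxy⟩
      have hm0 : 0 ≤ m := by
        by_contra h
        have : (m : ℝ) ≤ -1 := by exact_mod_cast (by omega : m ≤ -1)
        nlinarith
      obtain ⟨l, rfl⟩ := Int.eq_ofNat_of_zero_le hm0
      have h1 := hk' l y
      rw [hm] at hxy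
      have h2 : β (y + ↑(l : ℤ) * (2 * Real.pi)) = β y + l * (k * (2 * Real.pi)) := by
        rw [← h1]; simp
      rw [h2] at hxy
      have h3 : (l : ℝ) * (k * (2 * Real.pi)) = 0 := by linarith
      have hk0' : (k : ℝ) ≠ 0 := by exact_mod_cast hk0
      have h4 : (l : ℝ) = 0 := by
        rcases mul_eq_zero.1 h3 with h | h
        · exact h
        · exact absurd h (by positivity)
      rw [hm]; simp [h4]
    intro x y hxy
    rcases le_total y x with h | h
    · exact aux x y hxy h
    · exact (aux y x hxy.symm h).symm
  have habs : ∀ σ : ℝ, (σ = 1 ∨ σ = -1) → (∀ x y, x < y → σ * β x < σ * β y) →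
      (k : ℝ) = σ := by
    intro σ hσ hmono
    have hσ2 : σ * σ = 1 := by rcases hσ with rfl | rfl <;> norm_num
    have h1 := hmono 0 (2 * Real.pi) (by positivity)
    have h2 := hk 0
    rw [zero_add] at h2
    rw [h2] at h1
    have h3 : 0 < σ * k := by
      by_contra h
      nlinarith [mul_nonneg (sub_nonneg.2 (not_lt.1 h)) hpi.le]
    obtain ⟨τ, hτ⟩ : ∃ τ : ℤ, (τ : ℝ) = σ := by
      rcases hσ with rfl | rfl
      · exact ⟨1, by simp⟩
      · exact ⟨-1, by simp⟩
    have h4 : 0 < τ * k := by rw [← hτ] at h3; exact_mod_cast h3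
    by_contra hne
    have h5 : τ * k ≠ 1 := by
      intro h
      apply hne
      have : σ * k = 1 := by rw [← hτ]; exact_mod_cast h
      linear_combination σ * this - (k : ℝ) * hσ2
    have h6 : (2 : ℝ) ≤ σ * k := by
      rw [← hτ]; exact_mod_cast (by omega : 2 ≤ τ * k)
    obtain ⟨t, ht, hβt⟩ := intermediate_value_Icc (f := fun t => σ * β t)
      (show (0 : ℝ) ≤ 2 * Real.pi by positivity)
      (by fun_prop) (show σ * β 0 + 2 * Real.pi ∈ Icc _ _ by
        constructor
        · linarith
        · rw [h2]; nlinarith)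
    have hβt' : σ * β t = σ * β 0 + 2 * Real.pi := hβt
    obtain ⟨m, hm⟩ := key t 0 ⟨τ, by
      rw [hτ]; linear_combination σ * hβt' - (β t - β 0) * hσ2⟩
    rw [zero_add] at hm
    have hm1 : 0 < m ∨ m ≤ 0 := lt_or_ge _ _
    rcases hm1 with h | h
    · have h7 : (1 : ℝ) ≤ m := by exact_mod_cast h
      have h8 : t = 2 * Real.pi := le_antisymm ht.2 (by rw [hm]; nlinarith)
      rw [h8, h2] at hβt'
      have : Real.pi * (σ * k - 1) = 0 := by linear_combination hβt' / 2
      rcases mul_eq_zero.1 this with h | h <;> linarith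
    · have h7 : (m : ℝ) ≤ 0 := by exact_mod_cast h
      have h8 : t = 0 := le_antisymm (by rw [hm]; nlinarith) ht.1
      rw [h8] at hβt'
      linarith
  refine ⟨β, hβ, hβe, ?_⟩
  rcases hβ.strictMono_of_inj hinj with h | h
  · left
    refine ⟨h, fun t => ?_⟩
    rw [hk, habs 1 (Or.inl rfl) fun x y hxy => by simpa using h hxy, one_mul]
  · right
    refine ⟨h, fun t => ?_⟩
    rw [hk, habs (-1) (Or.inr rfl) fun x y hxy => by simpa using h hxy]; ring

open Topology in
/-- Smooth cutoff functions in the plane. -/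
theorem exists_contDiff_cutoff {K W : Set ℂ} (hK : IsClosed K) (hW : IsOpen W) (hKW : K ⊆ W) :
    ∃ X : ℂ → ℝ, (∀ n : ℕ∞, ContDiff ℝ n X) ∧ (∀ᶠ x in 𝓝ˢ K, X x = 1) ∧
      (∀ᶠ x in 𝓝ˢ Wᶜ, X x = 0) ∧ ∀ x, X x ∈ Icc (0 : ℝ) 1 := by
  obtain ⟨X, h0, h1, h⟩ := exists_contMDiffMap_zero_one_nhds_of_isClosed
    (modelWithCornersSelf ℝ ℂ) (n := (⊤ : ℕ∞)) hW.isClosed_compl hK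
    (disjoint_compl_left_iff_subset.2 hKW)
  refine ⟨X, fun n => ?_, h1, h0, h⟩
  exact (contMDiff_iff_contDiff.1 X.contMDiff).of_le (by exact_mod_cast le_top)

open MeasureTheory Metric ContinuousLinearMap Convolution in
/-- Mollification of a monotone quasi-periodic function. -/
theorem exists_monotone_contDiff_approx {f : ℝ → ℝ} (hf : Continuous f) (hm : Monotone f)
    {p c : ℝ} (hp : ∀ t, f (t + p) = f t + c) {δ : ℝ} (hδ : 0 < δ) :
    ∃ b : ℝ → ℝ, (∀ n : ℕ∞, ContDiff ℝ n b) ∧ Monotone b ∧ (∀ t, b (t + p) = b t + c) ∧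
      ∀ a ε, (∀ x ∈ ball a δ, dist (f x) (f a) ≤ ε) → dist (b a) (f a) ≤ ε := by
  let φ : ContDiffBump (0 : ℝ) := ⟨δ / 2, δ, by positivity, by linarith⟩
  have h_intg : ∀ x, Integrable (fun t => φ.normed volume t * f (x - t)) volume := by
    intro x
    refine Continuous.integrable_of_hasCompactSupport ?_ ?_
    · exact φ.continuous_normed.mul (by fun_prop)
    · exact (φ.hasCompactSupport_normed (μ := volume)).mul_right
  refine ⟨fun x => ∫ t, φ.normed volume t * f (x - t), fun n => ?_, ?_, ?_, ?_⟩
  · have := (φ.hasCompactSupport_normed (μ := volume)).contDiff_convolution_left (μ := volume)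
      (lsmul ℝ ℝ)
      (φ.contDiff_normed (n := n)) hf.locallyIntegrable
    exact this
  · intro x y hxy
    exact integral_mono (h_intg x) (h_intg y) fun t =>
      mul_le_mul_of_nonneg_left (hm (by linarith)) (φ.nonneg_normed t)
  · intro x
    have h1 : ∀ t, φ.normed volume t * f (x + p - t) =
        φ.normed volume t * f (x - t) + φ.normed volume t * c := by
      intro t
      rw [show x + p - t = (x - t) + p by ring, hp]; ring
    simp_rw [h1]
    rw [integral_add (h_intg x) ((φ.integrable_normed (μ := volume)).mul_const c), integral_mul_const,
      φ.integral_normed, one_mul]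
  · intro a ε h
    exact φ.dist_normed_convolution_le hf.aestronglyMeasurable h

open Topology in
/-- The primitive of the smooth part of the derivative of a monotone function. -/
theorem exists_monotone_contDiff_part {n : ℕ∞} {β : ℝ → ℝ}
    (hm : Monotone β) (hp : ∀ t, β (t + 2 * Real.pi) = β t + 2 * Real.pi)
    {χ : ℝ → ℝ} (hχ : ∀ n : ℕ∞, ContDiff ℝ n χ) (hχp : ∀ t, χ (t + 2 * Real.pi) = χ t)
    (hχI : ∀ t, χ t ∈ Icc (0 : ℝ) 1) (hn : 1 ≤ n)
    (hχβ : ∀ t, (∀ᶠ u in 𝓝 t, χ u = 0) ∨ ContDiffAt ℝ n β t) :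
    ∃ b : ℝ → ℝ, ∃ c : ℝ, ContDiff ℝ n b ∧ Monotone b ∧ Monotone (fun t => β t - b t) ∧
      (∀ t, b (t + 2 * Real.pi) = b t + c) ∧
      ∀ x y, x ≤ y → (∀ t ∈ Icc x y, χ t = 1) → β y - b y = β x - b x := by
  set γ : ℝ → ℝ := fun t => χ t * deriv β t with hγ
  have hγk : ∀ k : ℕ, ((k + 1 : ℕ) : ℕ∞) ≤ n → ContDiff ℝ k γ := by
    intro k hk
    rw [contDiff_iff_contDiffAt]
    intro t
    rcases hχβ t with h | h
    · refine contDiffAt_const (c := (0 : ℝ)) |>.congr_of_eventuallyEq ?_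
      filter_upwards [h] with u hu
      simp [hγ, hu]
    · have h1 : ContDiffAt ℝ k (deriv β) t := h.derivWithin (by exact_mod_cast hk)
      exact (hχ k).contDiffAt.mul h1
  have hγc : Continuous γ := (hγk 0 (by simpa using hn)).continuous
  have hd0 : ∀ t, 0 ≤ deriv β t := fun t => hm.deriv_nonneg
  have hγ0 : ∀ t, 0 ≤ γ t := fun t => mul_nonneg (hχI t).1 (hd0 t)
  set b : ℝ → ℝ := fun t => ∫ u in (0 : ℝ)..t, γ u with hb
  have hbd : ∀ t, HasDerivAt b (γ t) t := fun t =>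
    intervalIntegral.integral_hasDerivAt_right (hγc.intervalIntegrable _ _)
      (hγc.stronglyMeasurableAtFilter _ _) hγc.continuousAt
  have hbdiff : ∀ x y, b y - b x = ∫ u in x..y, γ u := fun x y => by
    simp only [hb]
    rw [intervalIntegral.integral_interval_sub_left] <;> exact hγc.intervalIntegrable _ _
  have hderiv : deriv b = γ := funext fun t => (hbd t).deriv
  have hdp : ∀ t, deriv β (t + 2 * Real.pi) = deriv β t := by
    intro t
    rw [← deriv_comp_add_const]
    have : (fun x => β (x + 2 * Real.pi)) = fun x => β x + 2 * Real.pi := funext hp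
    rw [this]; simp
  have hγp : Function.Periodic γ (2 * Real.pi) := fun t => by
    simp only [hγ]
    rw [hdp, hχp]
  refine ⟨b, ∫ u in (0 : ℝ)..(2 * Real.pi), γ u, ?_, ?_, ?_, ?_, ?_⟩
  · rw [contDiff_iff_forall_nat_le]
    intro m hmn
    cases m with
    | zero => exact contDiff_zero.2 (continuous_iff_continuousAt.2 fun t => (hbd t).continuousAt)
    | succ k =>
      have : ContDiff ℝ (((k : ℕ) : WithTop ℕ∞) + 1) b := by
        rw [contDiff_succ_iff_deriv]
        refine ⟨fun t => (hbd t).differentiableAt, fun h => absurd h (by simp), ?_⟩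
        rw [hderiv]
        exact hγk k hmn
      exact_mod_cast this
  · exact monotone_of_deriv_nonneg (fun t => (hbd t).differentiableAt) fun t => by
      rw [(hbd t).deriv]; exact hγ0 t
  · intro x y hxy
    have h1 := (hm.monotoneOn (uIcc x y)).intervalIntegral_deriv_mem_uIcc
    have h2 := (hm.monotoneOn (uIcc x y)).intervalIntegrable_deriv
    rw [uIcc_of_le (sub_nonneg.2 (hm hxy))] at h1
    have h3 : ∫ u in x..y, γ u ≤ ∫ u in x..y, deriv β u :=
      intervalIntegral.integral_mono_on hxy (hγc.intervalIntegrable _ _) h2 fun u _ =>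
        mul_le_of_le_one_left (hd0 u) (hχI u).2
    have h4 := hbdiff x y
    have := h1.2
    change β x - b x ≤ β y - b y
    linarith
  · intro t
    have := hbdiff t (t + 2 * Real.pi)
    rw [hγp.intervalIntegral_add_eq t 0, zero_add] at this
    linarith
  · intro x y hxy h1
    have hβd : ∀ t ∈ uIcc x y, HasDerivAt β (γ t) t := by
      intro t ht
      rw [uIcc_of_le hxy] at ht
      have h2 := h1 t ht
      rcases hχβ t with h | h
      · have := h.self_of_nhds
        rw [h2] at this; norm_num at this
      · have hne : (n : WithTop ℕ∞) ≠ 0 := by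
          intro h0
          have : n = 0 := by exact_mod_cast h0
          rw [this] at hn; exact absurd hn (by simp)
        have := (h.differentiableAt hne).hasDerivAt
        simpa [hγ, h2] using this
    have h5 := intervalIntegral.integral_eq_sub_of_hasDerivAt hβd (hγc.intervalIntegrable _ _)
    have := hbdiff x y
    linarith

open Metric in
theorem exists_uniform_of_quasiPeriodic {f : ℝ → ℝ} (hf : Continuous f) {p c : ℝ} (hp0 : 0 < p)
    (hp : ∀ t, f (t + p) = f t + c) {ε : ℝ} (hε : 0 < ε) :
    ∃ δ > 0, ∀ x y, dist x y < δ → dist (f x) (f y) < ε := by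
  have hper : Function.Periodic (fun t => f t - c / p * t) p := fun t => by
    simp only [hp]; field_simp; ring
  obtain ⟨δ, hδ, h⟩ := Metric.uniformContinuousOn_iff.1
    ((isCompact_Icc (a := -p) (b := 2 * p)).uniformContinuousOn_of_continuous
      (f := fun t => f t - c / p * t) (by fun_prop)) (ε / 2) (by positivity)
  have hK : 0 < |c / p| + 1 := by positivity
  refine ⟨min (min δ p) (ε / 2 / (|c / p| + 1)), by positivity, fun x y hxy => ?_⟩
  have h1 : dist x y < δ := hxy.trans_le ((min_le_left _ _).trans (min_le_left _ _))
  have h2 : dist x y < p := hxy.trans_le ((min_le_left _ _).trans (min_le_right _ _))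
  have h3 : dist x y < ε / 2 / (|c / p| + 1) := hxy.trans_le (min_le_right _ _)
  set m := ⌊x / p⌋
  have hm1 : (m : ℝ) * p ≤ x := (le_div_iff₀ hp0).1 (Int.floor_le _)
  have hm2 : x < (m + 1 : ℝ) * p := (div_lt_iff₀ hp0).1 (Int.lt_floor_add_one _)
  rw [Real.dist_eq, abs_lt] at h2
  have key := h (x - m * p) ⟨by nlinarith, by nlinarith⟩ (y - m * p)
    ⟨by nlinarith, by nlinarith⟩ (by simpa using h1)
  rw [hper.sub_int_mul_eq m, hper.sub_int_mul_eq m] at key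
  rw [Real.dist_eq] at key h3 ⊢
  have h4 : f x - f y = (f x - c / p * x - (f y - c / p * y)) + c / p * (x - y) := by ring
  have h5 : |c / p * (x - y)| ≤ ε / 2 := by
    rw [abs_mul]
    rw [lt_div_iff₀ hK] at h3
    nlinarith [abs_nonneg (x - y), abs_nonneg (c / p)]
  rw [h4]
  exact (abs_add_le _ _).trans_lt (by linarith)

theorem norm_cexp_I_mul_sub_le (x y : ℝ) :
    ‖Complex.exp (Complex.I * x) - Complex.exp (Complex.I * y)‖ ≤ |x - y| := by
  have h1 : Complex.exp (Complex.I * x) - Complex.exp (Complex.I * y) =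
      Complex.exp (Complex.I * y) * (Complex.exp (Complex.I * ((x - y : ℝ) : ℂ)) - 1) := by
    rw [mul_sub, ← Complex.exp_add, mul_one]
    congr 2
    push_cast; ring
  rw [h1, norm_mul, norm_cexp_I_mul_ofReal, one_mul]
  exact Real.norm_exp_I_mul_ofReal_sub_one_le

theorem cexp_I_mul_add_two_pi (t : ℝ) :
    Complex.exp (Complex.I * ((t + 2 * Real.pi : ℝ) : ℂ)) = Complex.exp (Complex.I * t) :=
  cexp_I_mul_ofReal_eq_iff.2 ⟨1, by simp⟩

open Metric Topology in
/-- A monotone circle map which is smooth near `S` is a uniform limit of smooth monotone circle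
maps which agree with it near `S`. -/
theorem exists_monotone_contDiff_approx_rel {n : ℕ∞} (hn : 1 ≤ n) {β : ℝ → ℝ} (hβ : Continuous β)
    (hm : Monotone β) (hp : ∀ t, β (t + 2 * Real.pi) = β t + 2 * Real.pi) {S E : Set ℂ}
    (hS : IsCompact S) (hE : IsOpen E) (hSE : S ⊆ E)
    (hreg : ∀ t : ℝ, Complex.exp (Complex.I * t) ∈ E → ContDiffAt ℝ n β t) :
    ∃ N : Set ℝ, IsOpen N ∧ (∀ t : ℝ, Complex.exp (Complex.I * t) ∈ S → t ∈ N) ∧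
      (∀ t ∈ N, ContDiffAt ℝ n β t) ∧
      ∀ ε > 0, ∃ b : ℝ → ℝ, ContDiff ℝ n b ∧ Monotone b ∧
        (∀ t, b (t + 2 * Real.pi) = b t + 2 * Real.pi) ∧ (∀ t, |b t - β t| ≤ ε) ∧
        ∀ t ∈ N, b t = β t := by
  obtain ⟨X, hX, hX1, hX0, hXI⟩ := exists_contDiff_cutoff hS.isClosed hE hSE
  set e : ℝ → ℂ := fun t => Complex.exp (Complex.I * t) with he
  have hec : ∀ n : ℕ∞, ContDiff ℝ n e := fun n => by
    simp only [he]
    have h1 : ContDiff ℝ n (fun t : ℝ => (t : ℂ)) := Complex.ofRealCLM.contDiff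
    exact (contDiff_const.mul h1).cexp
  have hecont : Continuous e := (hec 0).continuous
  obtain ⟨O, hO, hSO, hOX⟩ := mem_nhdsSet_iff_exists.1 hX1
  obtain ⟨δ, hδ, hth⟩ := hS.exists_thickening_subset_open hO hSO
  obtain ⟨b₁, c, hb1, hb1m, hb2m, hb1p, hb1c⟩ := exists_monotone_contDiff_part (n := n) hm hp
    (χ := fun t => X (e t)) (fun n => (hX n).comp (hec n))
    (fun t => by simp only [he]; rw [cexp_I_mul_add_two_pi]) (fun t => hXI _) hn
    (fun t => by
      by_cases h : e t ∈ E
      · exact Or.inr (hreg t h)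
      · left
        have h2 : ∀ᶠ x in 𝓝 (e t), X x = 0 := hX0.filter_mono (nhds_le_nhdsSet h)
        exact hecont.continuousAt.eventually h2)
  set β₂ : ℝ → ℝ := fun t => β t - b₁ t with hβ2
  have hβ2c : Continuous β₂ := hβ.sub hb1.continuous
  have hβ2p : ∀ t, β₂ (t + 2 * Real.pi) = β₂ t + (2 * Real.pi - c) := fun t => by
    simp only [hβ2]; rw [hp, hb1p]; ring
  refine ⟨e ⁻¹' (thickening (δ / 2) S), isOpen_thickening.preimage hecont,
    fun t ht => self_subset_thickening (by positivity) S ht, fun t ht => hreg t ?_, ?_⟩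
  · by_contra h
    have h1 : X (e t) = 1 := hOX (hth (thickening_mono (by linarith) S ht))
    have h0 : X (e t) = 0 := hX0.self_of_nhdsSet _ h
    rw [h1] at h0; norm_num at h0
  intro ε hε
  obtain ⟨δ₁, hδ₁, huc⟩ := exists_uniform_of_quasiPeriodic hβ2c Real.two_pi_pos hβ2p hε
  obtain ⟨b, hb, hbm, hbp, hbd⟩ := exists_monotone_contDiff_approx hβ2c hb2m hβ2p
    (show 0 < min δ₁ (δ / 2) by positivity)
  refine ⟨fun t => b₁ t + b t, hb1.add (hb n), hb1m.add hbm, fun t => ?_, fun t => ?_,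
    fun t ht => ?_⟩
  · simp only [hb1p, hbp]; ring
  · have := hbd t ε fun x hx => (huc x t (lt_of_lt_of_le hx (min_le_left _ _))).le
    rw [Real.dist_eq] at this
    convert this using 2
    simp only [hβ2]; ring
  · have hone : ∀ x, dist x t < δ / 2 → X (e x) = 1 := by
      intro x hx
      refine hOX (hth ?_)
      obtain ⟨s, hs, hst⟩ := mem_thickening_iff.1 ht
      refine mem_thickening_iff.2 ⟨s, hs, ?_⟩
      have h1 : dist (e x) (e t) ≤ dist x t := by
        rw [dist_eq_norm, Real.dist_eq]; exact norm_cexp_I_mul_sub_le x t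
      have := dist_triangle (e x) (e t) s
      linarith
    have := hbd t 0 fun x hx => by
      have hx' : dist x t < δ / 2 := lt_of_lt_of_le hx (min_le_right _ _)
      rw [Real.dist_eq, abs_lt] at hx'
      have : β₂ x = β₂ t := by
        rcases le_total x t with h | h
        · refine (hb1c x t h fun u hu => hone u ?_).symm
          rw [Real.dist_eq, abs_lt]; constructor <;> linarith [hu.1, hu.2]
        · refine hb1c t x h fun u hu => hone u ?_
          rw [Real.dist_eq, abs_lt]; constructor <;> linarith [hu.1, hu.2]
      rw [this, dist_self]
    have h2 : b t = β₂ t := dist_le_zero.1 this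
    simp only [h2, hβ2]; ring

open Filter Topology in
/-- A sequence of functions converging uniformly can be interpolated smoothly. -/
theorem exists_smooth_interpolation {n : ℕ∞} {β : ℝ → ℝ} {N : Set ℝ} {p : ℝ}
    (happ : ∀ ε > 0, ∃ b : ℝ → ℝ, ContDiff ℝ n b ∧ Monotone b ∧
        (∀ t, b (t + p) = b t + p) ∧ (∀ t, |b t - β t| ≤ ε) ∧ ∀ t ∈ N, b t = β t) :
    ∃ B : ℝ → ℝ → ℝ, (∀ x : ℝ, 0 < x → ∀ t, ContDiffAt ℝ n (fun q : ℝ × ℝ => B q.1 q.2) (x, t)) ∧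
      (∀ x : ℝ, 0 < x → Monotone (B x)) ∧ (∀ x > 0, ∀ t, B x (t + p) = B x t + p) ∧
      (∀ x : ℝ, 0 < x → ∀ t, |B x t - β t| ≤ 1 / x) ∧ ∀ x > 0, ∀ t ∈ N, B x t = β t := by
  choose b hb using fun k : ℕ => happ (1 / (k + 1)) (by positivity)
  set st := Real.smoothTransition
  set C : ℕ → ℝ → ℝ → ℝ := fun K x t =>
    b 0 t + ∑ k ∈ Finset.range K, st (x - k) * (b (k + 1) t - b k t) with hC
  have hCK : ∀ (x t : ℝ) (K : ℕ), x ≤ K → C K x t = C ⌈x⌉₊ x t := by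
    intro x t K hK
    simp only [hC]
    congr 1
    symm
    refine Finset.sum_subset (Finset.range_subset_range.2 (Nat.ceil_le.2 hK)) fun k _ hk => ?_
    rw [Finset.mem_range, not_lt] at hk
    have : st (x - k) = 0 := Real.smoothTransition.zero_of_nonpos
      (sub_nonpos.2 (Nat.ceil_le.1 hk))
    rw [this, zero_mul]
  have hconv : ∀ x : ℝ, 0 < x → ∃ m : ℕ, ∃ σ ∈ Icc (0 : ℝ) 1, x ≤ m + 1 ∧
      ∀ t, C ⌈x⌉₊ x t = (1 - σ) * b m t + σ * b (m + 1) t := by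
    intro x hx
    refine ⟨⌊x⌋₊, st (x - ⌊x⌋₊), ⟨Real.smoothTransition.nonneg _, Real.smoothTransition.le_one _⟩,
      (Nat.lt_floor_add_one x).le, fun t => ?_⟩
    rw [← hCK x t (⌊x⌋₊ + 1) (by push_cast; exact (Nat.lt_floor_add_one x).le)]
    simp only [hC]
    rw [Finset.sum_range_succ]
    have : ∑ k ∈ Finset.range ⌊x⌋₊, st (x - k) * (b (k + 1) t - b k t) =
        ∑ k ∈ Finset.range ⌊x⌋₊, (b (k + 1) t - b k t) := by
      refine Finset.sum_congr rfl fun k hk => ?_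
      have h1 : (k : ℝ) + 1 ≤ x := by
        have : k + 1 ≤ ⌊x⌋₊ := Finset.mem_range.1 hk
        exact le_trans (by exact_mod_cast this) (Nat.floor_le hx.le)
      have : st (x - k) = 1 := Real.smoothTransition.one_of_one_le (by linarith)
      rw [this, one_mul]
    rw [this, Finset.sum_range_sub (fun k => b k t)]
    ring
  refine ⟨fun x t => C ⌈x⌉₊ x t, ?_, ?_, ?_, ?_, ?_⟩
  · intro x hx t
    have h1 : ContDiff ℝ n (fun q : ℝ × ℝ => C (⌈x⌉₊ + 1) q.1 q.2) := by
      simp only [hC]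
      refine ((hb 0).1.comp contDiff_snd).add (ContDiff.sum fun k _ => ?_)
      refine ContDiff.mul ?_ (((hb (k + 1)).1.comp contDiff_snd).sub ((hb k).1.comp contDiff_snd))
      exact Real.smoothTransition.contDiff.comp (contDiff_fst.sub contDiff_const)
    refine h1.contDiffAt.congr_of_eventuallyEq ?_
    have h2 : ∀ᶠ q : ℝ × ℝ in 𝓝 (x, t), q.1 < (⌈x⌉₊ + 1 : ℕ) :=
      continuousAt_fst.eventually (gt_mem_nhds (by
        push_cast; exact lt_of_le_of_lt (Nat.le_ceil x) (lt_add_one _)))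
    filter_upwards [h2] with q hq
    exact (hCK _ _ _ hq.le).symm
  · intro x hx t u htu
    obtain ⟨m, σ, hσ, -, h⟩ := hconv x hx
    simp only [h]
    have h1 := (hb m).2.1 htu
    have h2 := (hb (m + 1)).2.1 htu
    nlinarith [mul_le_mul_of_nonneg_left h1 (sub_nonneg.2 hσ.2),
      mul_le_mul_of_nonneg_left h2 hσ.1]
  · intro x hx t
    obtain ⟨m, σ, hσ, -, h⟩ := hconv x hx
    simp only [h]
    rw [(hb m).2.2.1, (hb (m + 1)).2.2.1]; ring
  · intro x hx t
    obtain ⟨m, σ, hσ, hm, h⟩ := hconv x hx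
    simp only [h]
    have h1 := (hb m).2.2.2.1 t
    have h2 := (hb (m + 1)).2.2.2.1 t
    have h3 : (1 : ℝ) / (m + 1) ≤ 1 / x := one_div_le_one_div_of_le hx hm
    have h4 : (1 : ℝ) / ((m + 1 : ℕ) + 1) ≤ 1 / x :=
      one_div_le_one_div_of_le hx (by push_cast; linarith)
    have h5 : (1 - σ) * b m t + σ * b (m + 1) t - β t =
        (1 - σ) * (b m t - β t) + σ * (b (m + 1) t - β t) := by ring
    rw [h5]
    refine (abs_add_le _ _).trans ?_
    rw [abs_mul, abs_mul, abs_of_nonneg hσ.1, abs_of_nonneg (sub_nonneg.2 hσ.2)]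
    nlinarith [mul_le_mul_of_nonneg_left (h1.trans h3) (sub_nonneg.2 hσ.2),
      mul_le_mul_of_nonneg_left (h2.trans h4) hσ.1]
  · intro x hx t ht
    obtain ⟨m, σ, hσ, hm, h⟩ := hconv x hx
    simp only [h]
    rw [(hb m).2.2.2.2 t ht, (hb (m + 1)).2.2.2.2 t ht]; ring

open Filter Topology in
theorem exists_angular_isotopy {n : ℕ∞} (hn : 1 ≤ n) {β : ℝ → ℝ} (hβ : Continuous β)
    {N : Set ℝ} (hN : IsOpen N) (hNβ : ∀ t ∈ N, ContDiffAt ℝ n β t) {p : ℝ}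
    (hp : ∀ t, β (t + p) = β t + p)
    (happ : ∀ ε > 0, ∃ b : ℝ → ℝ, ContDiff ℝ n b ∧ Monotone b ∧
        (∀ t, b (t + p) = b t + p) ∧ (∀ t, |b t - β t| ≤ ε) ∧ ∀ t ∈ N, b t = β t) :
    ∃ α : ℝ → ℝ → ℝ, Continuous (fun q : ℝ × ℝ => α q.1 q.2) ∧
      (∀ r t, α r (t + p) = α r t + p) ∧ (∀ t, α 1 t = β t) ∧ (∀ r ≤ 1 / 2, ∀ t, α r t = t) ∧
      (∀ r < 1, ∀ t, ContDiffAt ℝ n (fun q : ℝ × ℝ => α q.1 q.2) (r, t) ∧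
        0 < deriv (α r) t) ∧
      ∀ r, ∀ t ∈ N, ContDiffAt ℝ n (fun q : ℝ × ℝ => α q.1 q.2) (r, t) := by
  obtain ⟨B, hB1, hB2, hB3, hB4, hB5⟩ := exists_smooth_interpolation happ
  set κ : ℝ → ℝ := fun r => 1 - Real.smoothTransition (2 * r - 1) with hκ
  have hκd : ContDiff ℝ n κ :=
    contDiff_const.sub (Real.smoothTransition.contDiff.comp
      ((contDiff_const.mul contDiff_id).sub contDiff_const))
  have hκ1 : κ 1 = 0 := by
    have : Real.smoothTransition (2 * 1 - 1) = 1 := Real.smoothTransition.one_of_one_le (by norm_num)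
    simp only [hκ, this, sub_self]
  have hκh : ∀ r ≤ 1 / 2, κ r = 1 := fun r hr => by
    have : Real.smoothTransition (2 * r - 1) = 0 :=
      Real.smoothTransition.zero_of_nonpos (by linarith)
    simp only [hκ, this, sub_zero]
  have hκpos : ∀ r < 1, 0 < κ r := fun r hr => by
    have : Real.smoothTransition (2 * r - 1) < 1 :=
      Real.smoothTransition.lt_one_of_lt_one (by linarith)
    simp only [hκ]; linarith
  have hκle : ∀ r, κ r ≤ 1 := fun r => by
    have := Real.smoothTransition.nonneg (2 * r - 1)
    simp only [hκ]; linarith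
  set A : ℝ → ℝ → ℝ := fun r t => if r < 1 then B (1 - r)⁻¹ t else β t with hA
  have hAlt : ∀ r < 1, ∀ t, A r t = B (1 - r)⁻¹ t := fun r hr t => if_pos hr
  have hxpos : ∀ r : ℝ, r < 1 → 0 < (1 - r)⁻¹ := fun r hr => inv_pos.2 (by linarith)
  have hAbd : ∀ r t, |A r t - β t| ≤ max (1 - r) 0 := by
    intro r t
    by_cases hr : r < 1
    · rw [hAlt r hr]
      refine (hB4 _ (hxpos r hr) t).trans ?_
      rw [one_div, inv_inv]; exact le_max_left _ _
    · have : A r t = β t := if_neg hr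
      rw [this]; simp
  have hAN : ∀ r, ∀ t ∈ N, A r t = β t := by
    intro r t ht
    by_cases hr : r < 1
    · rw [hAlt r hr]; exact hB5 _ (hxpos r hr) t ht
    · exact if_neg hr
  have hAp : ∀ r t, A r (t + p) = A r t + p := by
    intro r t
    by_cases hr : r < 1
    · rw [hAlt r hr, hAlt r hr]; exact hB3 _ (hxpos r hr) t
    · simp only [hA, if_neg hr]; exact hp t
  have hAd : ∀ r < 1, ∀ t, ContDiffAt ℝ n (fun q : ℝ × ℝ => A q.1 q.2) (r, t) := by
    intro r hr t
    have h1 : ContDiffAt ℝ n (fun q : ℝ × ℝ => ((1 - q.1)⁻¹, q.2)) (r, t) := by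
      refine ContDiffAt.prodMk ?_ contDiffAt_snd
      exact (contDiffAt_const.sub contDiffAt_fst).inv (sub_pos.2 hr).ne'
    have h2 := ContDiffAt.comp (r, t) (hB1 _ (hxpos r hr) t) h1
    refine h2.congr_of_eventuallyEq ?_
    have h3 : ∀ᶠ q : ℝ × ℝ in 𝓝 (r, t), q.1 < 1 :=
      continuousAt_fst.eventually (gt_mem_nhds hr)
    filter_upwards [h3] with q hq
    exact hAlt _ hq _
  have hAc : Continuous (fun q : ℝ × ℝ => A q.1 q.2) := by
    rw [continuous_iff_continuousAt]
    rintro ⟨r, t⟩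
    rcases lt_or_ge r 1 with hr | hr
    · exact (hAd r hr t).continuousAt
    · have h1 : Tendsto (fun q : ℝ × ℝ => A q.1 q.2 - β q.2) (𝓝 (r, t)) (𝓝 0) := by
        refine squeeze_zero_norm (a := fun q : ℝ × ℝ => max (1 - q.1) 0) (fun q => hAbd _ _) ?_
        have : Continuous fun q : ℝ × ℝ => max (1 - q.1) (0 : ℝ) := by fun_prop
        have h2 := this.tendsto (r, t)
        simpa [max_eq_right (sub_nonpos.2 hr)] using h2
      have h2 : ContinuousAt (fun q : ℝ × ℝ => (A q.1 q.2 - β q.2) + β q.2) (r, t) := by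
        refine ContinuousAt.add ?_ (hβ.continuousAt.comp continuousAt_snd)
        have : A r t - β t = 0 := by
          rw [show A r t = β t from if_neg (not_lt.2 hr), sub_self]
        rw [ContinuousAt]
        simpa only [this] using h1
      simpa using h2
  refine ⟨fun r t => (1 - κ r) * A r t + κ r * t, ?_, ?_, ?_, ?_, ?_, ?_⟩
  · have := hκd.continuous
    fun_prop
  · intro r t
    simp only [hAp]; ring
  · intro t
    simp only [hκ1]
    rw [show A 1 t = β t from if_neg (lt_irrefl _)]; ring
  · intro r hr t
    simp only [hκh r hr]; ring
  · intro r hr t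
    refine ⟨?_, ?_⟩
    · exact ((contDiffAt_const.sub (hκd.contDiffAt.comp _ contDiffAt_fst)).mul (hAd r hr t)).add
        ((hκd.contDiffAt.comp _ contDiffAt_fst).mul contDiffAt_snd)
    · have hn' : (n : WithTop ℕ∞) ≠ 0 := by
        intro h0
        have : n = 0 := by exact_mod_cast h0
        rw [this] at hn; exact absurd hn (by simp)
      have h1 : DifferentiableAt ℝ (fun t => A r t) t := by
        have h2 : DifferentiableAt ℝ (fun q : ℝ × ℝ => A q.1 q.2) (r, t) :=
          (hAd r hr t).differentiableAt hn'
        exact DifferentiableAt.comp t (g := fun q : ℝ × ℝ => A q.1 q.2) (f := fun t => (r, t)) h2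
          ((differentiableAt_const r).prodMk differentiableAt_id)
      have h3 : 0 ≤ deriv (fun t => A r t) t := by
        have : Monotone fun t => A r t := by
          intro u v huv
          simp only [hAlt r hr]
          exact hB2 _ (hxpos r hr) huv
        exact this.deriv_nonneg
      have h4 : HasDerivAt (fun t => (1 - κ r) * A r t + κ r * t)
          ((1 - κ r) * deriv (fun t => A r t) t + κ r * 1) t :=
        (h1.hasDerivAt.const_mul _).add ((hasDerivAt_id t).const_mul _)
      rw [h4.deriv]
      have := mul_nonneg (sub_nonneg.2 (hκle r)) h3
      linarith [hκpos r hr]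
  · intro r t ht
    have h1 : ContDiffAt ℝ n (fun q : ℝ × ℝ => (1 - κ q.1) * β q.2 + κ q.1 * q.2) (r, t) :=
      ((contDiffAt_const.sub (hκd.contDiffAt.comp _ contDiffAt_fst)).mul
        (ContDiffAt.comp (r, t) (hNβ t ht) contDiffAt_snd)).add
        ((hκd.contDiffAt.comp _ contDiffAt_fst).mul contDiffAt_snd)
    refine h1.congr_of_eventuallyEq ?_
    have h3 : ∀ᶠ q : ℝ × ℝ in 𝓝 (r, t), q.2 ∈ N :=
      continuousAt_snd.eventually (hN.mem_nhds ht)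
    filter_upwards [h3] with q hq
    rw [hAN _ _ hq]

theorem det_eq_of_complex (L : ℂ →L[ℝ] ℂ) :
    L.det = (L 1).re * (L Complex.I).im - (L 1).im * (L Complex.I).re := by
  rw [ContinuousLinearMap.det, ← LinearMap.det_toMatrix Complex.basisOneI, Matrix.det_fin_two]
  simp [LinearMap.toMatrix_apply]
  ring

open Filter Topology in
/-- Maps preserving the radius, given by their effect on the angle. -/
theorem exists_polar_map {n : ℕ∞} (hn : 1 ≤ n) {α : ℝ → ℝ → ℝ}
    (hαc : Continuous (fun q : ℝ × ℝ => α q.1 q.2))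
    (hp : ∀ r t, α r (t + 2 * Real.pi) = α r t + 2 * Real.pi)
    (h0 : ∀ r ≤ 1 / 2, ∀ t, α r t = t) :
    ∃ F : ℂ → ℂ, Continuous F ∧ (∀ z, ‖F z‖ = ‖z‖) ∧
      (∀ t : ℝ, F (Complex.exp (Complex.I * t)) = Complex.exp (Complex.I * α 1 t)) ∧
      (∀ z, ‖z‖ ≤ 1 / 2 → F z = z) ∧
      ∀ ζ : ℂ, (∀ᶠ q : ℝ × ℝ in 𝓝 (Real.exp ζ.re, ζ.im),
          ContDiffAt ℝ n (fun q : ℝ × ℝ => α q.1 q.2) q) →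
        deriv (α (Real.exp ζ.re)) ζ.im ≠ 0 → RegAt n F (Complex.exp ζ) := by
  have hn1 : (1 : WithTop ℕ∞) ≤ n := by exact_mod_cast hn
  have hn0 : (n : WithTop ℕ∞) ≠ 0 := by intro h; simp [h] at hn1
  set f : ℂ → ℂ := fun ζ => ζ.re + Complex.I * α (Real.exp ζ.re) ζ.im with hf
  have hfc : Continuous f := by
    have h1 : Continuous fun ζ : ℂ => α (Real.exp ζ.re) ζ.im :=
      hαc.comp (by fun_prop : Continuous fun ζ : ℂ => (Real.exp ζ.re, ζ.im))
    fun_prop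
  have hpm : ∀ r t (m : ℤ), α r (t + m * (2 * Real.pi)) = α r t + m * (2 * Real.pi) := by
    intro r t m
    induction m using Int.induction_on with
    | zero => simp
    | succ i ih =>
      have := hp r (t + i * (2 * Real.pi))
      push_cast at ih ⊢
      rw [ih] at this
      rw [show t + ((i : ℝ) + 1) * (2 * Real.pi) = t + i * (2 * Real.pi) + 2 * Real.pi by ring,
        this]; ring
    | pred i ih =>
      have := hp r (t + (-(i : ℝ) - 1) * (2 * Real.pi))
      push_cast at ih ⊢
      rw [show t + (-(i : ℝ) - 1) * (2 * Real.pi) + 2 * Real.pi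
        = t + -(i : ℝ) * (2 * Real.pi) by ring, ih] at this
      linarith
  set F : ℂ → ℂ := fun z => if z = 0 then 0 else Complex.exp (f (Complex.log z)) with hF
  have hFe : ∀ ζ, F (Complex.exp ζ) = Complex.exp (f ζ) := by
    intro ζ
    simp only [hF, if_neg (Complex.exp_ne_zero ζ)]
    obtain ⟨m, hm⟩ := Complex.exp_eq_exp_iff_exists_int.1
      (Complex.exp_log (Complex.exp_ne_zero ζ))
    rw [hm, Complex.exp_eq_exp_iff_exists_int]
    refine ⟨m, ?_⟩
    have h1 : (ζ + m * (2 * Real.pi * Complex.I)).re = ζ.re := by simp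
    have h2 : (ζ + m * (2 * Real.pi * Complex.I)).im = ζ.im + m * (2 * Real.pi) := by simp
    simp only [hf, h1, h2, hpm]
    push_cast; ring
  have hFid : ∀ z, ‖z‖ ≤ 1 / 2 → F z = z := by
    intro z hz
    by_cases hz0 : z = 0
    · simp [hF, hz0]
    · conv_lhs => rw [← Complex.exp_log hz0]
      rw [hFe]
      have h1 : Real.exp (Complex.log z).re = ‖z‖ := by
        rw [← Complex.norm_exp, Complex.exp_log hz0]
      have : f (Complex.log z) = Complex.log z := by
        simp only [hf, h1, h0 _ hz]
        rw [mul_comm]; exact Complex.re_add_im _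
      rw [this, Complex.exp_log hz0]
  have hlocal : ∀ ζ : ℂ, ∃ ℓ : ℂ → ℂ, AnalyticAt ℂ ℓ (Complex.exp ζ) ∧
      deriv ℓ (Complex.exp ζ) ≠ 0 ∧ ℓ (Complex.exp ζ) = ζ ∧
      ∀ᶠ z in 𝓝 (Complex.exp ζ), F z = Complex.exp (f (ℓ z)) := by
    intro ζ
    obtain ⟨ℓ, h1, h2, h3, -, h4⟩ := exists_analytic_leftInverse (e := Complex.exp) (a := ζ)
      analyticAt_cexp (by rw [Complex.deriv_exp]; exact Complex.exp_ne_zero ζ)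
    refine ⟨ℓ, h1, h2, h3, ?_⟩
    filter_upwards [h4] with z hz
    rw [← hFe, hz]
  refine ⟨F, ?_, ?_, ?_, hFid, ?_⟩
  · rw [continuous_iff_continuousAt]
    intro z
    by_cases hz : z = 0
    · have : F =ᶠ[𝓝 z] id := by
        have h1 : ∀ᶠ w : ℂ in 𝓝 z, ‖w‖ < 1 / 2 :=
          continuous_norm.continuousAt.eventually (gt_mem_nhds (by rw [hz]; norm_num))
        filter_upwards [h1] with w hw using hFid w hw.le
      exact continuousAt_id.congr this.symm
    · obtain ⟨ℓ, h1, -, h3, h4⟩ := hlocal (Complex.log z)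
      rw [Complex.exp_log hz] at h1 h3 h4
      have h5 : ContinuousAt (fun z => Complex.exp (f (ℓ z))) z :=
        (Complex.continuous_exp.comp hfc).continuousAt.comp h1.continuousAt
      exact h5.congr (h4.mono fun _ h => h.symm)
  · intro z
    by_cases hz : z = 0
    · simp [hF, hz]
    · rw [← Complex.exp_log hz, hFe, Complex.norm_exp, Complex.norm_exp]
      simp [hf]
  · intro t
    rw [hFe]
    simp [hf]
  · intro ζ hζ hd
    obtain ⟨ℓ, h1, h2, h3, h4⟩ := hlocal ζ
    have hcd : ∀ ξ : ℂ, ContDiffAt ℝ n (fun q : ℝ × ℝ => α q.1 q.2) (Real.exp ξ.re, ξ.im) →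
        ContDiffAt ℝ n f ξ := by
      intro ξ hξ
      have hre : ContDiff ℝ n fun z : ℂ => z.re := Complex.reCLM.contDiff
      have him : ContDiff ℝ n fun z : ℂ => z.im := Complex.imCLM.contDiff
      have hco : ContDiff ℝ n fun x : ℝ => (x : ℂ) := Complex.ofRealCLM.contDiff
      have h5 : ContDiffAt ℝ n (fun ξ : ℂ => α (Real.exp ξ.re) ξ.im) ξ :=
        ContDiffAt.comp ξ (g := fun q : ℝ × ℝ => α q.1 q.2)
          (f := fun ξ : ℂ => (Real.exp ξ.re, ξ.im)) hξ
          ((Real.contDiff_exp.comp hre).prodMk him).contDiffAt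
      exact (hco.comp hre).contDiffAt.add (contDiffAt_const.mul (hco.contDiffAt.comp ξ h5))
    have hreg : RegAt n f ζ := by
      constructor
      · have hc : ContinuousAt (fun ξ : ℂ => (Real.exp ξ.re, ξ.im)) ζ :=
          (by fun_prop : Continuous fun ξ : ℂ => (Real.exp ξ.re, ξ.im)).continuousAt
        filter_upwards [hc.eventually hζ] with ξ hξ using hcd ξ hξ
      · have hdf : DifferentiableAt ℝ f ζ := (hcd ζ hζ.self_of_nhds).differentiableAt hn0
        have hre : HasFDerivAt (fun z => (f z).re) (Complex.reCLM.comp (fderiv ℝ f ζ)) ζ :=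
          Complex.reCLM.hasFDerivAt.comp ζ hdf.hasFDerivAt
        have hre' : HasFDerivAt (fun z => (f z).re) Complex.reCLM ζ := by
          have : (fun z => (f z).re) = Complex.reCLM := by
            ext z; simp [hf]
          rw [this]; exact Complex.reCLM.hasFDerivAt
        have hun := hre.unique hre'
        have e1 : (fderiv ℝ f ζ 1).re = 1 := by
          have := congrArg (fun L => L 1) hun; simpa using this
        have e2 : (fderiv ℝ f ζ Complex.I).re = 0 := by
          have := congrArg (fun L => L Complex.I) hun; simpa using this
        have hline : HasDerivAt (fun t : ℝ => (⟨ζ.re, t⟩ : ℂ)) Complex.I ζ.im := by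
          have : (fun t : ℝ => (⟨ζ.re, t⟩ : ℂ)) = fun t : ℝ => (ζ.re : ℂ) + t * Complex.I := by
            ext t; exact Complex.mk_eq_add_mul_I _ _
          rw [this]
          simpa using ((Complex.ofRealCLM.hasDerivAt (x := ζ.im)).mul_const Complex.I).const_add
            (ζ.re : ℂ)
        have h6 : HasDerivAt (fun t : ℝ => (f ⟨ζ.re, t⟩).im) (fderiv ℝ f ζ Complex.I).im ζ.im := by
          have h7 : HasDerivAt (fun t : ℝ => f ⟨ζ.re, t⟩) (fderiv ℝ f ζ Complex.I) ζ.im :=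
            HasFDerivAt.comp_hasDerivAt (f := fun t : ℝ => (⟨ζ.re, t⟩ : ℂ)) ζ.im
              hdf.hasFDerivAt hline
          exact Complex.imCLM.hasFDerivAt.comp_hasDerivAt ζ.im h7
        have h8 : (fun t : ℝ => (f ⟨ζ.re, t⟩).im) = α (Real.exp ζ.re) := by
          ext t; simp [hf]
        rw [h8] at h6
        rw [det_eq_of_complex, e1, e2, ← h6.deriv]
        simpa using hd
    have h5 : RegAt n ℓ (Complex.exp ζ) := RegAt.of_analyticAt h1 h2
    have h6 : RegAt n (fun z => f (ℓ z)) (Complex.exp ζ) :=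
      RegAt.comp hn1 (by rw [h3]; exact hreg) h5
    have h7 : RegAt n Complex.exp (f (ℓ (Complex.exp ζ))) :=
      RegAt.of_analyticAt analyticAt_cexp
        (by rw [Complex.deriv_exp]; exact Complex.exp_ne_zero _)
    exact (RegAt.comp (g := Complex.exp) (h := fun z => f (ℓ z)) hn1 h7 h6).congr h4

theorem eq_zero_of_det_ne_zero {L : ℂ →L[ℝ] ℂ} (h : L.det ≠ 0) {v : ℂ} (hv : L v = 0) :
    v = 0 :=
  (L.toContinuousLinearEquivOfDetNeZero h).injective (by simpa using hv)

open Filter Topology in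
theorem contDiffAt_arg_of_contDiffAt {n : ℕ∞} (hn : 1 ≤ n) {β : ℝ → ℝ} {t : ℝ}
    (hβ : ContinuousAt β t) {g : ℂ → ℂ} (hg : RegAt n g (Complex.exp (Complex.I * t)))
    (he : ∀ᶠ u : ℝ in 𝓝 t,
      Complex.exp (Complex.I * β u) = g (Complex.exp (Complex.I * u))) :
    ContDiffAt ℝ n β t ∧ deriv β t ≠ 0 := by
  have hn1 : (1 : WithTop ℕ∞) ≤ n := by exact_mod_cast hn
  have hn0 : (n : WithTop ℕ∞) ≠ 0 := by intro h; simp [h] at hn1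
  have hco : ContDiff ℝ n fun x : ℝ => (x : ℂ) := Complex.ofRealCLM.contDiff
  have h1 : ContDiffAt ℝ n (fun u : ℝ => g (Complex.exp (Complex.I * u))) t :=
    ContDiffAt.comp t (g := g) (f := fun u : ℝ => Complex.exp (Complex.I * u)) hg.contDiffAt
      (contDiff_const.mul hco).cexp.contDiffAt
  have h2 : ContDiffAt ℝ n (fun u : ℝ => β t + (Complex.log (g (Complex.exp (Complex.I * u)) /
      Complex.exp (Complex.I * β t))).im) t := by
    refine contDiffAt_const.add ?_
    have h3 : ContDiffAt ℝ n (fun u : ℝ => g (Complex.exp (Complex.I * u)) /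
      Complex.exp (Complex.I * β t)) t := by
      simp only [div_eq_mul_inv]
      exact h1.mul contDiffAt_const
    have h4 : ContDiffAt ℝ n Complex.log (g (Complex.exp (Complex.I * t)) /
      Complex.exp (Complex.I * β t)) := by
      rw [← he.self_of_nhds, div_self (Complex.exp_ne_zero _)]
      exact (Complex.contDiffAt_log (by simp)).restrict_scalars ℝ
    have h5 := ContDiffAt.comp t (g := Complex.log) (f := fun u : ℝ =>
      g (Complex.exp (Complex.I * u)) / Complex.exp (Complex.I * β t)) h4 h3
    exact (Complex.imCLM.contDiff (n := n)).contDiffAt.comp t h5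
  have hpi := Real.pi_pos
  have h6 : ContDiffAt ℝ n β t := by
    refine h2.congr_of_eventuallyEq ?_
    have h7 : ∀ᶠ u in 𝓝 t, β u ∈ Ioo (β t - Real.pi) (β t + Real.pi) :=
      hβ.eventually (Ioo_mem_nhds (by linarith) (by linarith))
    filter_upwards [he, h7] with u hu hu2
    rw [← hu, ← Complex.exp_sub, Complex.log_exp]
    · simp
    · simp; linarith [hu2.1]
    · simp; linarith [hu2.2]
  refine ⟨h6, fun hd => ?_⟩
  have h7 : HasDerivAt β 0 t := hd ▸ (h6.differentiableAt hn0).hasDerivAt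
  have h8 : HasDerivAt (fun u : ℝ => Complex.exp (Complex.I * β u)) 0 t := by
    have := ((h7.ofReal_comp).const_mul Complex.I).cexp
    simpa using this
  have h9 : HasDerivAt (fun u : ℝ => Complex.exp (Complex.I * u))
      (Complex.exp (Complex.I * t) * Complex.I) t := by
    have := ((Complex.ofRealCLM.hasDerivAt (x := t)).const_mul Complex.I).cexp
    simpa using this
  have h10 : HasDerivAt (fun u : ℝ => g (Complex.exp (Complex.I * u)))
      (fderiv ℝ g (Complex.exp (Complex.I * t)) (Complex.exp (Complex.I * t) * Complex.I)) t :=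
    HasFDerivAt.comp_hasDerivAt (f := fun u : ℝ => Complex.exp (Complex.I * u)) t
      (hg.contDiffAt.differentiableAt hn0).hasFDerivAt h9
  have h11 := (h8.congr_of_eventuallyEq (he.mono fun _ h => h.symm)).unique h10
  exact mul_ne_zero (Complex.exp_ne_zero _) Complex.I_ne_zero
    (eq_zero_of_det_ne_zero hg.2 h11.symm)

theorem regAt_conj (n : WithTop ℕ∞) (z : ℂ) : RegAt n (starRingEnd ℂ) z := by
  have h : (starRingEnd ℂ : ℂ → ℂ) = Complex.conjCLE := by ext; simp
  rw [h]
  refine ⟨Filter.Eventually.of_forall fun y => Complex.conjCLE.contDiff.contDiffAt, ?_⟩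
  rw [ContinuousLinearEquiv.fderiv, det_eq_of_complex]
  simp

open Metric Filter Topology in
theorem exists_radial_extension_of_strictMono {n : ℕ∞} (hn : 1 ≤ n) {G : ℂ → ℂ} {β : ℝ → ℝ}
    (hβ : Continuous β)
    (hGβ : ∀ t : ℝ, G (Complex.exp (Complex.I * t)) = Complex.exp (Complex.I * β t))
    (hmono : StrictMono β) (hper : ∀ t, β (t + 2 * Real.pi) = β t + 2 * Real.pi)
    {S : Set ℂ} (hS : IsCompact S)
    (hreg : ∀ s ∈ S, ∃ g, RegAt n g s ∧ ∀ᶠ z in 𝓝 s, ‖z‖ = 1 → G z = g z) :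
    ∃ F : ℂ → ℂ, Continuous F ∧ (∀ z, ‖F z‖ = ‖z‖) ∧ (∀ z ∈ sphere (0 : ℂ) 1, F z = G z) ∧
      (∀ z ∈ ball (0 : ℂ) 1, RegAt n F z) ∧ ∀ s ∈ S, ‖s‖ = 1 → RegAt n F s := by
  have hn1 : (1 : WithTop ℕ∞) ≤ n := by exact_mod_cast hn
  set E : Set ℂ := {s | ∃ g, RegAt n g s ∧ ∀ᶠ z in 𝓝 s, ‖z‖ = 1 → G z = g z} with hE
  have hEo : IsOpen E := by
    rw [isOpen_iff_mem_nhds]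
    rintro s ⟨g, h1, h2⟩
    filter_upwards [h1.eventually hn1, h2.eventually_nhds] with y h3 h4
    exact ⟨g, h3, h4⟩
  have harg : ∀ t : ℝ, Complex.exp (Complex.I * t) ∈ E → ContDiffAt ℝ n β t ∧ deriv β t ≠ 0 := by
    rintro t ⟨g, h1, h2⟩
    refine contDiffAt_arg_of_contDiffAt hn hβ.continuousAt h1 ?_
    have hc : ContinuousAt (fun u : ℝ => Complex.exp (Complex.I * u)) t :=
      (by fun_prop : Continuous fun u : ℝ => Complex.exp (Complex.I * u)).continuousAt
    filter_upwards [hc.eventually h2] with u hu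
    rw [← hGβ]
    exact hu (norm_cexp_I_mul_ofReal u)
  obtain ⟨N, hN, hSN, hNβ, happ⟩ := exists_monotone_contDiff_approx_rel hn hβ hmono.monotone hper
    hS hEo (fun s hs => hreg s hs) (fun t ht => (harg t ht).1)
  obtain ⟨α, h1, h2, h3, h4, h5, h6⟩ := exists_angular_isotopy hn hβ hN hNβ hper happ
  obtain ⟨F, f1, f2, f3, f4, f5⟩ := exists_polar_map hn h1 h2 h4
  refine ⟨F, f1, f2, ?_, ?_, ?_⟩
  · intro z hz
    have hz1 : ‖z‖ = 1 := by simpa using hz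
    obtain ⟨t, ht⟩ := Complex.norm_eq_one_iff z |>.1 hz1
    rw [← ht, mul_comm, f3, hGβ, h3]
  · intro z hz
    have hz1 : ‖z‖ < 1 := by simpa using hz
    by_cases hz0 : z = 0
    · have : F =ᶠ[𝓝 z] id := by
        have h1 : ∀ᶠ w : ℂ in 𝓝 z, ‖w‖ < 1 / 2 :=
          continuous_norm.continuousAt.eventually (gt_mem_nhds (by rw [hz0]; norm_num))
        filter_upwards [h1] with w hw using f4 w hw.le
      exact (RegAt.of_analyticAt analyticAt_id (by simp)).congr this
    · have hlt : Real.exp (Complex.log z).re < 1 := by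
        rwa [← Complex.norm_exp, Complex.exp_log hz0]
      have := f5 (Complex.log z) ?_ (h5 _ hlt _).2.ne'
      · rwa [Complex.exp_log hz0] at this
      · have : ∀ᶠ q : ℝ × ℝ in 𝓝 (Real.exp (Complex.log z).re, (Complex.log z).im), q.1 < 1 :=
          continuousAt_fst.eventually (gt_mem_nhds hlt)
        filter_upwards [this] with q hq using (h5 q.1 hq q.2).1
  · intro s hs hs1
    obtain ⟨t, ht⟩ := Complex.norm_eq_one_iff s |>.1 hs1
    have hst : Complex.exp (Complex.I * t) = s := by rw [← ht, mul_comm]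
    have htN : t ∈ N := hSN t (by rw [hst]; exact hs)
    have := f5 (Complex.I * t) ?_ ?_
    · rwa [hst] at this
    · have : ∀ᶠ q : ℝ × ℝ in 𝓝 (Real.exp (Complex.I * t).re, (Complex.I * (t : ℂ)).im), q.2 ∈ N :=
        continuousAt_snd.eventually (hN.mem_nhds (by simpa using htN))
      filter_upwards [this] with q hq using h6 q.1 q.2 hq
    · have e1 : Real.exp (Complex.I * (t : ℂ)).re = 1 := by simp
      have e2 : (Complex.I * (t : ℂ)).im = t := by simp
      rw [e1, e2, show α 1 = β from funext h3]
      exact (harg t (by rw [hst]; exact hreg s hs)).2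

open Metric Filter Topology in
/-- A homeomorphism of the circle extends to the disc, preserving the radius, with all the
regularity that one can expect. -/
theorem exists_radial_extension {n : ℕ∞} (hn : 1 ≤ n) {G : ℂ → ℂ}
    (hc : ContinuousOn G (sphere 0 1)) (hm : MapsTo G (sphere 0 1) (sphere 0 1))
    (hi : InjOn G (sphere 0 1)) {S : Set ℂ} (hS : IsCompact S)
    (hreg : ∀ s ∈ S, ∃ g, RegAt n g s ∧ ∀ᶠ z in 𝓝 s, ‖z‖ = 1 → G z = g z) :
    ∃ F : ℂ → ℂ, Continuous F ∧ (∀ z, ‖F z‖ = ‖z‖) ∧ (∀ z ∈ sphere (0 : ℂ) 1, F z = G z) ∧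
      (∀ z ∈ ball (0 : ℂ) 1, RegAt n F z) ∧ ∀ s ∈ S, ‖s‖ = 1 → RegAt n F s := by
  have hn1 : (1 : WithTop ℕ∞) ≤ n := by exact_mod_cast hn
  obtain ⟨β, hβ, hGβ, ⟨h1, h2⟩ | ⟨h1, h2⟩⟩ := exists_strictMono_arg hc hm hi
  · exact exists_radial_extension_of_strictMono hn hβ hGβ h1 h2 hS hreg
  · obtain ⟨F, f1, f2, f3, f4, f5⟩ := exists_radial_extension_of_strictMono hn
      (G := fun z => starRingEnd ℂ (G z)) (β := fun t => - β t) hβ.neg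
      (fun t => by
        simp only [hGβ]
        rw [← Complex.exp_conj]; simp) (fun x y hxy => neg_lt_neg (h1 hxy))
      (fun t => by simp only [h2]; ring) hS (fun s hs => by
        obtain ⟨g, h3, h4⟩ := hreg s hs
        refine ⟨fun z => starRingEnd ℂ (g z), RegAt.comp hn1 (regAt_conj n _) h3, ?_⟩
        filter_upwards [h4] with z hz hz1
        rw [hz hz1])
    refine ⟨fun z => starRingEnd ℂ (F z), Complex.continuous_conj.comp f1, fun z => by simp [f2],
      fun z hz => by simp only [f3 z hz]; simp,
      fun z hz => RegAt.comp hn1 (regAt_conj n _) (f4 z hz),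
      fun s hs hs1 => RegAt.comp hn1 (regAt_conj n _) (f5 s hs hs1)⟩

open Filter Topology in
/-- A cutoff function on the half-line with arbitrarily small logarithmic derivative. -/
theorem exists_log_cutoff {c δ : ℝ} (hc : 0 < c) (hδ : 0 < δ) :
    ∃ φ : ℝ → ℝ, (∀ (n : ℕ∞), ∀ u > 0, ContDiffAt ℝ n φ u) ∧ (∀ u, φ u ∈ Icc (0 : ℝ) 1) ∧
      (∀ u ≥ δ, φ u = 0) ∧ (∃ η > 0, ∀ u > 0, u < η → φ u = 1) ∧
      ∀ u > 0, u * |deriv φ u| ≤ c := by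
  obtain ⟨B, hB⟩ : ∃ B, ∀ x, |deriv Real.smoothTransition x| ≤ B := by
    have hcd : Continuous (deriv Real.smoothTransition) :=
      (Real.smoothTransition.contDiff (n := 1)).continuous_deriv le_rfl
    obtain ⟨B, hB⟩ := isCompact_Icc.exists_bound_of_continuousOn
      (s := Icc (0 : ℝ) 1) hcd.continuousOn
    refine ⟨max B 0, fun x => ?_⟩
    by_cases hx : x ∈ Icc (0 : ℝ) 1
    · exact (hB x hx).trans (le_max_left _ _)
    · have : deriv Real.smoothTransition x = 0 := by
        rw [mem_Icc, not_and_or, not_le, not_le] at hx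
        rcases hx with hx | hx
        · have : Real.smoothTransition =ᶠ[𝓝 x] fun _ => 0 := by
            filter_upwards [gt_mem_nhds hx] with y hy
            exact Real.smoothTransition.zero_of_nonpos hy.le
          rw [this.deriv_eq]; simp
        · have : Real.smoothTransition =ᶠ[𝓝 x] fun _ => 1 := by
            filter_upwards [lt_mem_nhds hx] with y hy
            exact Real.smoothTransition.one_of_one_le hy.le
          rw [this.deriv_eq]; simp
      rw [this]; simp
  have hB0 : 0 ≤ B := (abs_nonneg _).trans (hB 0)
  set a : ℝ := c / (B + 1) with ha
  have ha0 : 0 < a := by positivity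
  have haB : a * B ≤ c := by
    rw [ha, div_mul_eq_mul_div, div_le_iff₀ (by positivity)]
    nlinarith
  refine ⟨fun u => Real.smoothTransition (a * (Real.log δ - Real.log u)), ?_, ?_, ?_, ?_, ?_⟩
  · intro n u hu
    exact Real.smoothTransition.contDiff.contDiffAt.comp u
      (contDiffAt_const.mul (contDiffAt_const.sub (Real.contDiffAt_log.2 hu.ne')))
  · intro u
    exact ⟨Real.smoothTransition.nonneg _, Real.smoothTransition.le_one _⟩
  · intro u hu
    refine Real.smoothTransition.zero_of_nonpos ?_
    have := Real.log_le_log hδ hu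
    nlinarith
  · refine ⟨δ * Real.exp (-(1 / a)), by positivity, fun u hu hu2 => ?_⟩
    refine Real.smoothTransition.one_of_one_le ?_
    have h1 := Real.log_lt_log hu hu2
    rw [Real.log_mul hδ.ne' (Real.exp_ne_zero _), Real.log_exp] at h1
    have h2 : 1 / a < Real.log δ - Real.log u := by linarith
    rw [div_lt_iff₀ ha0] at h2
    linarith
  · intro u hu
    have h1 : HasDerivAt (fun u => a * (Real.log δ - Real.log u)) (a * (- u⁻¹)) u := by
      have := (((Real.hasDerivAt_log hu.ne').const_sub (Real.log δ)).const_mul a)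
      simpa using this
    have h2 := (((Real.smoothTransition.contDiff (n := 1)).differentiable one_ne_zero)
      (a * (Real.log δ - Real.log u))).hasDerivAt.comp u h1
    have h3 : deriv (fun u => Real.smoothTransition (a * (Real.log δ - Real.log u))) u = _ :=
      h2.deriv
    rw [h3, abs_mul, abs_mul, abs_neg, abs_inv, abs_of_pos ha0, abs_of_pos hu]
    have : u * (|deriv Real.smoothTransition (a * (Real.log δ - Real.log u))| * (a * u⁻¹)) =
        a * |deriv Real.smoothTransition (a * (Real.log δ - Real.log u))| := by
      field_simp
    rw [this]
    exact (mul_le_mul_of_nonneg_left (hB _) ha0.le).trans haB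

theorem det_eq_of_norm_eq_one (L : ℂ →L[ℝ] ℂ) {s : ℂ} (hs : ‖s‖ = 1) :
    L.det = (L s).re * (L (Complex.I * s)).im - (L s).im * (L (Complex.I * s)).re := by
  have h1 : L s = s.re • L 1 + s.im • L Complex.I := by
    rw [← map_smul, ← map_smul, ← map_add]; congr 1
    apply Complex.ext <;> simp
  have h2 : L (Complex.I * s) = (-s.im) • L 1 + s.re • L Complex.I := by
    rw [← map_smul, ← map_smul, ← map_add]; congr 1
    apply Complex.ext <;> simp
  have h3 : s.re * s.re + s.im * s.im = 1 := by
    rw [← Complex.normSq_apply, Complex.normSq_eq_norm_sq, hs]; norm_num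
  rw [det_eq_of_complex, h1, h2]
  simp only [Complex.add_re, Complex.add_im, Complex.smul_re, Complex.smul_im, smul_eq_mul]
  linear_combination (-((L 1).re * (L Complex.I).im - (L 1).im * (L Complex.I).re)) * h3

theorem det_ne_zero_of_segment {A B : ℂ →L[ℝ] ℂ} {s p : ℂ} (hs : ‖s‖ = 1) {κ : ℝ}
    (hA : A (Complex.I * s) = κ * (Complex.I * p)) (hB : B (Complex.I * s) = κ * (Complex.I * p))
    (hA0 : 0 ≤ inner ℝ p (A s)) (hB0 : 0 ≤ inner ℝ p (B s)) (hAd : A.det ≠ 0) (hBd : B.det ≠ 0)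
    {l : ℝ} (hl : l ∈ Icc (0 : ℝ) 1) : ((1 - l) • A + l • B).det ≠ 0 := by
  have hL : ∀ L : ℂ →L[ℝ] ℂ, L (Complex.I * s) = κ * (Complex.I * p) →
      L.det = κ * inner ℝ p (L s) := by
    intro L h
    rw [det_eq_of_norm_eq_one L hs, h, Complex.inner]
    simp
    ring
  have hC : ((1 - l) • A + l • B) (Complex.I * s) = κ * (Complex.I * p) := by
    simp only [add_apply, smul_apply, hA, hB]
    rw [← add_smul]; simp
  rw [hL _ hC]
  rw [hL _ hA] at hAd
  rw [hL _ hB] at hBd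
  have h1 : 0 < inner ℝ p (A s) := hA0.lt_of_ne (right_ne_zero_of_mul hAd).symm
  have h2 : 0 < inner ℝ p (B s) := hB0.lt_of_ne (right_ne_zero_of_mul hBd).symm
  refine mul_ne_zero (left_ne_zero_of_mul hAd) (ne_of_gt ?_)
  simp only [add_apply, smul_apply, inner_add_right,
    inner_smul_right]
  rcases hl.1.eq_or_lt with h | h
  · rw [← h]; simpa using h1
  · have := mul_nonneg (sub_nonneg.2 hl.2) h1.le
    have := mul_pos h h2
    linarith

open Metric Filter Topology in
theorem inner_fderiv_nonneg_of_norm_le_one {f : ℂ → ℂ} {s : ℂ} (hs : ‖s‖ = 1)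
    (hf : DifferentiableAt ℝ f s) (hfs : ‖f s‖ = 1) (hb : ∀ᶠ z in 𝓝 s, ‖z‖ ≤ 1 → ‖f z‖ ≤ 1) :
    0 ≤ inner ℝ (f s) (fderiv ℝ f s s) := by
  have h1 := hf.hasFDerivAt.norm_sq
  have h2 : IsLocalMaxOn (fun z => ‖f z‖ ^ 2) (closedBall 0 1) s := by
    refine eventually_nhdsWithin_iff.2 ?_
    filter_upwards [hb] with z hz hz1
    have := hz (by simpa using hz1)
    rw [hfs]
    exact pow_le_pow_left₀ (norm_nonneg _) this 2
  have h3 : (-s) ∈ posTangentConeAt (closedBall (0 : ℂ) 1) s :=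
    mem_posTangentConeAt_of_segment_subset ((convex_closedBall _ _).segment_subset
      (by simp [hs]) (by simp))
  have h4 := h2.hasFDerivWithinAt_nonpos h1.hasFDerivWithinAt h3
  rw [map_neg] at h4
  simp only [smul_apply, ContinuousLinearMap.comp_apply,
    innerSL_apply_apply, nsmul_eq_mul] at h4
  push_cast at h4
  linarith

open Filter Topology in
theorem exists_fderiv_tangent_eq {f : ℂ → ℂ} {s : ℂ} (hs : ‖s‖ = 1)
    (hf : DifferentiableAt ℝ f s) (hb : ∀ᶠ z in 𝓝 s, ‖z‖ = 1 → ‖f z‖ = 1) :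
    ∃ κ : ℝ, fderiv ℝ f s (Complex.I * s) = κ * (Complex.I * f s) := by
  set γ : ℝ → ℂ := fun t => s * Complex.exp (Complex.I * t) with hγ
  have hγ0 : γ 0 = s := by simp [hγ]
  have h9 : HasDerivAt γ (Complex.I * s) 0 := by
    have := (((Complex.ofRealCLM.hasDerivAt (x := 0)).const_mul Complex.I).cexp).const_mul s
    simp at this
    rw [mul_comm Complex.I s]
    exact this
  have h1 : HasDerivAt (fun t => f (γ t)) (fderiv ℝ f s (Complex.I * s)) 0 :=
    HasFDerivAt.comp_hasDerivAt_of_eq (f := γ) 0 hf.hasFDerivAt h9 hγ0.symm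
  have h2 := h1.norm_sq
  have h3 : (fun t => ‖f (γ t)‖ ^ 2) =ᶠ[𝓝 0] fun _ => 1 := by
    have hc : Tendsto γ (𝓝 0) (𝓝 s) := by
      have := h9.continuousAt; rwa [ContinuousAt, hγ0] at this
    filter_upwards [hc.eventually hb] with t ht
    rw [ht (by simp [hγ, hs])]; norm_num
  have h4 := h2.unique ((hasDerivAt_const (0 : ℝ) (1 : ℝ)).congr_of_eventuallyEq h3)
  rw [hγ0, Complex.inner] at h4
  have hp : ‖f s‖ = 1 := hb.self_of_nhds hs
  have hp2 : (f s).re * (f s).re + (f s).im * (f s).im = 1 := by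
    rw [← Complex.normSq_apply, Complex.normSq_eq_norm_sq, hp]; norm_num
  set w := fderiv ℝ f s (Complex.I * s)
  simp only [Complex.mul_re, Complex.conj_re, Complex.conj_im] at h4
  refine ⟨-w.re * (f s).im + w.im * (f s).re, Complex.ext ?_ ?_⟩
  · simp
    linear_combination (f s).re / 2 * h4 - w.re * hp2
  · simp
    linear_combination (f s).im / 2 * h4 - w.im * hp2

open Filter Topology in
theorem fderiv_tangent_eq_of_eq {f g : ℂ → ℂ} {s : ℂ} (hs : ‖s‖ = 1)
    (hf : DifferentiableAt ℝ f s) (hg : DifferentiableAt ℝ g s)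
    (heq : ∀ᶠ z in 𝓝 s, ‖z‖ = 1 → g z = f z) :
    fderiv ℝ g s (Complex.I * s) = fderiv ℝ f s (Complex.I * s) := by
  set γ : ℝ → ℂ := fun t => s * Complex.exp (Complex.I * t) with hγ
  have hγ0 : γ 0 = s := by simp [hγ]
  have h9 : HasDerivAt γ (Complex.I * s) 0 := by
    have := (((Complex.ofRealCLM.hasDerivAt (x := 0)).const_mul Complex.I).cexp).const_mul s
    simp at this
    rw [mul_comm Complex.I s]
    exact this
  have h1 : HasDerivAt (fun t => f (γ t)) (fderiv ℝ f s (Complex.I * s)) 0 :=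
    HasFDerivAt.comp_hasDerivAt_of_eq (f := γ) 0 hf.hasFDerivAt h9 hγ0.symm
  have h2 : HasDerivAt (fun t => g (γ t)) (fderiv ℝ g s (Complex.I * s)) 0 :=
    HasFDerivAt.comp_hasDerivAt_of_eq (f := γ) 0 hg.hasFDerivAt h9 hγ0.symm
  have hc : Tendsto γ (𝓝 0) (𝓝 s) := by
    have := h9.continuousAt; rwa [ContinuousAt, hγ0] at this
  refine h2.unique (h1.congr_of_eventuallyEq ?_)
  filter_upwards [hc.eventually heq] with t ht
  exact ht (by simp [hγ, hs])

open Metric Filter Topology in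
/-- Two regular maps agreeing along the unit circle can be interpolated near a boundary
point. -/
theorem exists_crease_bound {n : WithTop ℕ∞} (hn : 1 ≤ n) {f g : ℂ → ℂ} {s : ℂ} (hs : ‖s‖ = 1)
    (hf : RegAt n f s) (hg : RegAt n g s) (heq : ∀ᶠ z in 𝓝 s, ‖z‖ = 1 → g z = f z)
    (hsph : ∀ᶠ z in 𝓝 s, ‖z‖ = 1 → ‖f z‖ = 1)
    (hfb : ∀ᶠ z in 𝓝 s, ‖z‖ ≤ 1 → ‖f z‖ ≤ 1) (hgb : ∀ᶠ z in 𝓝 s, ‖z‖ ≤ 1 → ‖g z‖ ≤ 1) :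
    ∃ c > 0, ∀ᶠ z in 𝓝 s, ‖z‖ < 1 → ∀ l ∈ Icc (0 : ℝ) 1, ∀ m : ℂ →L[ℝ] ℝ,
      ‖m‖ * (1 - ‖z‖) < c →
        ((1 - l) • fderiv ℝ f z + l • fderiv ℝ g z + m.smulRight (g z - f z)).det ≠ 0 := by
  have hn0 : n ≠ 0 := by intro h; simp [h] at hn
  have hfd := hf.contDiffAt.differentiableAt hn0
  have hgd := hg.contDiffAt.differentiableAt hn0
  have hgs : g s = f s := heq.self_of_nhds hs
  obtain ⟨κ, hκ⟩ := exists_fderiv_tangent_eq hs hfd hsph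
  have hκ' : fderiv ℝ g s (Complex.I * s) = κ * (Complex.I * f s) :=
    (fderiv_tangent_eq_of_eq hs hfd hgd heq).trans hκ
  have hfs : ‖f s‖ = 1 := hsph.self_of_nhds hs
  have h1 := inner_fderiv_nonneg_of_norm_le_one hs hfd hfs hfb
  have h2 := inner_fderiv_nonneg_of_norm_le_one hs hgd (hgs ▸ hfs) hgb
  rw [hgs] at h2
  set A := fderiv ℝ f s
  set B := fderiv ℝ g s
  have hcont : Continuous fun l : ℝ => (1 - l) • A + l • B := by fun_prop
  obtain ⟨δ, hδ, hsub⟩ := (isCompact_Icc.image hcont).exists_thickening_subset_open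
    (t := {L : ℂ →L[ℝ] ℂ | L.det ≠ 0})
    (isOpen_ne_fun ContinuousLinearMap.continuous_det continuous_const)
    (by
      rintro _ ⟨l, hl, rfl⟩
      exact det_ne_zero_of_segment hs hκ hκ' h1 h2 hf.2 hg.2 hl)
  have hsub' := (hg.hasStrictFDerivAt hn).sub (hf.hasStrictFDerivAt hn)
  obtain ⟨L, W, hW, hL⟩ := hsub'.exists_lipschitzOnWith
  have hret : Tendsto (fun z : ℂ => (‖z‖⁻¹ : ℝ) • z) (𝓝 s) (𝓝 s) := by
    have : ContinuousAt (fun z : ℂ => (‖z‖⁻¹ : ℝ) • z) s :=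
      (continuous_norm.continuousAt.inv₀ (by simp [hs])).smul continuousAt_id
    rw [ContinuousAt, hs] at this
    simpa using this
  have hfc : Tendsto (fderiv ℝ f) (𝓝 s) (𝓝 A) :=
    (hf.contDiffAt.fderiv_right (m := 0) (by simpa using hn)).continuousAt
  have hgc : Tendsto (fderiv ℝ g) (𝓝 s) (𝓝 B) :=
    (hg.contDiffAt.fderiv_right (m := 0) (by simpa using hn)).continuousAt
  have hne : ∀ᶠ z : ℂ in 𝓝 s, z ≠ 0 :=
    eventually_ne_nhds (by intro h; simp [h] at hs)
  refine ⟨δ / 3 / (L + 1), by positivity, ?_⟩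
  filter_upwards [hW, hret hW, hret.eventually heq, hne,
    hfc (ball_mem_nhds A (by positivity : 0 < δ / 3)),
    hgc (ball_mem_nhds B (by positivity : 0 < δ / 3))] with z hz hz' hze hz0 hzA hzB hz1 l hl m hm
  apply hsub
  rw [mem_thickening_iff]
  refine ⟨_, mem_image_of_mem _ hl, ?_⟩
  have hnz : ‖((‖z‖⁻¹ : ℝ) • z)‖ = 1 := by
    rw [norm_smul, norm_inv, norm_norm, inv_mul_cancel₀ (norm_ne_zero_iff.2 hz0)]
  have h3 : ‖g z - f z‖ ≤ L * (1 - ‖z‖) := by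
    have := hL.dist_le_mul z hz _ hz'
    simp only [Pi.sub_apply, hze hnz, sub_self, dist_zero_right] at this
    refine this.trans (le_of_eq ?_)
    congr 1
    have : z - (‖z‖⁻¹ : ℝ) • z = (1 - ‖z‖⁻¹ : ℝ) • z := by rw [sub_smul, one_smul]
    rw [dist_eq_norm, this, norm_smul, Real.norm_eq_abs, abs_sub_comm, abs_of_nonneg]
    · rw [sub_mul, inv_mul_cancel₀ (norm_ne_zero_iff.2 hz0), one_mul]
    · rw [sub_nonneg]
      exact (one_le_inv₀ (norm_pos_iff.2 hz0)).2 hz1.le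
  have h4 : ‖m.smulRight (g z - f z)‖ < δ / 3 := by
    rw [ContinuousLinearMap.norm_smulRight_apply]
    rw [lt_div_iff₀ (by positivity)] at hm
    have h5 := mul_le_mul_of_nonneg_left h3 (norm_nonneg m)
    have h6 := mul_nonneg (norm_nonneg m) (sub_nonneg.2 hz1.le)
    nlinarith
  rw [mem_preimage, mem_ball, dist_eq_norm] at hzA hzB
  have h5 : (1 - l) • fderiv ℝ f z + l • fderiv ℝ g z + m.smulRight (g z - f z) -
      ((1 - l) • A + l • B) = (1 - l) • (fderiv ℝ f z - A) + l • (fderiv ℝ g z - B) +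
        m.smulRight (g z - f z) := by
    simp only [smul_sub]; abel
  rw [dist_eq_norm, h5]
  have h6 := norm_add₃_le (a := (1 - l) • (fderiv ℝ f z - A)) (b := l • (fderiv ℝ g z - B))
    (c := m.smulRight (g z - f z))
  rw [norm_smul, norm_smul, Real.norm_eq_abs, Real.norm_eq_abs, abs_of_nonneg hl.1,
    abs_of_nonneg (sub_nonneg.2 hl.2)] at h6
  nlinarith [mul_le_mul_of_nonneg_left hzA.le (sub_nonneg.2 hl.2),
    mul_le_mul_of_nonneg_left hzB.le hl.1]

open Metric Filter Topology in
theorem exists_uniform_crease_bound {n : ℕ∞} (hn : 1 ≤ n) {F G : ℂ → ℂ} {S : Set ℂ}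
    (hFn : ∀ z, ‖F z‖ = ‖z‖) (hFS : ∀ s ∈ S, RegAt n F s)
    (hGb : MapsTo G (ball 0 1) (ball 0 1)) (hFG : ∀ z ∈ sphere (0 : ℂ) 1, F z = G z)
    (hS : IsCompact S) (hSs : S ⊆ sphere 0 1)
    (hreg : ∀ s ∈ S, ∃ g, RegAt n g s ∧ ∀ᶠ z in 𝓝 s, z ∈ closedBall (0 : ℂ) 1 → G z = g z) :
    ∃ c > 0, ∃ W, IsOpen W ∧ S ⊆ W ∧ ∀ z ∈ W, ‖z‖ < 1 →
      (∀ᶠ w in 𝓝 z, ContDiffAt ℝ n G w) ∧ ∀ l ∈ Icc (0 : ℝ) 1, ∀ m : ℂ →L[ℝ] ℝ,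
      ‖m‖ * (1 - ‖z‖) < c →
        ((1 - l) • fderiv ℝ F z + l • fderiv ℝ G z + m.smulRight (G z - F z)).det ≠ 0 := by
  have hn1 : (1 : WithTop ℕ∞) ≤ n := by exact_mod_cast hn
  set P : ℝ → ℂ → Prop := fun c z => ‖z‖ < 1 →
      (∀ᶠ w in 𝓝 z, ContDiffAt ℝ n G w) ∧ ∀ l ∈ Icc (0 : ℝ) 1, ∀ m : ℂ →L[ℝ] ℝ,
      ‖m‖ * (1 - ‖z‖) < c →
        ((1 - l) • fderiv ℝ F z + l • fderiv ℝ G z + m.smulRight (G z - F z)).det ≠ 0 with hP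
  have hPm : ∀ c c' z, c' ≤ c → P c z → P c' z := fun c c' z h hp hz =>
    ⟨(hp hz).1, fun l hl m hm => (hp hz).2 l hl m (hm.trans_le h)⟩
  suffices H : ∃ c > 0, ∃ W, IsOpen W ∧ S ⊆ W ∧ ∀ z ∈ W, P c z from H
  have hGle : ∀ z, ‖z‖ ≤ 1 → ‖G z‖ ≤ 1 := by
    intro z hz
    rcases hz.lt_or_eq with h | h
    · have := hGb (show z ∈ ball 0 1 by simpa using h)
      simp at this; exact this.le
    · rw [← hFG z (by simpa using h), hFn, h]
  refine hS.induction_on (p := fun S => ∃ c > 0, ∃ W, IsOpen W ∧ S ⊆ W ∧ ∀ z ∈ W, P c z)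
    ⟨1, one_pos, ∅, isOpen_empty, subset_rfl, fun z hz => absurd hz (notMem_empty z)⟩ ?_ ?_ ?_
  · rintro A B hAB ⟨c, hc, W, h1, h2, h3⟩
    exact ⟨c, hc, W, h1, hAB.trans h2, h3⟩
  · rintro A B ⟨c, hc, W, h1, h2, h3⟩ ⟨c', hc', W', h1', h2', h3'⟩
    refine ⟨min c c', lt_min hc hc', W ∪ W', h1.union h1', union_subset_union h2 h2', ?_⟩
    rintro z (hz | hz)
    · exact hPm _ _ _ (min_le_left _ _) (h3 z hz)
    · exact hPm _ _ _ (min_le_right _ _) (h3' z hz)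
  · intro s hs
    obtain ⟨g, hg, hGg⟩ := hreg s hs
    have hs1 : ‖s‖ = 1 := by simpa using hSs hs
    obtain ⟨c, hc, H⟩ := exists_crease_bound hn1 hs1 (hFS s hs) hg (by
        filter_upwards [hGg] with z hz hz1
        rw [← hz (by simp [hz1]), hFG z (by simpa using hz1)])
      (Eventually.of_forall fun z hz => by rw [hFn, hz])
      (Eventually.of_forall fun z hz => by rwa [hFn])
      (by
        filter_upwards [hGg] with z hz hz1
        rw [← hz (by simpa using hz1)]
        exact hGle z hz1)
    have H2 : ∀ᶠ z in 𝓝 s, P c z := by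
      filter_upwards [H, hGg.eventually_nhds, hg.1.eventually_nhds] with z h1 h2 h3 hz
      have h4 : G =ᶠ[𝓝 z] g := by
        have : ∀ᶠ w : ℂ in 𝓝 z, ‖w‖ < 1 := continuous_norm.continuousAt.eventually (gt_mem_nhds hz)
        filter_upwards [h2, this] with w hw hw1
        exact hw (by simpa using hw1.le)
      refine ⟨?_, ?_⟩
      · filter_upwards [h4.eventuallyEq_nhds, h3] with w hw1 hw2
        exact hw2.congr_of_eventuallyEq hw1
      · rw [h4.fderiv_eq, h4.self_of_nhds]
        exact h1 hz
    obtain ⟨W, hW1, hW2, hW3⟩ := _root_.eventually_nhds_iff.1 H2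
    exact ⟨W, mem_nhdsWithin_of_mem_nhds (hW2.mem_nhds hW3), c, hc, W, hW2, subset_rfl, hW1⟩

open Metric Filter Topology in
theorem exists_disc_interpolation {n : ℕ∞} (hn : 1 ≤ n) {F₀ G : ℂ → ℂ} {S : Set ℂ}
    (hF : Continuous F₀) (hFn : ∀ z, ‖F₀ z‖ = ‖z‖) (hFd : ∀ z ∈ ball (0 : ℂ) 1, RegAt n F₀ z)
    (hFS : ∀ s ∈ S, RegAt n F₀ s)
    (hG : ContinuousOn G (closedBall 0 1)) (hGb : MapsTo G (ball 0 1) (ball 0 1))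
    (hFG : ∀ z ∈ sphere (0 : ℂ) 1, F₀ z = G z)
    (hS : IsCompact S) (hSs : S ⊆ sphere 0 1)
    (hreg : ∀ s ∈ S, ∃ g, RegAt n g s ∧ ∀ᶠ z in 𝓝 s, z ∈ closedBall (0 : ℂ) 1 → G z = g z) :
    ∃ F : ℂ → ℂ, ContinuousOn F (closedBall 0 1) ∧ (∀ z ∈ sphere (0 : ℂ) 1, F z = G z) ∧
      BijOn F (ball 0 1) (ball 0 1) ∧ (∀ z ∈ ball (0 : ℂ) 1, RegAt n F z) ∧
      ∀ s ∈ S, ∀ᶠ z in 𝓝 s, z ∈ closedBall (0 : ℂ) 1 → F z = G z := by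
  have hn1 : (1 : WithTop ℕ∞) ≤ n := by exact_mod_cast hn
  have hn0 : (n : WithTop ℕ∞) ≠ 0 := by intro h; simp [h] at hn1
  obtain ⟨c, hc, W, hW, hSW, hWP⟩ := exists_uniform_crease_bound hn hFn hFS hGb hFG hS hSs hreg
  obtain ⟨X, hX1, hX2, hX3, hX4⟩ := exists_contDiff_cutoff hS.isClosed hW hSW
  obtain ⟨C, hC⟩ := (isCompact_closedBall (0 : ℂ) 1).exists_bound_of_continuousOn
    ((hX1 1).continuous_fderiv one_ne_zero).continuousOn
  have hC0 : 0 ≤ C := (norm_nonneg _).trans (hC 0 (by simp))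
  -- the difference is small near the circle
  obtain ⟨δ₀, hδ₀, hδ₀'⟩ : ∃ δ₀ > 0, ∀ z : ℂ, ‖z‖ ≤ 1 → 1 - ‖z‖ < δ₀ → ‖G z - F₀ z‖ < 1 / 2 := by
    have huc := (isCompact_closedBall (0 : ℂ) 1).uniformContinuousOn_of_continuous
      (hG.sub hF.continuousOn)
    obtain ⟨d, hd, hd'⟩ := Metric.uniformContinuousOn_iff.1 huc (1 / 2) (by norm_num)
    refine ⟨min d 1, by positivity, fun z hz hz2 => ?_⟩
    have hz0 : ‖z‖ ≠ 0 := by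
      intro h0
      rw [h0, sub_zero] at hz2; exact absurd hz2 (not_lt.2 (min_le_right _ _))
    have hnz : ‖((‖z‖⁻¹ : ℝ) • z)‖ = 1 := by
      rw [norm_smul, norm_inv, norm_norm, inv_mul_cancel₀ hz0]
    have := hd' z (by simpa using hz) ((‖z‖⁻¹ : ℝ) • z) (by rw [mem_closedBall_zero_iff, hnz]) (by
      have : z - (‖z‖⁻¹ : ℝ) • z = (1 - ‖z‖⁻¹ : ℝ) • z := by rw [sub_smul, one_smul]
      rw [dist_eq_norm, this, norm_smul, Real.norm_eq_abs, abs_sub_comm, abs_of_nonneg]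
      · rw [sub_mul, inv_mul_cancel₀ hz0, one_mul]
        exact hz2.trans_le (min_le_left _ _)
      · rw [sub_nonneg]
        exact (one_le_inv₀ ((norm_nonneg z).lt_of_ne' hz0)).2 hz)
    simp only [Pi.sub_apply] at this
    rwa [hFG ((‖z‖⁻¹ : ℝ) • z) (by rw [mem_sphere_zero_iff_norm, hnz]), sub_self,
      dist_zero_right] at this
  set δ := min (min δ₀ (1 / 2)) (c / (4 * (C + 1))) with hδ
  have hδpos : 0 < δ := by positivity
  obtain ⟨φ, hφ1, hφ2, hφ3, ⟨η, hη, hφ4⟩, hφ5⟩ := exists_log_cutoff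
    (show 0 < c / 8 by positivity) hδpos
  set u : ℂ → ℝ := fun z => 1 - ‖z‖ ^ 2 with hu
  have hucd : ContDiff ℝ n u := contDiff_const.sub (contDiff_norm_sq ℝ)
  have hupos : ∀ z ∈ ball (0 : ℂ) 1, 0 < u z := by
    intro z hz
    have : ‖z‖ < 1 := by simpa using hz
    simp only [hu]; nlinarith [norm_nonneg z]
  set w : ℂ → ℝ := fun z => X z * φ (u z) with hw
  have hw01 : ∀ z, w z ∈ Icc (0 : ℝ) 1 := fun z =>
    ⟨mul_nonneg (hX4 z).1 (hφ2 _).1, mul_le_one₀ (hX4 z).2 (hφ2 _).1 (hφ2 _).2⟩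
  have hwcd : ∀ z ∈ ball (0 : ℂ) 1, ContDiffAt ℝ n w z := fun z hz =>
    (hX1 n).contDiffAt.mul ((hφ1 n _ (hupos z hz)).comp z hucd.contDiffAt)
  have hwbd : ∀ z ∈ ball (0 : ℂ) 1, ‖fderiv ℝ w z‖ * (1 - ‖z‖) < c := by
    intro z hz
    have hz1 : ‖z‖ < 1 := by simpa using hz
    have h1 : HasFDerivAt X (fderiv ℝ X z) z :=
      ((hX1 1).contDiffAt.differentiableAt one_ne_zero).hasFDerivAt
    have h2 : HasFDerivAt u (-(2 • innerSL ℝ z : ℂ →L[ℝ] ℝ)) z :=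
      ((hasStrictFDerivAt_norm_sq z).hasFDerivAt).const_sub 1
    have h3 : HasDerivAt φ (deriv φ (u z)) (u z) :=
      ((hφ1 1 _ (hupos z hz)).differentiableAt one_ne_zero).hasDerivAt
    have h4 : HasFDerivAt (fun z => φ (u z)) (deriv φ (u z) • (-(2 • innerSL ℝ z : ℂ →L[ℝ] ℝ))) z :=
      h3.comp_hasFDerivAt z h2
    have h5 : HasFDerivAt w _ z := h1.mul h4
    rw [h5.fderiv]
    have h6 : ‖X z • deriv φ (u z) • (-(2 • innerSL ℝ z : ℂ →L[ℝ] ℝ)) + φ (u z) • fderiv ℝ X z‖ ≤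
        |deriv φ (u z)| * 2 + φ (u z) * C := by
      refine (norm_add_le _ _).trans (add_le_add ?_ ?_)
      · rw [norm_smul, norm_smul, norm_neg, Real.norm_eq_abs, Real.norm_eq_abs,
          abs_of_nonneg (hX4 z).1]
        have h7 : ‖(2 • innerSL ℝ z : ℂ →L[ℝ] ℝ)‖ ≤ 2 := by
          rw [← Nat.cast_smul_eq_nsmul ℝ, norm_smul, innerSL_apply_norm]
          simp; linarith
        calc X z * (|deriv φ (u z)| * ‖(2 • innerSL ℝ z : ℂ →L[ℝ] ℝ)‖)
            ≤ 1 * (|deriv φ (u z)| * 2) := by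
              apply mul_le_mul (hX4 z).2 _ (by positivity) zero_le_one
              exact mul_le_mul_of_nonneg_left h7 (abs_nonneg _)
          _ = _ := one_mul _
      · rw [norm_smul, Real.norm_eq_abs, abs_of_nonneg (hφ2 _).1]
        exact mul_le_mul_of_nonneg_left (hC z (by simpa using hz1.le)) (hφ2 _).1
    have h7 : 1 - ‖z‖ ≤ u z := by simp only [hu]; nlinarith [norm_nonneg z]
    have h8 : φ (u z) * u z ≤ δ := by
      rcases le_or_gt δ (u z) with h | h
      · rw [hφ3 _ h, zero_mul]; exact hδpos.le
      · nlinarith [(hφ2 (u z)).2, hupos z hz]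
    have h9 : δ * C ≤ c / 4 := by
      have : δ ≤ c / (4 * (C + 1)) := min_le_right _ _
      rw [le_div_iff₀ (by positivity)] at this
      nlinarith
    have h10 := hφ5 (u z) (hupos z hz)
    calc _ ≤ (|deriv φ (u z)| * 2 + φ (u z) * C) * u z := by
          apply mul_le_mul h6 h7 (by linarith)
          exact add_nonneg (by positivity) (mul_nonneg (hφ2 _).1 hC0)
      _ = 2 * (u z * |deriv φ (u z)|) + (φ (u z) * u z) * C := by ring
      _ < c := by nlinarith [mul_le_mul_of_nonneg_right h8 hC0]
  set F : ℂ → ℂ := fun z => F₀ z + w z • (G z - F₀ z) with hFdef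
  have hFsph : ∀ z ∈ sphere (0 : ℂ) 1, F z = G z := by
    intro z hz
    simp only [hFdef, hFG z hz, sub_self, smul_zero, add_zero]
  have hFball : MapsTo F (ball 0 1) (ball 0 1) := by
    intro z hz
    have h1 : F z = (1 - w z) • F₀ z + w z • G z := by
      simp only [hFdef]; rw [sub_smul, one_smul, smul_sub]; abel
    rw [h1]
    exact convex_ball _ _ (by simpa [hFn] using hz) (hGb hz) (sub_nonneg.2 (hw01 z).2) (hw01 z).1
      (by ring)
  have hFreg : ∀ z ∈ ball (0 : ℂ) 1, RegAt n F z := by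
    intro z hz
    by_cases hzW : z ∈ W
    · have hz1 : ‖z‖ < 1 := by simpa using hz
      obtain ⟨h1, h2⟩ := hWP z hzW hz1
      constructor
      · filter_upwards [h1, (hFd z hz).1, isOpen_ball.mem_nhds hz] with y hy1 hy2 hy3
        exact hy2.add ((hwcd y hy3).smul (hy1.sub hy2))
      · have hGd := (h1.self_of_nhds.differentiableAt hn0).hasFDerivAt
        have hFd' := ((hFd z hz).contDiffAt.differentiableAt hn0).hasFDerivAt
        have hwd := ((hwcd z hz).differentiableAt hn0).hasFDerivAt
        have h3 : HasFDerivAt F _ z := hFd'.add (hwd.smul (hGd.sub hFd'))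
        rw [h3.fderiv]
        have := h2 (w z) (hw01 z) (fderiv ℝ w z) (hwbd z hz)
        convert this using 2
        rw [sub_smul, one_smul, smul_sub]; abel
    · refine (hFd z hz).congr ?_
      filter_upwards [hX3.filter_mono (nhds_le_nhdsSet hzW)] with y hy
      simp [hFdef, hw, hy]
  have hFc : ContinuousOn F (closedBall 0 1) := by
    intro z hz
    have hz1 : ‖z‖ ≤ 1 := by simpa using hz
    rcases hz1.lt_or_eq with h | h
    · exact (hFreg z (by simpa using h)).continuousAt.continuousWithinAt
    · have hzs : z ∈ sphere (0 : ℂ) 1 := by simpa using h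
      refine ContinuousWithinAt.add hF.continuousWithinAt ?_
      have h0 : w z • (G z - F₀ z) = 0 := by rw [hFG z hzs, sub_self, smul_zero]
      rw [ContinuousWithinAt, h0]
      have h1 : Tendsto (fun y => ‖G y - F₀ y‖) (𝓝[closedBall 0 1] z) (𝓝 0) := by
        have := ((hG z hz).sub hF.continuousWithinAt).norm
        rw [ContinuousWithinAt] at this
        simpa [hFG z hzs] using this
      refine squeeze_zero_norm (fun y => ?_) h1
      rw [norm_smul, Real.norm_eq_abs, abs_of_nonneg (hw01 y).1]
      exact mul_le_of_le_one_left (norm_nonneg _) (hw01 y).2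
  refine ⟨F, hFc, hFsph, ?_, hFreg, ?_⟩
  · have hF00 : F₀ 0 = 0 := by rw [← norm_eq_zero, hFn, norm_zero]
    have hfar : ∀ z, δ ≤ u z → F z = F₀ z := by
      intro z hz; simp [hFdef, hw, hφ3 _ hz]
    have hδh : δ ≤ 1 / 2 := (min_le_left _ _).trans (min_le_right _ _)
    have hδ0' : δ ≤ δ₀ := (min_le_left _ _).trans (min_le_left _ _)
    have hF0 : F 0 = 0 := by
      rw [hfar 0 (by simp only [hu, norm_zero]; linarith), hF00]
    refine bijOn_of_proper_of_fiber isOpen_ball isOpen_ball (convex_ball _ _).isPreconnected hFball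
      (hFc.mono ball_subset_closedBall) (fun z hz => (hFreg z hz).exists_injOn hn1) ?_
      (mem_ball_self one_pos) ?_
    · intro Q hQ hQc
      have h1 : ball (0 : ℂ) 1 ∩ F ⁻¹' Q = closedBall 0 1 ∩ F ⁻¹' Q := by
        refine Subset.antisymm (inter_subset_inter_left _ ball_subset_closedBall) ?_
        rintro z ⟨hz, hzQ⟩
        refine ⟨?_, hzQ⟩
        have hz1 : ‖z‖ ≤ 1 := by simpa using hz
        rcases hz1.lt_or_eq with h | h
        · simpa using h
        · exfalso
          have h2 := hQ hzQ
          have hzs : z ∈ sphere (0 : ℂ) 1 := by simpa using h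
          rw [hFsph z hzs, ← hFG z hzs, mem_ball_zero_iff, hFn, h] at h2
          exact lt_irrefl _ h2
      rw [h1]
      exact (hFc.preimage_isClosed_of_isClosed isClosed_closedBall hQc.isClosed) |>
        fun h => (isCompact_closedBall (0 : ℂ) 1).of_isClosed_subset h inter_subset_left
    · intro z hz hz0
      rw [hF0] at hz0
      have hz1 : ‖z‖ < 1 := by simpa using hz
      rcases le_or_gt δ (u z) with h | h
      · rw [hfar z h] at hz0
        rw [← norm_eq_zero, ← hFn, hz0, norm_zero]
      · exfalso
        have h1 : 1 - ‖z‖ < δ₀ := by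
          refine lt_of_le_of_lt ?_ (h.trans_le hδ0')
          simp only [hu]; nlinarith [norm_nonneg z]
        have h2 := hδ₀' z hz1.le h1
        have h3 : ‖F₀ z‖ < 1 / 2 := by
          have : F₀ z = - (w z • (G z - F₀ z)) := by
            rw [eq_neg_iff_add_eq_zero]; exact hz0
          rw [this, norm_neg, norm_smul, Real.norm_eq_abs, abs_of_nonneg (hw01 z).1]
          exact (mul_le_of_le_one_left (norm_nonneg _) (hw01 z).2).trans_lt h2
        rw [hFn] at h3
        have h4 : u z < 1 / 2 := h.trans_le hδh
        simp only [hu] at h4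
        nlinarith [norm_nonneg z]
  · intro s hs
    have hs1 : ‖s‖ = 1 := by simpa using hSs hs
    have h1 : ∀ᶠ z in 𝓝 s, u z < η := hucd.continuous.continuousAt.eventually
      (gt_mem_nhds (by simp only [hu, hs1]; simpa using hη))
    filter_upwards [h1, hX2.filter_mono (nhds_le_nhdsSet hs)] with z hz1 hz2 hz3
    have hz4 : ‖z‖ ≤ 1 := by simpa using hz3
    rcases hz4.lt_or_eq with h | h
    · have := hφ4 (u z) (hupos z (by simpa using h)) hz1
      simp [hFdef, hw, hz2, this]
    · exact hFsph z (by simpa using h)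

/-- Every trigonometric polynomial is, up to a constant, the derivative along the circle of a
function analytic off the origin. -/
theorem exists_analytic_primitive_of_mem_span (P : C(AddCircle (2 * Real.pi), ℂ))
    (hP : P ∈ Submodule.span ℂ (range (fourier (T := 2 * Real.pi)))) :
    ∃ η : ℂ → ℂ, (∀ z : ℂ, z ≠ 0 → AnalyticAt ℂ η z) ∧ ∃ c : ℂ, ∀ t : ℝ,
      HasDerivAt (fun s : ℝ => η (Complex.exp (Complex.I * s))) (P t - c) t := by
  induction hP using Submodule.span_induction with
  | mem P hP =>
    obtain ⟨n, rfl⟩ := hP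
    by_cases hn : n = 0
    · subst hn
      refine ⟨fun _ => 0, fun z _ => analyticAt_const, 1, fun t => ?_⟩
      simpa using hasDerivAt_const t (0 : ℂ)
    · refine ⟨fun z => z ^ n / (Complex.I * n), fun z hz => ?_, 0, fun t => ?_⟩
      · exact (analyticAt_id.zpow hz).div analyticAt_const (by simp [hn])
      · have h0 : ∀ s : ℝ, Complex.exp (Complex.I * s) ^ n = Complex.exp (n * (Complex.I * s)) :=
          fun s => (Complex.exp_int_mul _ _).symm
        have h1 : HasDerivAt (fun s : ℝ => Complex.exp (n * (Complex.I * s)) / (Complex.I * n))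
            (Complex.exp (n * (Complex.I * t)) * (n * (Complex.I * 1)) / (Complex.I * n)) t := by
          have h2 : HasDerivAt (fun s : ℝ => (s : ℂ)) 1 t := Complex.ofRealCLM.hasDerivAt
          exact (((h2.const_mul Complex.I).const_mul (n : ℂ)).cexp).div_const _
        simp only [h0]
        convert h1 using 1
        rw [fourier_coe_apply]
        have : (n : ℂ) ≠ 0 := by exact_mod_cast hn
        have hpi : (Real.pi : ℂ) ≠ 0 := by exact_mod_cast Real.pi_ne_zero
        rw [sub_zero, mul_one, mul_comm (n : ℂ) Complex.I, mul_div_cancel_right₀ _ (by simp [hn])]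
        congr 1
        push_cast
        field_simp
  | zero => exact ⟨fun _ => 0, fun z _ => analyticAt_const, 0, fun t => by
      simpa using hasDerivAt_const t (0 : ℂ)⟩
  | add P Q _ _ hP hQ =>
    obtain ⟨η, hη, c, hc⟩ := hP
    obtain ⟨η', hη', c', hc'⟩ := hQ
    refine ⟨fun z => η z + η' z, fun z hz => (hη z hz).add (hη' z hz), c + c', fun t => ?_⟩
    refine ((hc t).add (hc' t)).congr_deriv ?_
    rw [ContinuousMap.coe_add, Pi.add_apply]; ring
  | smul a P _ hP =>
    obtain ⟨η, hη, c, hc⟩ := hP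
    refine ⟨fun z => a * η z, fun z hz => analyticAt_const.mul (hη z hz), a * c, fun t => ?_⟩
    refine ((hc t).const_mul a).congr_deriv ?_
    rw [ContinuousMap.coe_smul, Pi.smul_apply, smul_eq_mul]; ring

/-- A `C¹` function on the circle can be approximated in `C¹` by (the restriction of) a function
analytic off the origin. -/
theorem exists_analytic_circle_approx {k k' : ℝ → ℂ} (hk : ∀ t, HasDerivAt k (k' t) t)
    (hk' : Continuous k') (hper : Function.Periodic k (2 * Real.pi)) {ε : ℝ} (hε : 0 < ε) :
    ∃ η : ℂ → ℂ, (∀ z : ℂ, z ≠ 0 → AnalyticAt ℂ η z) ∧ ∀ t ∈ Icc (-Real.pi) Real.pi,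
      ‖η (Complex.exp (Complex.I * t)) - k t‖ ≤ ε ∧
      ∃ d, HasDerivAt (fun s : ℝ => η (Complex.exp (Complex.I * s))) d t ∧ ‖d - k' t‖ ≤ ε := by
  have : Fact (0 < 2 * Real.pi) := ⟨Real.two_pi_pos⟩
  have hper' : Function.Periodic k' (2 * Real.pi) := by
    intro t
    have h1 : HasDerivAt (fun s => k (s + 2 * Real.pi)) (k' (t + 2 * Real.pi)) t :=
      (hk (t + 2 * Real.pi)).comp_add_const t (2 * Real.pi)
    have h2 : (fun s => k (s + 2 * Real.pi)) = k := funext hper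
    rw [h2] at h1
    exact h1.unique (hk t)
  let f : C(AddCircle (2 * Real.pi), ℂ) :=
    ⟨hper'.lift, continuous_coinduced_dom.2 hk'⟩
  have hf : ∀ t : ℝ, f t = k' t := fun t => hper'.lift_coe t
  have hpi := Real.pi_pos
  obtain ⟨ε', hε', hε1⟩ : ∃ ε' > 0, 2 * ε' * Real.pi ≤ ε ∧ 2 * ε' ≤ ε := by
    refine ⟨ε / (2 * Real.pi + 2), by positivity, ?_, ?_⟩
    · rw [mul_div_assoc', div_mul_eq_mul_div, div_le_iff₀ (by positivity)]; nlinarith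
    · rw [mul_div_assoc', div_le_iff₀ (by positivity)]; nlinarith
  have hcl : f ∈ closure (Submodule.span ℂ (range (fourier (T := 2 * Real.pi))) :
      Set C(AddCircle (2 * Real.pi), ℂ)) := by
    rw [← Submodule.topologicalClosure_coe, span_fourier_closure_eq_top]; trivial
  obtain ⟨P, hP, hPf⟩ := Metric.mem_closure_iff.1 hcl ε' hε'
  have hPk : ∀ t : ℝ, ‖P t - k' t‖ ≤ ε' := by
    intro t
    rw [← hf t, ← dist_eq_norm, dist_comm]
    exact (ContinuousMap.dist_apply_le_dist _).trans hPf.le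
  obtain ⟨η, hη, c, hc⟩ := exists_analytic_primitive_of_mem_span P hP
  have hcb : ‖c‖ ≤ ε' := by
    have h1 : ∀ t : ℝ, HasDerivAt (fun s : ℝ => η (Complex.exp (Complex.I * s)) - k s + c * s)
        (P t - k' t) t := by
      intro t
      have h2 : HasDerivAt (fun s : ℝ => (s : ℂ)) 1 t := Complex.ofRealCLM.hasDerivAt
      exact (((hc t).sub (hk t)).add (h2.const_mul c)).congr_deriv (by ring)
    have h3 := convex_univ.norm_image_sub_le_of_norm_hasDerivWithin_le (C := ε')
      (fun t _ => (h1 t).hasDerivWithinAt) (fun t _ => hPk t) (mem_univ (0 : ℝ))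
      (mem_univ (2 * Real.pi))
    have h4 : Complex.exp (Complex.I * ((2 * Real.pi : ℝ) : ℂ)) = 1 := by
      rw [mul_comm]; push_cast; exact Complex.exp_two_pi_mul_I
    have h5 : k (2 * Real.pi) = k 0 := by simpa using hper 0
    simp only [h4, h5] at h3
    have h6 : η 1 - k 0 + c * ((2 * Real.pi : ℝ) : ℂ)
      - (η (Complex.exp (Complex.I * ((0 : ℝ) : ℂ))) - k 0 + c * ((0 : ℝ) : ℂ))
      = c * ((2 * Real.pi : ℝ) : ℂ) := by simp
    rw [h6, norm_mul, Complex.norm_real, sub_zero] at h3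
    exact le_of_mul_le_mul_right h3 (by rw [Real.norm_eq_abs, abs_of_pos Real.two_pi_pos]; positivity)
  have hder : ∀ t : ℝ, ‖P t - c - k' t‖ ≤ 2 * ε' := by
    intro t
    calc ‖P t - c - k' t‖ = ‖(P t - k' t) - c‖ := by congr 1; ring
      _ ≤ ‖P t - k' t‖ + ‖c‖ := norm_sub_le _ _
      _ ≤ 2 * ε' := by linarith [hPk t]
  refine ⟨fun z => η z - η 1 + k 0, fun z hz => ((hη z hz).sub analyticAt_const).add
    analyticAt_const, fun t ht => ⟨?_, P t - c, ?_, (hder t).trans hε1.2⟩⟩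
  · have h3 := convex_univ.norm_image_sub_le_of_norm_hasDerivWithin_le (C := 2 * ε')
      (fun t _ => ((hc t).sub (hk t)).hasDerivWithinAt) (fun t _ => hder t) (mem_univ (0 : ℝ))
      (mem_univ t)
    have h4 : |t| ≤ Real.pi := abs_le.2 ht
    simp only [sub_zero, Real.norm_eq_abs, Complex.ofReal_zero, mul_zero, Complex.exp_zero,
      Pi.sub_apply] at h3
    calc _ = ‖η (Complex.exp (Complex.I * t)) - k t - (η 1 - k 0)‖ := by congr 1; ring
      _ ≤ 2 * ε' * |t| := h3
      _ ≤ 2 * ε' * Real.pi := by gcongr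
      _ ≤ ε := hε1.1
  · exact ((hc t).sub_const _).add_const _

open Metric Filter Topology in
/-- Composing with the radial projection onto the unit circle. -/
theorem exists_fderiv_radial_comp {n : WithTop ℕ∞} (hn : 1 ≤ n) {e : ℂ → ℂ}
    (he : ∀ z : ℂ, z ≠ 0 → ContDiffAt ℝ n e z)
    {ε : ℝ} (hε : ∀ t ∈ Icc (-Real.pi) Real.pi, ∃ d,
      HasDerivAt (fun s : ℝ => e (Complex.exp (Complex.I * s))) d t ∧ ‖d‖ ≤ ε)
    {z : ℂ} (hz : z ≠ 0) :
    ContDiffAt ℝ n (fun w : ℂ => e (w / ‖w‖)) z ∧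
      ‖fderiv ℝ (fun w : ℂ => e (w / ‖w‖)) z‖ ≤ ε * ‖z‖⁻¹ := by
  have hn0 : n ≠ 0 := by rintro rfl; simp at hn
  have hz' : (‖z‖ : ℂ) ≠ 0 := by simpa using hz
  constructor
  · have h1 : ContDiffAt ℝ n (fun w : ℂ => w / (‖w‖ : ℂ)) z := by
      have h2 : ContDiffAt ℝ n (fun w : ℂ => ‖w‖⁻¹ • w) z :=
        ((contDiffAt_norm ℝ hz).inv (by simpa using hz)).smul contDiffAt_id
      refine h2.congr_of_eventuallyEq (Eventually.of_forall fun w => ?_)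
      simp [Complex.real_smul, div_eq_inv_mul]
    exact ContDiffAt.comp (g := e) (f := fun w : ℂ => w / (‖w‖ : ℂ)) z
      (he _ (div_ne_zero hz hz')) h1
  · obtain ⟨d, hd, hdε⟩ := hε (Complex.arg z)
      ⟨(Complex.neg_pi_lt_arg z).le, Complex.arg_le_pi z⟩
    let θ : ℂ → ℝ := fun w => Complex.arg z + (Complex.log (w / z)).im
    have hθz : θ z = Complex.arg z := by simp [θ, hz]
    have h1 : HasFDerivAt θ (Complex.imCLM.comp
        ((ContinuousLinearMap.toSpanSingleton ℂ z⁻¹).restrictScalars ℝ)) z := by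
      have h2 : HasDerivAt (fun w : ℂ => Complex.log (w / z)) z⁻¹ z := by
        have h3 : HasDerivAt (fun w : ℂ => w / z) (1 / z) z := (hasDerivAt_id z).div_const z
        have h4 := h3.clog (by rw [div_self hz]; exact Complex.one_mem_slitPlane)
        simpa [hz] using h4
      exact (Complex.imCLM.hasFDerivAt.comp z (h2.hasFDerivAt.restrictScalars ℝ)).const_add _
    have h5 : (fun w : ℂ => e (w / ‖w‖)) =ᶠ[𝓝 z]
        fun w => e (Complex.exp (Complex.I * θ w)) := by
      filter_upwards [isOpen_ne.mem_nhds hz] with w hw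
      congr 1
      have hw' : (‖w‖ : ℂ) ≠ 0 := by simpa using hw
      have e1 : Complex.exp (Complex.log (w / z)) = w / z :=
        Complex.exp_log (div_ne_zero hw hz)
      have e2 : Complex.exp (Complex.log z) = z := Complex.exp_log hz
      have e3 : Complex.exp (Complex.log z + Complex.log (w / z)) = w := by
        rw [Complex.exp_add, e1, e2]; field_simp
      have e4 : ((Complex.log z + Complex.log (w / z)).im : ℝ) = θ w := by
        simp [θ, Complex.log_im]
      have e5 : (‖w‖ : ℂ) = Complex.exp ((Complex.log z + Complex.log (w / z)).re : ℂ) := by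
        conv_lhs => rw [← e3]
        rw [Complex.norm_exp]; push_cast; rfl
      have e6 := Complex.re_add_im (Complex.log z + Complex.log (w / z))
      rw [div_eq_iff hw', e5, ← e4, ← Complex.exp_add, mul_comm, add_comm, e6, e3]
    rw [h5.fderiv_eq]
    have h6 : HasFDerivAt (fun w : ℂ => e (Complex.exp (Complex.I * θ w)))
        ((ContinuousLinearMap.toSpanSingleton ℝ d).comp (Complex.imCLM.comp
        ((ContinuousLinearMap.toSpanSingleton ℂ z⁻¹).restrictScalars ℝ))) z := by
      have h7 : HasFDerivAt (fun s : ℝ => e (Complex.exp (Complex.I * s)))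
        (ContinuousLinearMap.toSpanSingleton ℝ d) (θ z) := by rw [hθz]; exact hd.hasFDerivAt
      exact h7.comp z h1
    rw [h6.fderiv]
    have hε0 : 0 ≤ ε := (norm_nonneg d).trans hdε
    refine ContinuousLinearMap.opNorm_le_bound _ (by positivity) fun v => ?_
    simp only [ContinuousLinearMap.comp_apply, ContinuousLinearMap.toSpanSingleton_apply,
      ContinuousLinearMap.coe_restrictScalars', Complex.imCLM_apply, smul_eq_mul, norm_smul]
    calc ‖(v * z⁻¹).im‖ * ‖d‖ ≤ ‖v * z⁻¹‖ * ε := by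
          gcongr; exact Complex.abs_im_le_norm _
      _ = ε * ‖z‖⁻¹ * ‖v‖ := by rw [norm_mul, norm_inv]; ring

open Metric Filter Topology in
/-- A homeomorphism which is regular on `A` can be modified near a compact part of the unit circle
inside `A` so as to be analytic along that part of the circle. -/
theorem exists_analytic_on_circle {n : ℕ∞} (hn : 1 ≤ n) {h : ℂ → ℂ} {U Y A S : Set ℂ} {R : ℝ}
    (hU : IsOpen U) (hY : IsOpen Y) (hh : BijOn h U Y) (hc : ContinuousOn h U)
    (hA : IsOpen A) (hAU : A ⊆ U) (hreg : ∀ z ∈ A, RegAt n h z) (hR : 1 < R)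
    (hS : IsCompact S) (hSA : S ⊆ A) (hSs : S ⊆ sphere 0 1) :
    ∃ g : ℂ → ℂ, ContinuousOn g U ∧ BijOn g U Y ∧ (∀ z, z ∉ ball (0 : ℂ) R → g z = h z) ∧
      (∀ z ∈ A, RegAt n g z) ∧ ∃ η : ℂ → ℂ, (∀ z, z ≠ 0 → AnalyticAt ℂ η z) ∧
        ∀ᶠ z in 𝓝ˢ S, ‖z‖ = 1 → g z = η z := by
  have hn1 : (1 : WithTop ℕ∞) ≤ n := by exact_mod_cast hn
  have hn0 : (n : WithTop ℕ∞) ≠ 0 := by intro h; simp [h] at hn1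
  have hprc : ∀ z : ℂ, z ≠ 0 → ContinuousAt (fun w : ℂ => w / (‖w‖ : ℂ)) z := fun z hz =>
    continuousAt_id.div (by fun_prop) (by simpa using hz)
  have hpr1 : ∀ z : ℂ, ‖z‖ = 1 → z / (‖z‖ : ℂ) = z := fun z hz => by simp [hz]
  have hne : ∀ z : ℂ, ‖z‖ = 1 → z ≠ 0 := fun z hz h0 => by simp [h0] at hz
  -- the cutoff concentrating near `S`
  let W : Set ℂ := A ∩ ball 0 R ∩ ({z | z ≠ 0} ∩ (fun w : ℂ => w / (‖w‖ : ℂ)) ⁻¹' A)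
  have hW : IsOpen W := by
    refine (hA.inter isOpen_ball).inter ?_
    exact ContinuousOn.isOpen_inter_preimage
      (fun z hz => (hprc z hz).continuousWithinAt) isOpen_ne hA
  have hSW : S ⊆ W := by
    intro s hs
    have h1 : ‖s‖ = 1 := by simpa using hSs hs
    refine ⟨⟨hSA hs, by simpa [h1] using hR⟩, hne s h1, ?_⟩
    rw [mem_preimage, hpr1 s h1]; exact hSA hs
  obtain ⟨X, hXs, hX1, hX0, hXI⟩ := exists_contDiff_cutoff hS.isClosed hW hSW
  let C : Set ℂ := tsupport X
  have hCW : C ⊆ W := by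
    intro z hz
    by_contra hzW
    refine (notMem_tsupport_iff_eventuallyEq.2 ?_) hz
    exact hX0.filter_mono (nhds_le_nhdsSet hzW)
  have hC : IsCompact C := by
    refine Metric.isCompact_of_isClosed_isBounded (isClosed_tsupport X) ?_
    exact Metric.isBounded_ball.subset fun z hz => (hCW hz).1.2
  have hCA : C ⊆ A := fun z hz => (hCW hz).1.1
  have hC0 : ∀ z ∈ C, z ≠ 0 := fun z hz => (hCW hz).2.1
  have hSC : S ⊆ C := by
    intro s hs
    have h1 : X s = 1 := (hX1.filter_mono (nhds_le_nhdsSet hs)).self_of_nhds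
    exact subset_tsupport _ (by rw [Function.mem_support, h1]; exact one_ne_zero)
  -- extending `h` smoothly
  obtain ⟨X₂, hX₂s, hX₂1, hX₂0, -⟩ := exists_contDiff_cutoff hS.isClosed hA hSA
  let q : ℂ → ℂ := fun z => (X₂ z : ℂ) * h z
  have hq : ContDiff ℝ n q := by
    refine contDiff_iff_contDiffAt.2 fun z => ?_
    by_cases hz : z ∈ A
    · exact (Complex.ofRealCLM.contDiff.contDiffAt.comp z (hX₂s n).contDiffAt).mul
        (hreg z hz).contDiffAt
    · refine (contDiffAt_const (c := (0 : ℂ))).congr_of_eventuallyEq ?_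
      filter_upwards [hX₂0.filter_mono (nhds_le_nhdsSet hz)] with w hw
      simp [q, hw]
  let c : ℝ → ℂ := fun t => Complex.exp (Complex.I * t)
  have hcd : ∀ t, HasDerivAt c (Complex.I * c t) t := by
    intro t
    have h2 : HasDerivAt (fun s : ℝ => (s : ℂ)) 1 t := Complex.ofRealCLM.hasDerivAt
    refine ((h2.const_mul Complex.I).cexp).congr_deriv ?_
    simp only [c]; ring
  have hcc : Continuous c := by fun_prop
  let k' : ℝ → ℂ := fun t => fderiv ℝ q (c t) (Complex.I * c t)
  have hk : ∀ t, HasDerivAt (fun s => q (c s)) (k' t) t := fun t =>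
    ((hq.differentiable hn0 (c t)).hasFDerivAt).comp_hasDerivAt t (hcd t)
  have hk' : Continuous k' := by
    have := hq.continuous_fderiv hn0
    exact (this.comp hcc).clm_apply (by fun_prop)
  have hper : Function.Periodic (fun s => q (c s)) (2 * Real.pi) := by
    intro t
    have : c (t + 2 * Real.pi) = c t := by
      simp only [c]
      rw [Complex.exp_eq_exp_iff_exists_int]
      exact ⟨1, by push_cast; ring⟩
    simp only [this]
  -- stability constants
  have hhC : ContinuousOn h C := hc.mono (hCA.trans hAU)
  have hYC : h '' C ⊆ Y := by
    rintro _ ⟨z, hz, rfl⟩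
    exact hh.mapsTo (hAU (hCA hz))
  obtain ⟨δ₁, hδ₁, hδY⟩ := (hC.image_of_continuousOn hhC).exists_thickening_subset_open hY hYC
  have hfd : ContinuousOn (fderiv ℝ h) C := fun z hz =>
    ((hreg z (hCA hz)).contDiffAt.continuousAt_fderiv hn0).continuousWithinAt
  have hdo : IsOpen {L : ℂ →L[ℝ] ℂ | L.det ≠ 0} :=
    isOpen_ne_fun ContinuousLinearMap.continuous_det continuous_const
  obtain ⟨δ₂, hδ₂, hδd⟩ := (hC.image_of_continuousOn hfd).exists_thickening_subset_open hdo (by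
    rintro _ ⟨z, hz, rfl⟩; exact (hreg z (hCA hz)).2)
  obtain ⟨B, hB⟩ : ∃ B, ∀ z ∈ C, ‖z‖⁻¹ + ‖fderiv ℝ (fun z => (X z : ℂ)) z‖ ≤ B := by
    have hXc : ContDiff ℝ 1 (fun z => (X z : ℂ)) :=
      Complex.ofRealCLM.contDiff.comp (by exact_mod_cast hXs 1)
    have h1 : ContinuousOn (fun z => ‖z‖⁻¹ + ‖fderiv ℝ (fun z => (X z : ℂ)) z‖) C := by
      refine ContinuousOn.add ?_ ((hXc.continuous_fderiv one_ne_zero).norm.continuousOn)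
      exact continuous_norm.continuousOn.inv₀ fun z hz => by simpa using hC0 z hz
    obtain ⟨B, hB⟩ := (hC.image_of_continuousOn h1).bddAbove
    exact ⟨B, fun z hz => hB (mem_image_of_mem _ hz)⟩
  obtain ⟨ε, hε, hε1, hε2⟩ : ∃ ε > 0, ε < δ₁ ∧ ε * B < δ₂ := by
    refine ⟨min (δ₁ / 2) (δ₂ / (2 * (|B| + 1))), by positivity, ?_, ?_⟩
    · exact (min_le_left _ _).trans_lt (by linarith)
    · have h1 : min (δ₁ / 2) (δ₂ / (2 * (|B| + 1))) * B ≤ δ₂ / (2 * (|B| + 1)) * (|B| + 1) := by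
        refine mul_le_mul_of_nonneg_left ?_ (by positivity) |>.trans
          (mul_le_mul_of_nonneg_right (min_le_right _ _) (by positivity))
        linarith [le_abs_self B]
      have h2 : δ₂ / (2 * (|B| + 1)) * (|B| + 1) = δ₂ / 2 := by field_simp
      linarith
  obtain ⟨η, hη, hηk⟩ := exists_analytic_circle_approx hk hk' hper hε
  let e : ℂ → ℂ := fun z => η z - q z
  let E : ℂ → ℂ := fun w => e (w / (‖w‖ : ℂ))
  have he : ∀ z : ℂ, z ≠ 0 → ContDiffAt ℝ n e z := fun z hz =>
    ((hη z hz).contDiffAt.restrict_scalars ℝ).sub hq.contDiffAt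
  have hEd := fun (z : ℂ) (hz : z ≠ 0) => exists_fderiv_radial_comp hn1 he (ε := ε) (fun t ht => by
    obtain ⟨-, d, hd, hdε⟩ := hηk t ht
    exact ⟨d - k' t, hd.sub (hk t), hdε⟩) hz
  have hEε : ∀ z : ℂ, z ≠ 0 → ‖E z‖ ≤ ε := by
    intro z hz
    have h1 := (hηk (Complex.arg z) ⟨(Complex.neg_pi_lt_arg z).le, Complex.arg_le_pi z⟩).1
    have h2 : z / (‖z‖ : ℂ) = Complex.exp (Complex.I * Complex.arg z) := by
      rw [div_eq_iff (by simpa using hz), mul_comm, mul_comm Complex.I]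
      exact (Complex.norm_mul_exp_arg_mul_I z).symm
    simp only [E, e, h2]
    exact h1
  let g : ℂ → ℂ := fun z => h z + (X z : ℂ) * E z
  have hgC : ∀ z, z ∉ C → g =ᶠ[𝓝 z] h := by
    intro z hz
    filter_upwards [notMem_tsupport_iff_eventuallyEq.1 hz] with w hw
    simp [g, hw]
  have hgA : ∀ z ∈ A, RegAt n g z := by
    intro z hz
    by_cases hzC : z ∈ C
    · have hcd : ∀ y ∈ W, ContDiffAt ℝ n g y := fun y hy =>
        (hreg y hy.1.1).contDiffAt.add
          ((Complex.ofRealCLM.contDiff.contDiffAt.comp y (hXs n).contDiffAt).mul (hEd y hy.2.1).1)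
      refine RegAt.of_isOpen hW (hCW hzC) (fun y hy => (hcd y hy).contDiffWithinAt) ?_
      have hXz : HasFDerivAt (fun z => (X z : ℂ)) (fderiv ℝ (fun z => (X z : ℂ)) z) z :=
        ((Complex.ofRealCLM.contDiff.contDiffAt.comp z
          (hXs n).contDiffAt).differentiableAt hn0).hasFDerivAt
      have hEz := ((hEd z (hC0 z hzC)).1.differentiableAt hn0).hasFDerivAt
      have hhz := ((hreg z hz).contDiffAt.differentiableAt hn0).hasFDerivAt
      have h1 := (hhz.add (hXz.mul hEz)).fderiv
      apply hδd
      refine mem_thickening_iff.2 ⟨_, mem_image_of_mem _ hzC, ?_⟩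
      refine lt_of_le_of_lt ?_ hε2
      rw [dist_eq_norm]
      have h2 : fderiv ℝ g z - fderiv ℝ h z = (X z : ℂ) • fderiv ℝ E z +
          E z • fderiv ℝ (fun z => (X z : ℂ)) z := by
        rw [sub_eq_iff_eq_add']; exact h1
      rw [h2]
      have hX' : ‖(X z : ℂ)‖ ≤ 1 := by
        rw [Complex.norm_real, Real.norm_eq_abs, abs_le]
        exact ⟨by linarith [(hXI z).1], (hXI z).2⟩
      calc _ ≤ ‖(X z : ℂ)‖ * ‖fderiv ℝ E z‖ + ‖E z‖ * ‖fderiv ℝ (fun z => (X z : ℂ)) z‖ := by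
            refine (norm_add_le _ _).trans ?_
            rw [norm_smul, norm_smul]
        _ ≤ 1 * (ε * ‖z‖⁻¹) + ε * ‖fderiv ℝ (fun z => (X z : ℂ)) z‖ := by
            gcongr
            · exact (hEd z (hC0 z hzC)).2
            · exact hEε z (hC0 z hzC)
        _ = ε * (‖z‖⁻¹ + ‖fderiv ℝ (fun z => (X z : ℂ)) z‖) := by ring
        _ ≤ ε * B := by gcongr; exact hB z hzC
    · exact (hreg z hz).congr (hgC z hzC)
  have hgc : ContinuousOn g U := by
    intro z hz
    by_cases hzC : z ∈ C
    · exact (hgA z (hCA hzC)).continuousAt.continuousWithinAt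
    · exact ((hc.continuousAt (hU.mem_nhds hz)).congr (hgC z hzC).symm).continuousWithinAt
  refine ⟨g, hgc, ?_, ?_, hgA, η, hη, ?_⟩
  · refine bijOn_of_eqOn_compl_compact hU hh hc hC (hCA.trans hAU) ?_ hgc ?_ ?_
    · intro z hz
      by_cases hzC : z ∈ C
      · apply hδY
        refine mem_thickening_iff.2 ⟨_, mem_image_of_mem _ hzC, lt_of_le_of_lt ?_ hε1⟩
        rw [dist_eq_norm]
        have hX' : ‖(X z : ℂ)‖ ≤ 1 := by
          rw [Complex.norm_real, Real.norm_eq_abs, abs_le]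
          exact ⟨by linarith [(hXI z).1], (hXI z).2⟩
        simp only [g, add_sub_cancel_left, norm_mul]
        calc _ ≤ 1 * ε := by gcongr; exact hEε z (hC0 z hzC)
          _ = ε := one_mul _
      · rw [(hgC z hzC).self_of_nhds]; exact hh.mapsTo hz
    · intro z hz
      by_cases hzC : z ∈ C
      · exact (hgA z (hCA hzC)).exists_injOn hn1
      · refine ⟨U ∩ Cᶜ, inter_mem (hU.mem_nhds hz)
          ((isClosed_tsupport X).isOpen_compl.mem_nhds hzC), ?_⟩
        intro x hx y hy hxy
        rw [(hgC x hx.2).self_of_nhds, (hgC y hy.2).self_of_nhds] at hxy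
        exact hh.injOn hx.1 hy.1 hxy
    · intro z _ hz; exact (hgC z hz).self_of_nhds
  · intro z hz
    exact (hgC z fun hzC => hz (hCW hzC).1.2).self_of_nhds
  · filter_upwards [hX1, hX₂1] with z h1 h2 hz
    simp [g, h1, E, e, q, h2, hz]

open Metric in
theorem continuousOn_leftInverse_of_isCompact {f g : ℂ → ℂ} {C : Set ℂ} (hC : IsCompact C)
    (hf : ContinuousOn f C) (hinj : InjOn f C) (hg : ∀ x ∈ C, g (f x) = x) :
    ContinuousOn g (f '' C) := by
  refine Metric.continuousOn_iff.2 ?_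
  rintro _ ⟨x, hx, rfl⟩ δ hδ
  obtain ⟨ε, hε, h⟩ := exists_uniform_leftInverse hC hf hinj hδ
  refine ⟨ε, hε, ?_⟩
  rintro _ ⟨y, hy, rfl⟩ hxy
  rw [hg x hx, hg y hy, dist_eq_norm]
  exact h y hy x hx (by rw [← dist_eq_norm]; exact hxy.le)

open Metric Filter Topology in
/-- A homeomorphism which is analytic along part of the unit circle can be made regular inside the
unit disc without changing it near the given part of the circle. -/
theorem exists_regular_on_ball_of_analytic {n : ℕ∞} (hn : 1 ≤ n) {f η : ℂ → ℂ} {U S : Set ℂ}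
    (hU : IsOpen U) (hc : ContinuousOn f U) (hinj : InjOn f U) (hBU : closedBall 0 1 ⊆ U)
    (hS : IsCompact S) (hSs : S ⊆ sphere 0 1) (hreg : ∀ s ∈ S, RegAt n f s)
    (hη : ∀ z, z ≠ 0 → AnalyticAt ℂ η z) (hfη : ∀ᶠ z in 𝓝ˢ S, ‖z‖ = 1 → f z = η z) :
    ∃ g : ℂ → ℂ, ContinuousOn g U ∧ BijOn g U (f '' U) ∧
      (∀ z, z ∉ ball (0 : ℂ) 1 → g z = f z) ∧ (∀ z ∈ ball (0 : ℂ) 1, RegAt n g z) ∧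
      ∀ s ∈ S, g =ᶠ[𝓝 s] f := by
  have hn1 : (1 : WithTop ℕ∞) ≤ n := by exact_mod_cast hn
  have hn0 : (n : WithTop ℕ∞) ≠ 0 := by intro h; simp [h] at hn1
  have hbc := ball_subset_closedBall (x := (0 : ℂ)) (ε := 1)
  have hsc := sphere_subset_closedBall (x := (0 : ℂ)) (ε := 1)
  obtain ⟨ψ, Φ, hψd, hΦc, hΦ, hΦb, hΦs, -, hψΦ⟩ :=
    exists_caratheodory (hc.mono hBU) (hinj.mono hBU)
  have hψc : ContinuousOn ψ (closedBall 0 1) :=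
    (hc.comp hΦc (fun z hz => hBU (hΦ.mapsTo hz))).congr hψΦ
  have hψi : InjOn ψ (closedBall 0 1) := by
    intro x hx y hy hxy
    rw [hψΦ x hx, hψΦ y hy] at hxy
    exact hΦ.injOn hx hy (hinj (hBU (hΦ.mapsTo hx)) (hBU (hΦ.mapsTo hy)) hxy)
  obtain ⟨G, hG⟩ : ∃ G : ℂ → ℂ, InvOn G Φ (closedBall 0 1) (closedBall 0 1) :=
    ⟨_, hΦ.invOn_invFunOn⟩
  have hGΦ : ∀ z ∈ closedBall (0 : ℂ) 1, G (Φ z) = z := fun z hz => hG.1 hz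
  have hΦG : ∀ z ∈ closedBall (0 : ℂ) 1, Φ (G z) = z := fun z hz => hG.2 hz
  have hGc : ContinuousOn G (closedBall 0 1) := by
    have := continuousOn_leftInverse_of_isCompact (isCompact_closedBall (0 : ℂ) 1) hΦc hΦ.injOn hGΦ
    rwa [hΦ.image_eq] at this
  have hGb : MapsTo G (ball 0 1) (ball 0 1) := by
    intro z hz
    obtain ⟨w, hw, rfl⟩ := hΦb.surjOn hz
    rwa [hGΦ w (hbc hw)]
  have hGs : MapsTo G (sphere 0 1) (sphere 0 1) := by
    intro z hz
    obtain ⟨w, hw, rfl⟩ := hΦs.surjOn hz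
    rwa [hGΦ w (hsc hw)]
  have hGi : InjOn G (closedBall 0 1) := fun x hx y hy hxy => by
    rw [← hΦG x hx, ← hΦG y hy, hxy]
  have hψG : ∀ z ∈ closedBall (0 : ℂ) 1, ψ (G z) = f z := by
    intro z hz
    obtain ⟨w, hw, rfl⟩ := hΦ.surjOn hz
    rw [hGΦ w hw, hψΦ w hw]
  -- `G` is regular along `S`
  have hGreg : ∀ s ∈ S, ∃ g, RegAt n g s ∧ ∀ᶠ z in 𝓝 s, z ∈ closedBall (0 : ℂ) 1 → G z = g z := by
    intro s hs
    have hs1 : ‖s‖ = 1 := by simpa using hSs hs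
    have hsB := hsc (hSs hs)
    have hs0 : s ≠ 0 := fun h0 => by simp [h0] at hs1
    have hb1 : ‖G s‖ = 1 := by simpa using hGs (hSs hs)
    have hfs := hfη.filter_mono (nhds_le_nhdsSet hs)
    have hηd : deriv η s ≠ 0 := by
      intro h0
      have hηF : HasFDerivAt η ((ContinuousLinearMap.toSpanSingleton ℂ (deriv η s)).restrictScalars ℝ) s :=
        ((hη s hs0).differentiableAt.hasDerivAt.hasFDerivAt).restrictScalars ℝ
      have h1 := fderiv_tangent_eq_of_eq hs1 hηF.differentiableAt
        ((hreg s hs).contDiffAt.differentiableAt hn0) hfs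
      rw [hηF.fderiv] at h1
      have h2 : fderiv ℝ f s (Complex.I * s) = 0 := by rw [h1]; simp [h0]
      have h3 := eq_zero_of_det_ne_zero (hreg s hs).2 h2
      exact mul_ne_zero Complex.I_ne_zero hs0 h3
    obtain ⟨Ψ, hΨa, hΨd, hΨ⟩ := exists_analytic_extension_of_boundary hs1 hb1 (hη s hs0) hηd hψc hψd
      hψi hΦc hΦs.mapsTo (hΦG s hsB) (by
        filter_upwards [hfs] with s' hs' z hz hzs
        rw [hψΦ z (by simp [hz]), hzs]
        apply hs'
        rw [← hzs]
        simpa using hΦs.mapsTo (show z ∈ sphere (0 : ℂ) 1 by simpa using hz)) (by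
        filter_upwards [hfs] with s' hs' hn' hmem
        rw [← hs' hn'] at hmem
        obtain ⟨z, hz, hzs⟩ := hmem
        rw [hψΦ z (hbc hz)] at hzs
        have h5 := hinj (hBU (hΦ.mapsTo (hbc hz))) (hBU (by simp [hn'])) hzs
        have h6 := hΦb.mapsTo hz
        rw [h5] at h6
        simp [hn'] at h6)
    obtain ⟨L, hLa, hLd, -, hL, -⟩ := exists_analytic_leftInverse hΨa hΨd
    have hΨs : Ψ (G s) = f s := by
      rw [hΨ.self_of_nhds (by simp [hb1]), hψG s hsB]
    rw [hΨs] at hLa hLd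
    refine ⟨fun z => L (f z), RegAt.comp hn1 (RegAt.of_analyticAt hLa hLd) (hreg s hs), ?_⟩
    have h7 : Tendsto G (𝓝[closedBall 0 1] s) (𝓝 (G s)) := hGc s hsB
    rw [← eventually_nhdsWithin_iff]
    filter_upwards [h7.eventually hL, h7.eventually hΨ, self_mem_nhdsWithin] with z h1 h2 hz
    have hGz : G z ∈ closedBall (0 : ℂ) 1 := by
      obtain ⟨w, hw, rfl⟩ := hΦ.surjOn hz
      rwa [hGΦ w hw]
    rw [← hψG z hz, ← h2 hGz, h1]
  obtain ⟨F₀, hF₀c, hF₀n, hF₀s, hF₀b, hF₀S⟩ := exists_radial_extension hn (hGc.mono hsc) hGs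
    (hGi.mono hsc) hS (fun s hs => by
      obtain ⟨g, hg, hev⟩ := hGreg s hs
      exact ⟨g, hg, hev.mono fun z hz h1 => hz (by simp [h1])⟩)
  obtain ⟨F, hFc, hFs, hFb, hFr, hFS⟩ := exists_disc_interpolation hn hF₀c hF₀n hF₀b
    (fun s hs => hF₀S s hs (by simpa using hSs hs)) hGc hGb hF₀s hS hSs hGreg
  have hFB : MapsTo F (closedBall 0 1) (closedBall 0 1) := by
    intro z hz
    rcases (mem_closedBall_zero_iff.1 hz).lt_or_eq with h1 | h1
    · exact hbc (hFb.mapsTo (mem_ball_zero_iff.2 h1))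
    · have h2 := mem_sphere_zero_iff_norm.2 h1
      rw [hFs z h2]; exact hsc (hGs h2)
  classical
  let g : ℂ → ℂ := (closedBall (0 : ℂ) 1).piecewise (fun z => ψ (F z)) f
  have hg1 : ∀ z ∈ closedBall (0 : ℂ) 1, g z = ψ (F z) := fun z hz => piecewise_eq_of_mem _ _ _ hz
  have hg2 : ∀ z, z ∉ ball (0 : ℂ) 1 → g z = f z := by
    intro z hz
    by_cases hz' : z ∈ closedBall (0 : ℂ) 1
    · have hzs : z ∈ sphere (0 : ℂ) 1 := by
        rw [mem_sphere_zero_iff_norm]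
        exact le_antisymm (mem_closedBall_zero_iff.1 hz') (not_lt.1 (by simpa using hz))
      rw [hg1 z hz', hFs z hzs, hψG z hz']
    · exact piecewise_eq_of_notMem _ _ _ hz'
  have hgball : BijOn g (ball 0 1) (f '' ball 0 1) := by
    have h1 : BijOn ψ (ball 0 1) (f '' ball 0 1) := by
      refine ⟨fun z hz => ?_, hψi.mono hbc, ?_⟩
      · rw [hψΦ z (hbc hz)]; exact mem_image_of_mem _ (hΦb.mapsTo hz)
      · rintro _ ⟨w, hw, rfl⟩
        exact ⟨G w, hGb hw, hψG w (hbc hw)⟩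
    exact (h1.comp hFb).congr fun z hz => (hg1 z (hbc hz)).symm
  have hgout : BijOn g (U \ ball 0 1) (f '' (U \ ball 0 1)) :=
    ((hinj.mono sdiff_subset).bijOn_image).congr fun z hz => (hg2 z hz.2).symm
  have hUu : U = ball 0 1 ∪ U \ ball 0 1 := (union_sdiff_cancel (hbc.trans hBU)).symm
  refine ⟨g, ?_, ?_, hg2, ?_, ?_⟩
  · intro z hz
    have h1 : ContinuousWithinAt g (closedBall 0 1) z ∨ z ∉ closedBall (0 : ℂ) 1 := by
      by_cases hz' : z ∈ closedBall (0 : ℂ) 1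
      · left
        exact (hψc.comp hFc hFB).congr hg1 z hz'
      · exact Or.inr hz'
    have h2 : ContinuousWithinAt g (U \ ball 0 1) z ∨ z ∈ ball (0 : ℂ) 1 := by
      by_cases hz' : z ∈ ball (0 : ℂ) 1
      · exact Or.inr hz'
      · left
        exact (hc.mono sdiff_subset).congr (fun z hz => hg2 z hz.2) z ⟨hz, hz'⟩
    rcases h1 with h1 | h1
    · rcases h2 with h2 | h2
      · refine (h1.union h2).mono ?_
        intro w hw
        by_cases hw' : w ∈ ball (0 : ℂ) 1
        · exact Or.inl (hbc hw')
        · exact Or.inr ⟨hw, hw'⟩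
      · exact (h1.continuousAt (mem_of_superset (isOpen_ball.mem_nhds h2) hbc)).continuousWithinAt
    · have h3 : g =ᶠ[𝓝 z] f := by
        filter_upwards [isClosed_closedBall.isOpen_compl.mem_nhds h1] with w hw
        exact hg2 w fun h => hw (hbc h)
      exact ((hc.continuousAt (hU.mem_nhds hz)).congr h3.symm).continuousWithinAt
  · have h1 : InjOn g (ball 0 1 ∪ U \ ball 0 1) := by
      rw [injOn_union disjoint_sdiff_self_right]
      refine ⟨hgball.injOn, hgout.injOn, fun x hx y hy hxy => ?_⟩
      obtain ⟨w, hw, hwx⟩ := hgball.mapsTo hx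
      rw [hg2 y hy.2, ← hwx] at hxy
      exact hy.2 (hinj (hBU (hbc hw)) hy.1 hxy ▸ hw)
    have h2 := hgball.union hgout h1
    rwa [← image_union, ← hUu] at h2
  · intro z hz
    have hFz := hFb.mapsTo hz
    have h1 : RegAt n ψ (F z) := RegAt.of_analyticAt
      (hψd.analyticAt (isOpen_ball.mem_nhds hFz))
      (deriv_ne_zero_of_injOn isOpen_ball hψd (hψi.mono hbc) hFz)
    refine (RegAt.comp hn1 h1 (hFr z hz)).congr ?_
    filter_upwards [isOpen_ball.mem_nhds hz] with w hw
    exact hg1 w (hbc hw)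
  · intro s hs
    filter_upwards [hFS s hs] with z hz
    by_cases hz' : z ∈ closedBall (0 : ℂ) 1
    · rw [hg1 z hz', hz hz', hψG z hz']
    · exact hg2 z fun h => hz' (hbc h)

open Metric Filter Topology in
/-- A homeomorphism can be made regular on the unit disc by a modification supported in a slightly
larger disc, keeping it regular on a given compact set. -/
theorem exists_regular_on_unit_ball {n : ℕ∞} (hn : 1 ≤ n) {h : ℂ → ℂ} {U Y A C : Set ℂ} {R : ℝ}
    (hU : IsOpen U) (hY : IsOpen Y) (hh : BijOn h U Y) (hc : ContinuousOn h U)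
    (hA : IsOpen A) (hAU : A ⊆ U) (hreg : ∀ z ∈ A, RegAt n h z) (hR : 1 < R)
    (hRU : closedBall 0 1 ⊆ U) (hC : IsCompact C) (hCA : C ⊆ A) :
    ∃ g : ℂ → ℂ, ContinuousOn g U ∧ BijOn g U Y ∧ (∀ z, z ∉ ball (0 : ℂ) R → g z = h z) ∧
      ∀ z ∈ C ∪ ball 0 1, RegAt n g z := by
  have hS : IsCompact (C ∩ sphere 0 1) := hC.inter_right isClosed_sphere
  obtain ⟨f, hfc, hfb, hfh, hfr, η, hη, hfη⟩ := exists_analytic_on_circle hn hU hY hh hc hA hAU hreg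
    hR hS (inter_subset_left.trans hCA) inter_subset_right
  obtain ⟨g, hgc, hgb, hgf, hgr, hgS⟩ := exists_regular_on_ball_of_analytic hn hU hfc hfb.injOn hRU hS
    inter_subset_right (fun s hs => hfr s (hCA hs.1)) hη hfη
  rw [hfb.image_eq] at hgb
  refine ⟨g, hgc, hgb, fun z hz => ?_, fun z hz => ?_⟩
  · rw [hgf z fun h => hz (ball_subset_ball hR.le h), hfh z hz]
  · by_cases hz1 : z ∈ ball (0 : ℂ) 1
    · exact hgr z hz1
    · have hzC : z ∈ C := hz.resolve_right hz1
      refine (hfr z (hCA hzC)).congr ?_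
      by_cases hzs : z ∈ sphere (0 : ℂ) 1
      · exact hgS z ⟨hzC, hzs⟩
      · have hzB : z ∉ closedBall (0 : ℂ) 1 := by
          rw [← ball_union_sphere]; exact fun h => h.elim hz1 hzs
        filter_upwards [isClosed_closedBall.isOpen_compl.mem_nhds hzB] with w hw
        exact hgf w fun h => hw (ball_subset_closedBall h)

open Metric Filter Topology in
/-- A homeomorphism can be made regular on a disc by a modification supported in a slightly
larger disc, keeping it regular on a given compact set. -/
theorem exists_regular_on_ball {n : ℕ∞} (hn : 1 ≤ n) {h : ℂ → ℂ} {U Y C : Set ℂ} {c : ℂ}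
    {ρ ρ' : ℝ} (hU : IsOpen U) (hY : IsOpen Y) (hh : BijOn h U Y) (hc : ContinuousOn h U)
    (hρ : 0 < ρ) (hρ' : ρ < ρ') (hBU : closedBall c ρ ⊆ U) (hC : IsCompact C) (hCU : C ⊆ U)
    (hreg : ∀ z ∈ C, RegAt n h z) :
    ∃ g : ℂ → ℂ, ContinuousOn g U ∧ BijOn g U Y ∧ (∀ z, z ∉ ball c ρ' → g z = h z) ∧
      ∀ z ∈ C ∪ ball c ρ, RegAt n g z := by
  have hn1 : (1 : WithTop ℕ∞) ≤ n := by exact_mod_cast hn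
  have hρc : (ρ : ℂ) ≠ 0 := by exact_mod_cast hρ.ne'
  let T : ℂ → ℂ := fun w => c + ρ * w
  let S : ℂ → ℂ := fun z => (z - c) / ρ
  have hTS : ∀ z, T (S z) = z := fun z => by simp only [T, S]; field_simp; ring
  have hST : ∀ w, S (T w) = w := fun w => by simp only [T, S]; field_simp; ring
  have hTc : Continuous T := by fun_prop
  have hSc : Continuous S := by fun_prop
  have hnS : ∀ z, ‖S z‖ = ‖z - c‖ / ρ := fun z => by
    simp only [S, norm_div, Complex.norm_real, Real.norm_eq_abs, abs_of_pos hρ]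
  have hTr : ∀ w, RegAt n T w := fun w => by
    have h1 : HasDerivAt T (ρ * 1) w := ((hasDerivAt_id w).const_mul (ρ : ℂ)).const_add c
    exact RegAt.of_analyticAt (by fun_prop) (by rw [h1.deriv]; simpa using hρ.ne')
  have hSr : ∀ z, RegAt n S z := fun z => by
    have h1 : HasDerivAt S (1 / ρ) z := ((hasDerivAt_id z).sub_const c).div_const _
    refine RegAt.of_analyticAt ?_ (by rw [h1.deriv]; simpa using hρ.ne')
    exact (analyticAt_id.sub analyticAt_const).div analyticAt_const hρc
  have hTb : BijOn T (T ⁻¹' U) U :=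
    ⟨fun z hz => hz, fun x _ y _ hxy => by rw [← hST x, ← hST y, hxy],
      fun z hz => ⟨S z, by rw [mem_preimage, hTS]; exact hz, hTS z⟩⟩
  have hA : IsOpen {w | w ∈ T ⁻¹' U ∧ RegAt n (fun w => h (T w)) w} :=
    (hU.preimage hTc).inter (RegAt.isOpen_setOf hn1 _)
  obtain ⟨g, hgc, hgb, hgh, hgr⟩ := exists_regular_on_unit_ball (n := n) hn (h := fun w => h (T w))
    (C := S '' C) (R := ρ' / ρ) (hU.preimage hTc) hY (hh.comp hTb)
    (hc.comp hTc.continuousOn fun z hz => hz) hA (fun w hw => hw.1) (fun w hw => hw.2)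
    (by rwa [one_lt_div hρ]) (by
      intro w hw
      refine hBU ?_
      rw [mem_closedBall_zero_iff, ← hST w, hnS, div_le_one hρ] at hw
      rwa [mem_closedBall, dist_eq_norm]) (hC.image hSc) (by
      rintro _ ⟨z, hz, rfl⟩
      refine ⟨by rw [mem_preimage, hTS]; exact hCU hz, RegAt.comp hn1 ?_ (hTr _)⟩
      rw [hTS]; exact hreg z hz)
  refine ⟨fun z => g (S z), hgc.comp hSc.continuousOn fun z hz => ?_, ?_, fun z hz => ?_,
    fun z hz => RegAt.comp hn1 (hgr _ ?_) (hSr z)⟩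
  · rw [mem_preimage, hTS]; exact hz
  · refine hgb.comp ⟨fun z hz => ?_, fun x _ y _ hxy => by rw [← hTS x, ← hTS y, hxy],
      fun w hw => ⟨T w, hw, hST w⟩⟩
    rw [mem_preimage, hTS]; exact hz
  · have h1 := hgh (S z) (by
      rw [mem_ball_zero_iff, hnS, div_lt_div_iff_of_pos_right hρ]
      rwa [mem_ball, dist_eq_norm] at hz)
    rw [hTS] at h1
    exact h1
  · refine hz.imp (mem_image_of_mem _) fun h1 => ?_
    rwa [mem_ball_zero_iff, hnS, div_lt_one hρ, ← dist_eq_norm]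

theorem image_eq_of_bijOn_of_eqOn_diff {g h : ℂ → ℂ} {U Y B : Set ℂ} (hg : BijOn g U Y)
    (hh : BijOn h U Y) (hB : B ⊆ U) (heq : EqOn g h (U \ B)) : g '' B = h '' B := by
  have h1 : g '' (U \ B) = h '' (U \ B) := image_congr heq
  have h2 : g '' B = Y \ g '' (U \ B) := by
    rw [← hg.image_eq, ← hg.injOn.image_sdiff_subset sdiff_subset, sdiff_sdiff_cancel_left hB]
  have h3 : h '' B = Y \ h '' (U \ B) := by
    rw [← hh.image_eq, ← hh.injOn.image_sdiff_subset sdiff_subset, sdiff_sdiff_cancel_left hB]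
  rw [h2, h3, h1]

open Metric Filter Topology in
/-- Regularisation on finitely many disjoint discs. -/
theorem exists_regular_on_disjoint_balls {n : ℕ∞} (hn : 1 ≤ n) {ι : Type*} {h : ℂ → ℂ}
    {U Y C : Set ℂ} {c : ι → ℂ} {r₀ r₁ r₂ : ℝ} (hU : IsOpen U) (hY : IsOpen Y) (hh : BijOn h U Y)
    (hc : ContinuousOn h U) (hr₁ : 0 < r₁) (hr₀₁ : r₀ < r₁) (hr₁₂ : r₁ < r₂) (hC : IsCompact C)
    (hCU : C ⊆ U) (hreg : ∀ z ∈ C, RegAt n h z) (T : Finset ι)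
    (hTU : ∀ i ∈ T, ball (c i) r₂ ⊆ U)
    (hT : ∀ i ∈ T, ∀ j ∈ T, i ≠ j → Disjoint (ball (c i) r₂) (ball (c j) r₂)) :
    ∃ g : ℂ → ℂ, ContinuousOn g U ∧ BijOn g U Y ∧
      (∀ z, (∀ i ∈ T, z ∉ ball (c i) r₂) → g z = h z) ∧
      (∀ z ∈ C, RegAt n g z) ∧ (∀ i ∈ T, ∀ z ∈ closedBall (c i) r₀, RegAt n g z) ∧
      ∀ i ∈ T, g '' ball (c i) r₂ = h '' ball (c i) r₂ := by
  classical
  induction T using Finset.induction_on with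
  | empty => exact ⟨h, hc, hh, fun _ _ => rfl, hreg, by simp, by simp⟩
  | insert a T ha ih =>
    obtain ⟨g, hgc, hgb, hgh, hgC, hgT, hgi⟩ := ih
      (fun i hi => hTU i (Finset.mem_insert_of_mem hi))
      (fun i hi j hj => hT i (Finset.mem_insert_of_mem hi) j (Finset.mem_insert_of_mem hj))
    have hda : ∀ i ∈ T, Disjoint (ball (c a) r₂) (ball (c i) r₂) := fun i hi =>
      hT a (Finset.mem_insert_self _ _) i (Finset.mem_insert_of_mem hi) (by rintro rfl; exact ha hi)
    have hr₀₂ : r₀ < r₂ := hr₀₁.trans hr₁₂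
    obtain ⟨f, hfc, hfb, hfg, hfr⟩ := exists_regular_on_ball hn
      (C := C ∪ ⋃ i ∈ T, closedBall (c i) r₀) (c := c a) hU hY hgb hgc hr₁ hr₁₂
      ((closedBall_subset_ball hr₁₂).trans (hTU a (Finset.mem_insert_self _ _)))
      (hC.union (T.isCompact_biUnion fun i _ => isCompact_closedBall _ _))
      (union_subset hCU (iUnion₂_subset fun i hi => (closedBall_subset_ball hr₀₂).trans
        (hTU i (Finset.mem_insert_of_mem hi)))) (by
        rintro z (hz | hz)
        · exact hgC z hz
        · obtain ⟨i, hi, hz⟩ := mem_iUnion₂.1 hz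
          exact hgT i hi z hz)
    refine ⟨f, hfc, hfb, fun z hz => ?_, fun z hz => hfr z (Or.inl (Or.inl hz)), ?_, ?_⟩
    · rw [hfg z (hz a (Finset.mem_insert_self _ _)),
        hgh z fun i hi => hz i (Finset.mem_insert_of_mem hi)]
    · intro i hi z hz
      rcases Finset.mem_insert.1 hi with rfl | hi
      · exact hfr z (Or.inr (closedBall_subset_ball hr₀₁ hz))
      · exact hfr z (Or.inl (Or.inr (mem_iUnion₂.2 ⟨i, hi, hz⟩)))
    · intro i hi
      rcases Finset.mem_insert.1 hi with rfl | hi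
      · rw [image_eq_of_bijOn_of_eqOn_diff hfb hgb (hTU _ (Finset.mem_insert_self _ _))
          fun z hz => hfg z hz.2]
        exact image_congr fun z hz => hgh z fun j hj hzj => (hda j hj).le_bot ⟨hz, hzj⟩
      · rw [← hgi i hi]
        exact image_congr fun z hz => hfg z fun hza => (hda i hi).le_bot ⟨hza, hz⟩

open Metric Filter Topology in
/-- Regularisation on finitely many discs which are disjoint within each of finitely many
colours. -/
theorem exists_regular_on_coloured_balls {n : ℕ∞} (hn : 1 ≤ n) {ι κ : Type*} [DecidableEq κ]
    {h : ℂ → ℂ}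
    {U Y C : Set ℂ} {c : ι → ℂ} {r₀ r₁ r₂ : ℝ} (hU : IsOpen U) (hY : IsOpen Y) (hh : BijOn h U Y)
    (hc : ContinuousOn h U) (hr₁ : 0 < r₁) (hr₀₁ : r₀ < r₁) (hr₁₂ : r₁ < r₂) (hC : IsCompact C)
    (hCU : C ⊆ U) (hreg : ∀ z ∈ C, RegAt n h z) (T : Finset ι)
    (hTU : ∀ i ∈ T, ball (c i) r₂ ⊆ U) (col : ι → κ)
    (hT : ∀ i ∈ T, ∀ j ∈ T, col i = col j → i ≠ j → Disjoint (ball (c i) r₂) (ball (c j) r₂))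
    (Q : Finset κ) :
    ∃ g : ℂ → ℂ, ContinuousOn g U ∧ BijOn g U Y ∧
      (∀ z, (∀ i ∈ T, z ∉ ball (c i) r₂) → g z = h z) ∧
      (∀ z ∈ C, RegAt n g z) ∧ (∀ i ∈ T, col i ∈ Q → ∀ z ∈ closedBall (c i) r₀, RegAt n g z) ∧
      ∀ z ∈ U, ∃ w ∈ U, dist z w ≤ Q.card * (2 * r₂) ∧ g z = h w := by
  induction Q using Finset.induction_on with
  | empty => exact ⟨h, hc, hh, fun _ _ => rfl, hreg, by simp, fun z hz => ⟨z, hz, by simp, rfl⟩⟩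
  | insert a Q ha ih =>
    obtain ⟨g, hgc, hgb, hgh, hgC, hgT, hgw⟩ := ih
    have hr₀₂ : r₀ < r₂ := hr₀₁.trans hr₁₂
    obtain ⟨f, hfc, hfb, hfg, hfC, hfT, hfi⟩ := exists_regular_on_disjoint_balls hn
      (C := C ∪ ⋃ i ∈ T.filter fun i => col i ∈ Q, closedBall (c i) r₀) (c := c) hU hY hgb hgc hr₁
      hr₀₁ hr₁₂
      (hC.union (Finset.isCompact_biUnion _ fun i _ => isCompact_closedBall _ _))
      (union_subset hCU (iUnion₂_subset fun i hi => (closedBall_subset_ball hr₀₂).trans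
        (hTU i (Finset.mem_filter.1 hi).1))) (by
        rintro z (hz | hz)
        · exact hgC z hz
        · obtain ⟨i, hi, hz⟩ := mem_iUnion₂.1 hz
          exact hgT i (Finset.mem_filter.1 hi).1 (Finset.mem_filter.1 hi).2 z hz)
      (T.filter fun i => col i = a) (fun i hi => hTU i (Finset.mem_filter.1 hi).1)
      (fun i hi j hj => hT i (Finset.mem_filter.1 hi).1 j (Finset.mem_filter.1 hj).1
        ((Finset.mem_filter.1 hi).2.trans (Finset.mem_filter.1 hj).2.symm))
    refine ⟨f, hfc, hfb, fun z hz => ?_, fun z hz => hfC z (Or.inl hz), ?_, ?_⟩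
    · rw [hfg z fun i hi => hz i (Finset.mem_filter.1 hi).1, hgh z hz]
    · intro i hi hic z hz
      rcases Finset.mem_insert.1 hic with hia | hiQ
      · exact hfT i (Finset.mem_filter.2 ⟨hi, hia⟩) z hz
      · exact hfC z (Or.inr (mem_iUnion₂.2 ⟨i, Finset.mem_filter.2 ⟨hi, hiQ⟩, hz⟩))
    · intro z hz
      obtain ⟨y, hyU, hzy, hfy⟩ : ∃ y ∈ U, dist z y ≤ 2 * r₂ ∧ f z = g y := by
        by_cases hex : ∃ i ∈ T.filter fun i => col i = a, z ∈ ball (c i) r₂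
        · obtain ⟨i, hi, hzi⟩ := hex
          have h1 : f z ∈ g '' ball (c i) r₂ := by rw [← hfi i hi]; exact mem_image_of_mem _ hzi
          obtain ⟨y, hy, hyz⟩ := h1
          refine ⟨y, hTU i (Finset.mem_filter.1 hi).1 hy, ?_, hyz.symm⟩
          rw [mem_ball] at hzi hy
          linarith [dist_triangle_right z y (c i)]
        · push Not at hex
          exact ⟨z, hz, by rw [dist_self]; linarith, hfg z hex⟩
      obtain ⟨w, hw, hyw, hgw'⟩ := hgw y hyU
      refine ⟨w, hw, ?_, hfy.trans hgw'⟩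
      rw [Finset.card_insert_of_notMem ha]
      push_cast
      linarith [dist_triangle z y w]

theorem exists_grid_near {s : ℝ} (hs : 0 < s) (z : ℂ) :
    ∃ i : ℤ × ℤ, dist z (s * (i.1 + i.2 * Complex.I)) < 4 / 5 * s := by
  refine ⟨(round (z.re / s), round (z.im / s)), ?_⟩
  have h1 := abs_sub_round (z.re / s)
  have h2 := abs_sub_round (z.im / s)
  have key : ∀ x : ℝ, |x / s - round (x / s)| ≤ 1 / 2 →
      (x - s * round (x / s)) ^ 2 ≤ s ^ 2 / 4 := by
    intro x hx
    have h3 : x - s * round (x / s) = s * (x / s - round (x / s)) := by field_simp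
    rw [h3, mul_pow]
    have h4 : (x / s - round (x / s)) ^ 2 ≤ (1 / 2) ^ 2 := sq_le_sq' (abs_le.1 hx).1 (abs_le.1 hx).2
    nlinarith [sq_nonneg s]
  rw [dist_eq_norm]
  refine lt_of_pow_lt_pow_left₀ 2 (by positivity) ?_
  rw [← Complex.normSq_eq_norm_sq, Complex.normSq_apply]
  have h5 := key _ h1
  have h6 := key _ h2
  simp only [Complex.sub_re, Complex.sub_im, Complex.mul_re, Complex.mul_im, Complex.add_re,
    Complex.add_im, Complex.ofReal_re, Complex.ofReal_im, Complex.intCast_re, Complex.intCast_im,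
    Complex.I_re, Complex.I_im]
  ring_nf at h5 h6 ⊢
  nlinarith [sq_pos_of_pos hs]

theorem two_le_abs_of_zmod_eq {m n : ℤ} (h : (m : ZMod 2) = n) (hne : m ≠ n) :
    2 ≤ |(m : ℝ) - n| := by
  rw [ZMod.intCast_eq_intCast_iff_dvd_sub] at h
  have h1 : (2 : ℤ) ≤ |m - n| := by
    obtain ⟨k, hk⟩ := h
    have : m - n ≠ 0 := sub_ne_zero.2 hne
    push_cast at hk
    rw [le_abs]
    omega
  exact_mod_cast h1

open Metric in
theorem disjoint_grid_balls {s r : ℝ} (hs : 0 < s) (hr : r ≤ s) {i j : ℤ × ℤ} (hij : i ≠ j)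
    (h1 : (i.1 : ZMod 2) = j.1) (h2 : (i.2 : ZMod 2) = j.2) :
    Disjoint (ball ((s : ℂ) * (i.1 + i.2 * Complex.I)) r)
      (ball ((s : ℂ) * (j.1 + j.2 * Complex.I)) r) := by
  apply ball_disjoint_ball
  rw [dist_eq_norm]
  set w : ℂ := (s : ℂ) * (i.1 + i.2 * Complex.I) - s * (j.1 + j.2 * Complex.I) with hw
  have hre : w.re = s * ((i.1 : ℝ) - j.1) := by simp [hw]; ring
  have him : w.im = s * ((i.2 : ℝ) - j.2) := by simp [hw]; ring
  by_cases h3 : i.1 = j.1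
  · have h4 : i.2 ≠ j.2 := fun h => hij (Prod.ext h3 h)
    have h5 := two_le_abs_of_zmod_eq h2 h4
    have h6 := Complex.abs_im_le_norm w
    rw [him, abs_mul, abs_of_pos hs] at h6
    nlinarith
  · have h5 := two_le_abs_of_zmod_eq h1 h3
    have h6 := Complex.abs_re_le_norm w
    rw [hre, abs_mul, abs_of_pos hs] at h6
    nlinarith

open Metric Filter Topology in
/-- A homeomorphism between plane open sets which is regular off a compact set can be perturbed
near that set to one which is regular everywhere. -/
theorem exists_regular_approx {n : ℕ∞} (hn : 1 ≤ n) {h : ℂ → ℂ} {U Y A : Set ℂ} {δ : ℝ}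
    (hU : IsOpen U) (hY : IsOpen Y) (hh : BijOn h U Y) (hc : ContinuousOn h U)
    (hreg : ∀ z ∈ A, RegAt n h z) (hD : IsCompact (U \ A)) (hδ : 0 < δ) :
    ∃ g : ℂ → ℂ, ContinuousOn g U ∧ BijOn g U Y ∧
      (∀ z, (∀ w ∈ U \ A, δ ≤ dist z w) → g z = h z) ∧ (∀ z ∈ U, RegAt n g z) ∧
      ∀ z ∈ U, ∃ w ∈ U, dist z w ≤ δ ∧ g z = h w := by
  classical
  obtain ⟨δ₀, hδ₀, hδU⟩ := hD.exists_cthickening_subset_open hU sdiff_subset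
  set D := U \ A with hDdef
  obtain ⟨s, hs, hs1, hs2⟩ : ∃ s > 0, 8 * s ≤ δ ∧ 2 * s ≤ δ₀ :=
    ⟨min (δ / 8) (δ₀ / 8), by positivity, by linarith [min_le_left (δ / 8) (δ₀ / 8)],
      by linarith [min_le_right (δ / 8) (δ₀ / 8)]⟩
  let c : ℤ × ℤ → ℂ := fun i => s * (i.1 + i.2 * Complex.I)
  obtain ⟨T₀, hT₀⟩ := hD.elim_finite_subcover (fun i => ball (c i) (4 / 5 * s))
    (fun _ => isOpen_ball) fun z _ => by
      obtain ⟨i, hi⟩ := exists_grid_near hs z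
      exact mem_iUnion.2 ⟨i, hi⟩
  let T := T₀.filter fun i => (ball (c i) (4 / 5 * s) ∩ D).Nonempty
  have hnear : ∀ i ∈ T, ∀ z ∈ ball (c i) (9 / 10 * s), ∃ w ∈ D, dist z w < 2 * s := by
    intro i hi z hz
    obtain ⟨w, hw, hwD⟩ := (Finset.mem_filter.1 hi).2
    refine ⟨w, hwD, ?_⟩
    rw [mem_ball] at hz hw
    linarith [dist_triangle_right z w (c i)]
  have hTN : ∀ i ∈ T, ball (c i) (9 / 10 * s) ⊆ cthickening (2 * s) D := by
    intro i hi z hz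
    obtain ⟨w, hw, hzw⟩ := hnear i hi z hz
    exact mem_cthickening_of_dist_le z w _ D hw hzw.le
  have hNU : cthickening (2 * s) D ⊆ U := (cthickening_mono hs2 D).trans hδU
  have hDN : D ⊆ cthickening (2 * s) D := self_subset_cthickening D
  let C := cthickening (2 * s) D \ ⋃ i ∈ T, ball (c i) (4 / 5 * s)
  have hC : IsCompact C :=
    hD.cthickening.diff (isOpen_biUnion fun i _ => isOpen_ball)
  have hCA : ∀ z ∈ C, z ∈ A := by
    intro z hz
    by_contra hzA
    have hzD : z ∈ D := ⟨hNU hz.1, hzA⟩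
    obtain ⟨i, hi, hzi⟩ := mem_iUnion₂.1 (hT₀ hzD)
    exact hz.2 (mem_iUnion₂.2 ⟨i, Finset.mem_filter.2 ⟨hi, z, hzi, hzD⟩, hzi⟩)
  obtain ⟨g, hgc, hgb, hgh, hgC, hgT, hgw⟩ := exists_regular_on_coloured_balls hn
    (c := c) (r₀ := 4 / 5 * s) (r₁ := 17 / 20 * s) (r₂ := 9 / 10 * s) hU hY hh hc (by positivity)
    (by linarith) (by linarith) hC (fun z hz => hNU hz.1) (fun z hz => hreg z (hCA z hz)) T
    (fun i hi => (hTN i hi).trans hNU)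
    (fun i => ((i.1 : ZMod 2), (i.2 : ZMod 2)))
    (fun i _ j _ hcol hij => disjoint_grid_balls hs (by linarith) hij (congrArg Prod.fst hcol)
      (congrArg Prod.snd hcol)) Finset.univ
  refine ⟨g, hgc, hgb, fun z hz => hgh z fun i hi hzi => ?_, fun z hz => ?_, fun z hz => ?_⟩
  · obtain ⟨w, hw, hzw⟩ := hnear i hi z hzi
    linarith [hz w hw]
  · by_cases hzN : z ∈ cthickening (2 * s) D
    · by_cases hzT : z ∈ ⋃ i ∈ T, ball (c i) (4 / 5 * s)
      · obtain ⟨i, hi, hzi⟩ := mem_iUnion₂.1 hzT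
        exact hgT i hi (Finset.mem_univ _) z (ball_subset_closedBall hzi)
      · exact hgC z ⟨hzN, hzT⟩
    · have hzA : z ∈ A := by
        by_contra hzA
        exact hzN (hDN ⟨hz, hzA⟩)
      refine (hreg z hzA).congr ?_
      filter_upwards [isClosed_cthickening.isOpen_compl.mem_nhds hzN] with w hw
      exact hgh w fun i hi hwi => hw (hTN i hi hwi)
  · obtain ⟨w, hw, hzw, hgw'⟩ := hgw z hz
    refine ⟨w, hw, hzw.trans ?_, hgw'⟩
    have : (Finset.univ : Finset (ZMod 2 × ZMod 2)).card = 4 := rfl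
    rw [this]
    push_cast
    linarith

theorem det_fderiv_ne_zero_of_leftInverse {g h : ℂ → ℂ} {U : Set ℂ} (hU : IsOpen U) {x : ℂ}
    (hx : x ∈ U) (hh : DifferentiableAt ℝ h x) (hg : DifferentiableAt ℝ g (h x))
    (hinv : ∀ z ∈ U, g (h z) = z) : (fderiv ℝ h x).det ≠ 0 := by
  have h1 : fderiv ℝ (fun z => g (h z)) x = (fderiv ℝ g (h x)).comp (fderiv ℝ h x) :=
    fderiv_comp x hg hh
  have h2 : (fun z => g (h z)) =ᶠ[nhds x] id := by
    filter_upwards [hU.mem_nhds hx] with z hz using hinv z hz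
  rw [h2.fderiv_eq, fderiv_id] at h1
  have h3 := congrArg ContinuousLinearMap.det h1
  intro h4
  have h5 : ((fderiv ℝ g (h x)).comp (fderiv ℝ h x)).det
      = (fderiv ℝ g (h x)).det * (fderiv ℝ h x).det := by
    simp [ContinuousLinearMap.det, LinearMap.det_comp]
  rw [h5, h4, mul_zero] at h3
  simp [ContinuousLinearMap.det] at h3

theorem bijOn_interior {h h' : ℂ → ℂ} {M : Set ℂ} (hbij : BijOn h M M) (hcont : ContinuousOn h M)
    (hinv : InvOn h' h M M) (hcont' : ContinuousOn h' M) :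
    BijOn h (interior M) (interior M) := by
  have hm' : MapsTo h' M M := by
    intro y hy
    obtain ⟨x, hx, rfl⟩ := hbij.surjOn hy
    rw [hinv.1 hx]; exact hx
  have key : ∀ f : ℂ → ℂ, ContinuousOn f M → InjOn f M → MapsTo f M M →
      MapsTo f (interior M) (interior M) := by
    intro f hf hi hm
    have h1 : f '' interior M ⊆ interior M := interior_maximal
      (by rintro _ ⟨x, hx, rfl⟩; exact hm (interior_subset hx))
      (isOpen_image_of_injOn isOpen_interior (hf.mono interior_subset) (hi.mono interior_subset))
    exact fun x hx => h1 (mem_image_of_mem _ hx)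
  refine ⟨key h hcont hbij.injOn hbij.mapsTo, hbij.injOn.mono interior_subset, fun y hy =>
    ⟨h' y, key h' hcont' hinv.2.injOn hm' hy, hinv.2 (interior_subset hy)⟩⟩

open Metric Filter Topology in
/-- The approximation theorem for compact subsets of `ℂ`, with closeness expressed through
displacement of the argument. -/
theorem exists_regular_approx_of_isCompact {n : ℕ∞} (hn : 1 ≤ n) {M K V : Set ℂ} {h h' : ℂ → ℂ}
    {δ₀ : ℝ} (hM : IsCompact M) (hK : IsCompact K) (hbd : M \ interior M ⊆ K)
    (hbij : BijOn h M M) (hcont : ContinuousOn h M) (hinv : InvOn h' h M M)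
    (hcont' : ContinuousOn h' M) (hV : IsOpen V) (hKV : K ⊆ V)
    (hd : ContDiffOn ℝ n h (V ∩ interior M)) (hd' : ContDiffOn ℝ n h' (h '' (V ∩ interior M)))
    (hδ₀ : 0 < δ₀) :
    ∃ g g' : ℂ → ℂ, BijOn g M M ∧ ContinuousOn g M ∧ InvOn g' g M M ∧ ContinuousOn g' M ∧
      (∀ x ∈ M, ∃ w ∈ M, dist x w ≤ δ₀ ∧ g x = h w) ∧
      (∃ W : Set ℂ, IsOpen W ∧ K ⊆ W ∧ EqOn g h W) ∧
      BijOn g (interior M) (interior M) ∧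
      ContDiffOn ℝ n g (interior M) ∧ ContDiffOn ℝ n g' (interior M) := by
  have hn1 : (1 : WithTop ℕ∞) ≤ n := by exact_mod_cast hn
  have hn0 : (n : WithTop ℕ∞) ≠ 0 := by intro h; simp [h] at hn1
  have hIM : interior M ⊆ M := interior_subset
  have hhI := bijOn_interior hbij hcont hinv hcont'
  have hA : IsOpen (V ∩ interior M) := hV.inter isOpen_interior
  have hAM : V ∩ interior M ⊆ M := inter_subset_right.trans hIM
  have hhA : IsOpen (h '' (V ∩ interior M)) :=
    isOpen_image_of_injOn hA (hcont.mono hAM) (hbij.injOn.mono hAM)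
  have hreg : ∀ z ∈ V ∩ interior M, RegAt n h z := by
    intro z hz
    refine RegAt.of_isOpen hA hz hd (det_fderiv_ne_zero_of_leftInverse (g := h') hA hz
      ((hd.contDiffAt (hA.mem_nhds hz)).differentiableAt hn0)
      ((hd'.contDiffAt (hhA.mem_nhds (mem_image_of_mem _ hz))).differentiableAt hn0)
      fun w hw => hinv.1 (hAM hw))
  have hDeq : interior M \ (V ∩ interior M) = M \ V := by
    ext z
    constructor
    · exact fun hz => ⟨hIM hz.1, fun hzV => hz.2 ⟨hzV, hz.1⟩⟩
    · intro hz
      refine ⟨?_, fun h => hz.2 h.1⟩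
      by_contra h
      exact hz.2 (hKV (hbd ⟨hz.1, h⟩))
  have hD : IsCompact (interior M \ (V ∩ interior M)) := by rw [hDeq]; exact hM.diff hV
  have hdisj : Disjoint K (interior M \ (V ∩ interior M)) := by
    rw [hDeq, disjoint_left]; exact fun z hz h => h.2 (hKV hz)
  obtain ⟨δ₁, hδ₁, hδd⟩ := hdisj.exists_thickenings hK hD.isClosed
  obtain ⟨g, hgc, hgb, hgh, hgr, hgw⟩ := exists_regular_approx hn (δ := min δ₀ δ₁)
    isOpen_interior isOpen_interior hhI (hcont.mono hIM) hreg hD (lt_min hδ₀ hδ₁)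
  have hgW : EqOn g h (thickening δ₁ K) := by
    intro z hz
    refine hgh z fun w hw => ?_
    by_contra hlt
    have h1 : dist z w < δ₁ := (not_le.1 hlt).trans_le (min_le_right _ _)
    exact disjoint_left.1 hδd hz (mem_thickening_iff.2 ⟨w, hw, h1⟩)
  have hKW : K ⊆ thickening δ₁ K := self_subset_thickening hδ₁ K
  have hbdW : M \ interior M ⊆ thickening δ₁ K := hbd.trans hKW
  have hhB : BijOn h (M \ interior M) (M \ interior M) := by
    refine ⟨fun x hx => ⟨hbij.mapsTo hx.1, fun hy => ?_⟩, hbij.injOn.mono sdiff_subset, ?_⟩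
    · obtain ⟨w, hw, hwx⟩ := hhI.surjOn hy
      exact hx.2 (hbij.injOn (hIM hw) hx.1 hwx ▸ hw)
    · intro y hy
      obtain ⟨x, hx, rfl⟩ := hbij.surjOn hy.1
      exact ⟨x, ⟨hx, fun hxI => hy.2 (hhI.mapsTo hxI)⟩, rfl⟩
  have hgB : BijOn g (M \ interior M) (M \ interior M) :=
    hhB.congr fun z hz => (hgW (hbdW hz)).symm
  have hgM : BijOn g M M := by
    have h1 := hgb.union hgB (by
      rw [injOn_union disjoint_sdiff_self_right]
      refine ⟨hgb.injOn, hgB.injOn, fun x hx y hy hxy => ?_⟩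
      exact (hgB.mapsTo hy).2 (hxy ▸ hgb.mapsTo hx))
    rwa [union_sdiff_cancel hIM] at h1
  have hgcM : ContinuousOn g M := by
    intro z hz
    by_cases hzI : z ∈ interior M
    · exact (hgc.continuousAt (isOpen_interior.mem_nhds hzI)).continuousWithinAt
    · refine (hcont z hz).congr_of_eventuallyEq ?_ (hgW (hbdW ⟨hz, hzI⟩))
      exact mem_nhdsWithin_of_mem_nhds (mem_of_superset
        (isOpen_thickening.mem_nhds (hbdW ⟨hz, hzI⟩)) hgW)
  have hinvg : InvOn (Function.invFunOn g M) g M M := hgM.invOn_invFunOn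
  refine ⟨g, Function.invFunOn g M, hgM, hgcM, hinvg, ?_, fun x hx => ?_,
    ⟨_, isOpen_thickening, hKW, hgW⟩, hgb,
    fun z hz => (hgr z hz).contDiffAt.contDiffWithinAt, ?_⟩
  · have h1 := continuousOn_leftInverse_of_isCompact hM hgcM hgM.injOn fun x hx => hinvg.1 hx
    rwa [hgM.image_eq] at h1
  · by_cases hxI : x ∈ interior M
    · obtain ⟨w, hw, hxw, hgx⟩ := hgw x hxI
      exact ⟨w, hIM hw, hxw.trans (min_le_left _ _), hgx⟩
    · exact ⟨x, hx, by rw [dist_self]; exact hδ₀.le, hgW (hbdW ⟨hx, hxI⟩)⟩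
  · intro y hy
    obtain ⟨x, hx, rfl⟩ := hgb.surjOn hy
    exact (RegAt.leftInverse (n := n) hn1 isOpen_interior hx hgb.injOn hgc
      (fun z hz => hinvg.1 (hIM hz)) (hgr x hx)).contDiffAt.contDiffWithinAt

/-- Let `M ⊆ ℝ²` be a compact topological 2-manifold with boundary, `K ⊆ M` a compact
set containing the boundary of `M`, and `h : M → M` a homeomorphism (with inverse `h'`)
which is a `C^r` diffeomorphism on a neighbourhood `V` of `K`.  Then for every `ε > 0`
there is a homeomorphism `g : M → M` (with inverse `g'`) which is `ε`-close to `h`,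
agrees with `h` on a neighbourhood `W` of `K`, and restricts to a `C^r` diffeomorphism
of the interior of `M` onto itself. -/
theorem approx_homeo_by_interior_diffeo (r : ℕ∞) (hr : 1 ≤ r)
    (M K : Set (ℝ × ℝ)) (hMc : IsCompact M) (hMm : IsTopManifoldWithBoundary2 M)
    (hKc : IsCompact K) (hKM : K ⊆ M) (hbd : M \ interior M ⊆ K)
    (h h' : (ℝ × ℝ) → (ℝ × ℝ))
    (hbij : Set.BijOn h M M) (hcont : ContinuousOn h M)
    (hinv : Set.InvOn h' h M M) (hcont' : ContinuousOn h' M)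
    (hdiff : ∃ V : Set (ℝ × ℝ), IsOpen V ∧ K ⊆ V ∧
      ContDiffOn ℝ r h (V ∩ interior M) ∧
      ContDiffOn ℝ r h' (h '' (V ∩ interior M)))
    (ε : ℝ) (hε : 0 < ε) :
    ∃ g g' : (ℝ × ℝ) → (ℝ × ℝ),
      Set.BijOn g M M ∧ ContinuousOn g M ∧
      Set.InvOn g' g M M ∧ ContinuousOn g' M ∧
      (∀ x ∈ M, dist (g x) (h x) < ε) ∧
      (∃ W : Set (ℝ × ℝ), IsOpen W ∧ K ⊆ W ∧ Set.EqOn g h (W ∩ M)) ∧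
      Set.BijOn g (interior M) (interior M) ∧
      ContDiffOn ℝ r g (interior M) ∧ ContDiffOn ℝ r g' (interior M) := by
  obtain ⟨V, hV, hKV, hd, hd'⟩ := hdiff
  let P : ℂ ≃L[ℝ] ℝ × ℝ := Complex.equivRealProdCLM
  have hPi : P ⁻¹' interior M = interior (P ⁻¹' M) := P.toHomeomorph.preimage_interior M
  have hPS : ∀ x, P (P.symm x) = x := P.apply_symm_apply
  have hSP : ∀ z, P.symm (P z) = z := P.symm_apply_apply
  have hcompact : ∀ S : Set (ℝ × ℝ), IsCompact S → IsCompact (P ⁻¹' S) := fun S hS =>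
    P.toHomeomorph.isCompact_preimage.2 hS
  have hcP : ContinuousOn (fun z => h (P z)) (P ⁻¹' M) :=
    hcont.comp P.continuous.continuousOn fun z hz => hz
  obtain ⟨δ, hδ, hδε⟩ := Metric.uniformContinuousOn_iff.1
    ((hcompact M hMc).uniformContinuousOn_of_continuous hcP) ε hε
  have conj : ∀ f : ℝ × ℝ → ℝ × ℝ, ContinuousOn f M →
      ContinuousOn (fun z => P.symm (f (P z))) (P ⁻¹' M) := fun f hf =>
    P.symm.continuous.comp_continuousOn (hf.comp P.continuous.continuousOn fun z hz => hz)
  have conj' : ∀ f : ℂ → ℂ, ContinuousOn f (P ⁻¹' M) →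
      ContinuousOn (fun x => P (f (P.symm x))) M := fun f hf =>
    P.continuous.comp_continuousOn (hf.comp P.symm.continuous.continuousOn
      fun x hx => by rwa [mem_preimage, hPS])
  have bconj : ∀ (f : ℂ → ℂ) (S : Set (ℝ × ℝ)), BijOn f (P ⁻¹' S) (P ⁻¹' S) →
      BijOn (fun x => P (f (P.symm x))) S S := by
    intro f S hf
    refine ⟨fun x hx => hf.mapsTo (by rwa [mem_preimage, hPS]), fun x hx y hy hxy => ?_,
      fun y hy => ?_⟩
    · exact P.symm.injective (hf.injOn (by rwa [mem_preimage, hPS]) (by rwa [mem_preimage, hPS])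
        (P.injective hxy))
    · obtain ⟨z, hz, hzy⟩ := hf.surjOn (show P.symm y ∈ P ⁻¹' S by rwa [mem_preimage, hPS])
      exact ⟨P z, hz, by simp only [hSP, hzy, hPS]⟩
  have hbijC : BijOn (fun z => P.symm (h (P z))) (P ⁻¹' M) (P ⁻¹' M) := by
    refine ⟨fun z hz => ?_, fun x hx y hy hxy => ?_, fun y hy => ?_⟩
    · rw [mem_preimage, hPS]; exact hbij.mapsTo hz
    · exact P.injective (hbij.injOn hx hy (P.symm.injective hxy))
    · obtain ⟨x, hx, hxy⟩ := hbij.surjOn hy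
      exact ⟨P.symm x, by rwa [mem_preimage, hPS], by simp only [hPS, hxy, hSP]⟩
  have himg : (fun z => P.symm (h (P z))) '' (P ⁻¹' V ∩ interior (P ⁻¹' M)) ⊆
      P ⁻¹' (h '' (V ∩ interior M)) := by
    rintro _ ⟨z, hz, rfl⟩
    rw [← hPi] at hz
    exact ⟨P z, hz, (hPS _).symm⟩
  obtain ⟨g, g', hgb, hgc, hgi, hgc', hgw, ⟨W, hW, hKW, hgW⟩, hgI, hgd, hgd'⟩ :=
    exists_regular_approx_of_isCompact (n := r) hr (M := P ⁻¹' M) (K := P ⁻¹' K) (V := P ⁻¹' V)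
      (h := fun z => P.symm (h (P z))) (h' := fun z => P.symm (h' (P z))) (δ₀ := δ / 2)
      (hcompact M hMc) (hcompact K hKc) (by
        rw [← hPi]; exact fun z hz => hbd ⟨hz.1, hz.2⟩) hbijC (conj h hcont)
      ⟨fun z hz => by simp only [hPS, hinv.1 hz, hSP],
        fun z hz => by simp only [hPS, hinv.2 hz, hSP]⟩
      (conj h' hcont') (hV.preimage P.continuous) (fun z hz => hKV hz)
      (P.symm.contDiff.comp_contDiffOn (hd.comp P.contDiff.contDiffOn fun z hz => by
        rw [← hPi] at hz; exact hz))
      (P.symm.contDiff.comp_contDiffOn (hd'.comp P.contDiff.contDiffOn himg)) (by positivity)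
  rw [← hPi] at hgI hgd hgd'
  refine ⟨fun x => P (g (P.symm x)), fun x => P (g' (P.symm x)), bconj g M hgb, conj' g hgc,
    ⟨fun x hx => ?_, fun x hx => ?_⟩, conj' g' hgc', fun x hx => ?_,
    ⟨P.symm ⁻¹' W, hW.preimage P.symm.continuous, fun x hx => hKW ?_, fun x hx => ?_⟩,
    bconj g _ hgI, ?_, ?_⟩
  · simp only [hSP, hgi.1 (show P.symm x ∈ P ⁻¹' M by rwa [mem_preimage, hPS]), hPS]
  · simp only [hSP, hgi.2 (show P.symm x ∈ P ⁻¹' M by rwa [mem_preimage, hPS]), hPS]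
  · have hxM : P.symm x ∈ P ⁻¹' M := by rwa [mem_preimage, hPS]
    obtain ⟨w, hw, hxw, hgx⟩ := hgw _ hxM
    have h1 := hδε w hw (P.symm x) hxM (by rw [dist_comm]; linarith)
    simp only [hgx, hPS] at h1 ⊢
    exact h1
  · rwa [mem_preimage, hPS]
  · have h1 := hgW hx.1
    simp only [hPS] at h1
    simp only [h1, hPS]
  · exact P.contDiff.comp_contDiffOn (hgd.comp P.symm.contDiff.contDiffOn fun x hx => by
      rwa [mem_preimage, hPS])
  · exact P.contDiff.comp_contDiffOn (hgd'.comp P.symm.contDiff.contDiffOn fun x hx => by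
      rwa [mem_preimage, hPS])

end
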